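/- Let φ: (R,m,k) → (S,n,ℓ) be a local ring homomorphism between commutative Noetherian local rings which is essentially of finite type and complete intersection at n, and let M be a finitely generated S-module. If cidim-fd_R M < ∞, then cidim_S M < ∞. -/

import Mathlib

/-!
Common definitions: André–Quillen homology via the standard (comonad/polynomial)
simplicial resolution, complete-intersection (flat) dimensions via quasi-deformations,
Cohen factorizations, Koszul homology `H₁`, and related notions.
-/

universe u

open TensorProduct IsLocalRing

noncomputable section

/-! ### Flat and projective dimension -/

/-- `FlatDimLE Q n N` : the `Q`-module `N` has flat dimension at most `n`,
i.e. it admits a flat resolution of length at most `n`. -/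
def FlatDimLE (Q : Type u) [CommRing Q] : ℕ → (N : Type u) → [AddCommGroup N] → [Module Q N] → Prop
  | 0, N, _, _ => Module.Flat Q N
  | n+1, N, _, _ =>
      ∃ (F : Type u) (_ : AddCommGroup F) (_ : Module Q F) (f : F →ₗ[Q] N),
        Module.Flat Q F ∧ Function.Surjective f ∧ FlatDimLE Q n (LinearMap.ker f)

/-- `ProjDimLE Q n N` : the `Q`-module `N` has projective dimension at most `n`. -/
def ProjDimLE (Q : Type u) [CommRing Q] : ℕ → (N : Type u) → [AddCommGroup N] → [Module Q N] → Prop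
  | 0, N, _, _ => Module.Projective Q N
  | n+1, N, _, _ =>
      ∃ (F : Type u) (_ : AddCommGroup F) (_ : Module Q F) (f : F →ₗ[Q] N),
        Module.Projective Q F ∧ Function.Surjective f ∧ ProjDimLE Q n (LinearMap.ker f)

/-- The flat dimension `fd_Q N` is finite. -/
def FlatDimFinite (Q : Type u) [CommRing Q] (N : Type u) [AddCommGroup N] [Module Q N] : Prop :=
  ∃ n : ℕ, FlatDimLE Q n N

/-- The projective dimension `pd_Q N` is finite. -/
def ProjDimFinite (Q : Type u) [CommRing Q] (N : Type u) [AddCommGroup N] [Module Q N] : Prop :=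
  ∃ n : ℕ, ProjDimLE Q n N

/-! ### Regular sequences, regular local rings, complete intersection conditions -/

/-- The ideal `I` is generated by an `A`-regular sequence. -/
def GeneratedByRegularSequence (A : Type u) [CommRing A] (I : Ideal A) : Prop :=
  ∃ rs : List A, RingTheory.Sequence.IsRegular A rs ∧ Ideal.span {x | x ∈ rs} = I

/-- A (Noetherian local) ring is regular iff its maximal ideal is generated by a
regular sequence. -/
def IsRegularLocal (A : Type u) [CommRing A] : Prop :=
  IsNoetherianRing A ∧
    ∃ h : IsLocalRing A, GeneratedByRegularSequence A (@IsLocalRing.maximalIdeal A _ h)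

/-- A local homomorphism is weakly regular if it is flat with regular closed fibre. -/
def IsWeaklyRegularHom (A B : Type u) [CommRing A] [CommRing B] [IsLocalRing A]
    (f : A →+* B) : Prop :=
  IsLocalHom f ∧ (letI := f.toAlgebra; Module.Flat A B) ∧
    IsRegularLocal (B ⧸ Ideal.map f (maximalIdeal A))

/-- `R'' → f → g` is a Cohen factorization of the semi-completion of `ψ : A → B`
with respect to the (maximal) ideal `J` of `B`:  `A → R'' → B̂` with `A → R''`
weakly regular, `R''` complete Noetherian local and `R'' → B̂` surjective local. -/
def IsCohenFactorizationAt (A B : Type u) [CommRing A] [CommRing B] [IsLocalRing A]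
    (ψ : A →+* B) (J : Ideal B) (R'' : Type u) [CommRing R'']
    (f : A →+* R'') (g : R'' →+* AdicCompletion J B) : Prop :=
  g.comp f = (algebraMap B (AdicCompletion J B)).comp ψ ∧
  IsNoetherianRing R'' ∧
  (∃ h : IsLocalRing R'', IsAdicComplete (@IsLocalRing.maximalIdeal R'' _ h) R'') ∧
  IsWeaklyRegularHom A R'' f ∧
  Function.Surjective g ∧ IsLocalHom g

/-- `ψ : A → B` is complete intersection (c.i.) at the ideal `J` (typically the
maximal ideal of `B`): in a Cohen factorization `A → R'' → B̂` of the
semi-completion of `ψ`, the kernel of `R'' → B̂` is generated by a regular sequence. -/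
def IsCIAt (A B : Type u) [CommRing A] [CommRing B] [IsLocalRing A]
    (ψ : A →+* B) (J : Ideal B) : Prop :=
  ∃ (R'' : Type u) (_ : CommRing R'') (f : A →+* R'') (g : R'' →+* AdicCompletion J B),
    IsCohenFactorizationAt A B ψ J R'' f g ∧ GeneratedByRegularSequence R'' (RingHom.ker g)

/-- A Noetherian local ring is a complete intersection if its completion is the
quotient of a complete regular local ring by an ideal generated by a regular sequence. -/
def IsCompleteIntersectionRing (A : Type u) [CommRing A] : Prop :=
  IsNoetherianRing A ∧
  ∃ h : IsLocalRing A,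
    ∃ (Q : Type u) (_ : CommRing Q)
      (g : Q →+* AdicCompletion (@IsLocalRing.maximalIdeal A _ h) A),
      IsRegularLocal Q ∧ (∃ hq : IsLocalRing Q, IsAdicComplete (@IsLocalRing.maximalIdeal Q _ hq) Q) ∧
      Function.Surjective g ∧ GeneratedByRegularSequence Q (RingHom.ker g)

/-! ### Complete intersection (flat) dimensions via quasi-deformations

`R → R' ← Q` is a quasi-deformation when `R → R'` is flat local and `Q → R'` is
surjective local with kernel generated by a `Q`-regular sequence (all rings
Noetherian local).  The various complete intersection (flat) dimensions
`CI-fd`, `CI-dim`, `CI*-fd`, `CI*-dim`, `cidim-fd`, `cidim` of a module `M` are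
`inf { fd_Q(R' ⊗_R M) - pd_Q R' }` over (upper / complete intersection)
quasi-deformations; such a dimension is finite iff there is a quasi-deformation
of the appropriate kind for which both `fd_Q (R' ⊗_R M)` and `pd_Q R'` are finite. -/

/-- The conditions on `R → R' ← Q` making it a quasi-deformation. -/
def IsQuasiDeformation (R R' Q : Type u) [CommRing R] [CommRing R'] [CommRing Q]
    (f : R →+* R') (g : Q →+* R') : Prop :=
  IsLocalRing R' ∧ IsLocalRing Q ∧ IsNoetherianRing R' ∧ IsNoetherianRing Q ∧
  IsLocalHom f ∧ IsLocalHom g ∧ (letI := f.toAlgebra; Module.Flat R R') ∧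
  Function.Surjective g ∧ GeneratedByRegularSequence Q (RingHom.ker g)

/-- `CI-fd_R M < ∞` (equivalently, for finitely generated `M`, `CI-dim_R M < ∞`):
there is a quasi-deformation `R → R' ← Q` with `fd_Q (R' ⊗_R M)` and `pd_Q R'` finite. -/
def HasFiniteCIDim (R : Type u) [CommRing R] (M : Type u) [AddCommGroup M] [Module R M] : Prop :=
  ∃ (R' Q : Type u) (_ : CommRing R') (_ : CommRing Q) (f : R →+* R') (g : Q →+* R'),
    IsQuasiDeformation R R' Q f g ∧
    (letI := f.toAlgebra;
     letI := g.toAlgebra;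
     letI : Module Q (R' ⊗[R] M) := Module.compHom _ g;
     FlatDimFinite Q (R' ⊗[R] M) ∧ ProjDimFinite Q R')

/-- `CI*-fd_R M < ∞` (resp. `CI*-dim_R M < ∞`): as in `HasFiniteCIDim` but over
upper quasi-deformations, i.e. `R → R'` is weakly regular. -/
def HasFiniteUpperCIDim (R : Type u) [CommRing R] [IsLocalRing R]
    (M : Type u) [AddCommGroup M] [Module R M] : Prop :=
  ∃ (R' Q : Type u) (_ : CommRing R') (_ : CommRing Q) (f : R →+* R') (g : Q →+* R'),
    IsQuasiDeformation R R' Q f g ∧ IsWeaklyRegularHom R R' f ∧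
    (letI := f.toAlgebra;
     letI := g.toAlgebra;
     letI : Module Q (R' ⊗[R] M) := Module.compHom _ g;
     FlatDimFinite Q (R' ⊗[R] M) ∧ ProjDimFinite Q R')

/-- `cidim-fd_R M < ∞` (resp. `cidim_R M < ∞`): as in `HasFiniteCIDim` but over
complete intersection quasi-deformations, i.e. `R → R'` is c.i. at the maximal
ideal of `R'`. -/
def HasFiniteCIQDDim (R : Type u) [CommRing R] [IsLocalRing R]
    (M : Type u) [AddCommGroup M] [Module R M] : Prop :=
  ∃ (R' Q : Type u) (_ : CommRing R') (_ : CommRing Q) (hR' : IsLocalRing R')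
    (f : R →+* R') (g : Q →+* R'),
    IsQuasiDeformation R R' Q f g ∧
    IsCIAt R R' f (@IsLocalRing.maximalIdeal R' _ hR') ∧
    (letI := f.toAlgebra;
     letI := g.toAlgebra;
     letI : Module Q (R' ⊗[R] M) := Module.compHom _ g;
     FlatDimFinite Q (R' ⊗[R] M) ∧ ProjDimFinite Q R')

/-! ### André–Quillen homology

`D_n(S|R, M)` is defined as the `n`-th homology of `L ⊗_S M`, where `L` is the
cotangent complex of the `R`-algebra `S`: the complex associated to the standard
simplicial resolution `X` of `S` by polynomial `R`-algebras (the comonad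
resolution `X_n = G^{n+1} S`, `G A = R[A]`), with `L_n = S ⊗_{X_n} Ω_{X_n/R}`
the free `S`-module on the variables of `X_n` and differentials the alternating
sums of the maps induced by the face maps. -/

/-- `AQV R S n` is, for `n ≥ 1`, the `n`-th ring in the standard simplicial
polynomial resolution of `S` over `R` (and `AQV R S 0 = S` as an index set). -/
def AQV (R S : Type u) [CommRing R] : ℕ → Type u
  | 0 => S
  | n+1 => MvPolynomial (AQV R S n) R

noncomputable instance (R S : Type u) [CommRing R] (n : ℕ) : CommRing (AQV R S (n+1)) :=
  inferInstanceAs (CommRing (MvPolynomial (AQV R S n) R))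

noncomputable instance (R S : Type u) [CommRing R] (n : ℕ) : Algebra R (AQV R S (n+1)) :=
  inferInstanceAs (Algebra R (MvPolynomial (AQV R S n) R))

/-- The augmentations `X_n → S` of the standard resolution. -/
def AQaug (R S : Type u) [CommRing R] [CommRing S] [Algebra R S] :
    (n : ℕ) → (AQV R S (n+1) →ₐ[R] S)
  | 0 => MvPolynomial.aeval (id : S → S)
  | n+1 => MvPolynomial.aeval (fun v : AQV R S (n+1) => AQaug R S n v)

/-- The face maps `dᵢ : X_{n+1} → X_n` of the standard resolution: `d₀` is the
counit and `d_{i+1} = G(dᵢ)`. -/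
def AQface (R S : Type u) [CommRing R] [CommRing S] [Algebra R S] :
    (n : ℕ) → (i : ℕ) → (AQV R S (n+2) →ₐ[R] AQV R S (n+1))
  | n, 0 => MvPolynomial.aeval (id : AQV R S (n+1) → AQV R S (n+1))
  | 0, _+1 => MvPolynomial.rename ⇑(AQaug R S 0)
  | n+1, i+1 => MvPolynomial.rename ⇑(AQface R S n i)

variable (R S : Type u) [CommRing R] [CommRing S] [Algebra R S]
variable (M : Type u) [AddCommGroup M] [Module S M]

/-- The map `L_{n+1} ⊗ M → L_n ⊗ M` induced by an `R`-algebra map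
`f : X_{n+1} → X_n` on the (base-changed) Kähler differentials: the free module
on the variables `v` of `X_{n+1}` maps by `e_v ↦ ∑_w aug(∂(f Xᵥ)/∂w) • e_w`. -/
def AQind (n : ℕ) (f : AQV R S (n+2) →ₐ[R] AQV R S (n+1)) :
    (AQV R S (n+1) →₀ M) →ₗ[S] (AQV R S n →₀ M) :=
  Finsupp.lsum S fun v : AQV R S (n+1) =>
    letI : DecidableEq (AQV R S n) := Classical.decEq _
    let P : MvPolynomial (AQV R S n) R := f (MvPolynomial.X v)
    ∑ w ∈ P.vars,
      (Finsupp.lsingle w).comp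
        ((AQaug R S n ((MvPolynomial.pderiv w) P) : S) • (LinearMap.id : M →ₗ[S] M))

/-- The differential `L_{n+1} ⊗ M → L_n ⊗ M` of the cotangent complex:
the alternating sum of the maps induced by the face maps. -/
def AQdiff (n : ℕ) : (AQV R S (n+1) →₀ M) →ₗ[S] (AQV R S n →₀ M) :=
  ∑ i ∈ Finset.range (n+2), ((-1 : ℤ)^i) • AQind R S M n (AQface R S n i)

/-- Cycles of the cotangent complex with coefficients in `M`. -/
def AQcycles : (n : ℕ) → Submodule S (AQV R S n →₀ M)
  | 0 => ⊤
  | n+1 => LinearMap.ker (AQdiff R S M n)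

/-- André–Quillen homology `D_n(S|R, M)`. -/
def AQH (n : ℕ) : Type u :=
  AQcycles R S M n ⧸
    (LinearMap.range (AQdiff R S M n)).comap (AQcycles R S M n).subtype

noncomputable instance (n : ℕ) : AddCommGroup (AQH R S M n) :=
  inferInstanceAs (AddCommGroup (AQcycles R S M n ⧸
    (LinearMap.range (AQdiff R S M n)).comap (AQcycles R S M n).subtype))

/-- `AQdimLE R S d`: the André–Quillen dimension of the `R`-algebra `S` is at
most `d`, i.e. `D_n(S|R, -) = 0` for all `n > d`. -/
def AQdimLE (d : ℕ) : Prop :=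
  ∀ n : ℕ, d < n → ∀ (N : Type u) (iN : AddCommGroup N) (mN : Module S N),
    Subsingleton (@AQH R S _ _ _ N iN mN n)

/-- `AQ-dim_R S < ∞`. -/
def AQdimFinite : Prop := ∃ d : ℕ, AQdimLE R S d

/-! ### Koszul homology `H₁` -/

/-- First differential of the Koszul complex on `x : Fin c → A`. -/
def koszulD1 (A : Type u) [CommRing A] {c : ℕ} (x : Fin c → A) : (Fin c → A) →ₗ[A] A :=
  ∑ i, x i • (LinearMap.proj i : ((Fin c → A)) →ₗ[A] A)

/-- One-cycles of the Koszul complex on `x`. -/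
def koszulZ1 (A : Type u) [CommRing A] {c : ℕ} (x : Fin c → A) : Submodule A (Fin c → A) :=
  LinearMap.ker (koszulD1 A x)

/-- One-boundaries of the Koszul complex on `x` (the image of the second Koszul
differential, spanned by the elements `xᵢ eⱼ - xⱼ eᵢ`). -/
def koszulB1 (A : Type u) [CommRing A] {c : ℕ} (x : Fin c → A) : Submodule A (Fin c → A) :=
  Submodule.span A
    {v : Fin c → A | ∃ i j, v =
      x i • (Pi.single j (1 : A) : Fin c → A) - x j • (Pi.single i (1 : A) : Fin c → A)}

/-- First Koszul homology of the sequence `x : Fin c → A`. -/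
def KoszulH1 (A : Type u) [CommRing A] {c : ℕ} (x : Fin c → A) : Type u :=
  koszulZ1 A x ⧸ (koszulB1 A x).comap (koszulZ1 A x).subtype

noncomputable instance (A : Type u) [CommRing A] {c : ℕ} (x : Fin c → A) :
    AddCommGroup (KoszulH1 A x) :=
  inferInstanceAs (AddCommGroup (koszulZ1 A x ⧸ (koszulB1 A x).comap (koszulZ1 A x).subtype))

noncomputable instance (A : Type u) [CommRing A] {c : ℕ} (x : Fin c → A) :
    Module A (KoszulH1 A x) :=
  inferInstanceAs (Module A (koszulZ1 A x ⧸ (koszulB1 A x).comap (koszulZ1 A x).subtype))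

/-- `H₁(K(σ))` is a free `T̂`-module:  for any Cohen factorization
`S → S'' → T̂` of the semi-completion of `σ` and any finite generating set `x` of
`ker (S'' → T̂)`, the first Koszul homology of `x`, base-changed to `T̂`
(it is killed by `ker (S'' → T̂)`), is a free `T̂`-module. -/
def KoszulH1FreeHom (S T : Type u) [CommRing S] [CommRing T] [IsLocalRing S] [IsLocalRing T]
    (σ : S →+* T) : Prop :=
  ∀ (S'' : Type u) (_ : CommRing S'') (f : S →+* S'')
    (g : S'' →+* AdicCompletion (maximalIdeal T) T),
    IsCohenFactorizationAt S T σ (maximalIdeal T) S'' f g →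
    ∀ (c : ℕ) (x : Fin c → S''), Ideal.span (Set.range x) = RingHom.ker g →
      (letI := g.toAlgebra;
       Module.Free (AdicCompletion (maximalIdeal T) T)
         ((AdicCompletion (maximalIdeal T) T) ⊗[S''] (KoszulH1 S'' x)))

/-! ### Separability (MacLane) -/

/-- A field extension `ℓ/k` is separable (in the sense of MacLane, allowing
non-algebraic extensions) iff `K ⊗_k ℓ` is reduced for every field extension `K/k`. -/
def IsSeparableFieldExtension (k ℓ : Type u) [Field k] [Field ℓ] [Algebra k ℓ] : Prop :=
  ∀ (K : Type u) (_ : Field K) (_ : Algebra k K), IsReduced (K ⊗[k] ℓ)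

end


section FD
variable {A : Type u} [CommRing A]

lemma flat_ker {F G : Type u} [AddCommGroup F] [AddCommGroup G] [Module A F] [Module A G]
    [Module.Flat A F] [Module.Flat A G] (f : F →ₗ[A] G) (hf : Function.Surjective f) :
    Module.Flat A (LinearMap.ker f) := by
  rw [Module.Flat.iff_rTensor_preserves_injective_linearMap]
  intro N N' _ _ _ _ h hh
  have h1 := LinearMap.lTensor_injective_of_exact_of_flat f hf _ (LinearMap.ker f).subtype_injective
    (LinearMap.exact_subtype_ker_map f) N
  have h3 := Module.Flat.rTensor_preserves_injective_linearMap (M := F) h hh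
  have h4 := h3.comp h1
  have : (h.rTensor F) ∘ ((LinearMap.ker f).subtype.lTensor N) =
      ((LinearMap.ker f).subtype.lTensor N') ∘ (h.rTensor (LinearMap.ker f)) := by
    rw [← LinearMap.coe_comp, ← LinearMap.coe_comp, LinearMap.rTensor_comp_lTensor,
      LinearMap.lTensor_comp_rTensor]
  rw [this] at h4
  exact h4.of_comp

lemma flat_ext {F G : Type u} [AddCommGroup F] [AddCommGroup G] [Module A F] [Module A G]
    [Module.Flat A G] (f : F →ₗ[A] G) (hf : Function.Surjective f)
    [Module.Flat A (LinearMap.ker f)] : Module.Flat A F := by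
  rw [Module.Flat.iff_rTensor_preserves_injective_linearMap]
  intro N N' _ _ _ _ h hh
  have e1 := LinearMap.exact_subtype_ker_map f
  have h2 := LinearMap.lTensor_injective_of_exact_of_flat f hf _ (LinearMap.ker f).subtype_injective
    e1 N'
  rw [injective_iff_map_eq_zero]
  intro x hx
  have c1 : ∀ x, (f.lTensor N') (h.rTensor F x) = h.rTensor G (f.lTensor N x) := fun x => by
    rw [← LinearMap.comp_apply, LinearMap.lTensor_comp_rTensor, ← LinearMap.rTensor_comp_lTensor]
    rfl
  have c2 : ∀ x, ((LinearMap.ker f).subtype.lTensor N') (h.rTensor _ x) =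
      h.rTensor F ((LinearMap.ker f).subtype.lTensor N x) := fun x => by
    rw [← LinearMap.comp_apply, LinearMap.lTensor_comp_rTensor, ← LinearMap.rTensor_comp_lTensor]
    rfl
  have h4 : f.lTensor N x = 0 := by
    apply Module.Flat.rTensor_preserves_injective_linearMap (M := G) h hh
    rw [← c1, hx, map_zero, map_zero]
  obtain ⟨k, rfl⟩ := ((lTensor_exact N e1 hf) x).1 h4
  rw [← c2] at hx
  have h5 := h2 (hx.trans (map_zero _).symm)
  rw [Module.Flat.rTensor_preserves_injective_linearMap h hh (h5.trans (map_zero _).symm), map_zero]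

lemma FlatDimLE.of_equiv : ∀ {n : ℕ} {N N' : Type u} [AddCommGroup N] [AddCommGroup N'] [Module A N]
    [Module A N'] (_ : N ≃ₗ[A] N'), FlatDimLE A n N → FlatDimLE A n N'
  | 0, N, N', _, _, _, _, e, h => by
    have : Module.Flat A N := h
    exact (Module.Flat.of_linearEquiv e.symm : Module.Flat A N')
  | n+1, N, N', _, _, _, _, e, ⟨F, _, _, f, h1, h2, h3⟩ => by
    refine ⟨F, _, _, e.toLinearMap.comp f, h1, e.surjective.comp h2, ?_⟩
    have : LinearMap.ker (e.toLinearMap.comp f) = LinearMap.ker f := by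
      ext; simp
    rw [this]; exact h3

/-- a restriction `ker (f ∘ h) → ker f` with kernel `ker h` -/
noncomputable def kerRestr {F E G : Type u} [AddCommGroup F] [AddCommGroup E] [AddCommGroup G]
    [Module A F] [Module A E] [Module A G] (h : F →ₗ[A] E) (f : E →ₗ[A] G) :
    LinearMap.ker (f.comp h) →ₗ[A] LinearMap.ker f :=
  h.restrict (fun x hx => by simpa using hx)

lemma kerRestr_surj {F E G : Type u} [AddCommGroup F] [AddCommGroup E] [AddCommGroup G]
    [Module A F] [Module A E] [Module A G] (h : F →ₗ[A] E) (f : E →ₗ[A] G)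
    (hs : Function.Surjective h) : Function.Surjective (kerRestr h f) := by
  rintro ⟨x, hx⟩
  obtain ⟨y, rfl⟩ := hs x
  exact ⟨⟨y, by simpa using hx⟩, Subtype.ext rfl⟩

noncomputable def kerRestr_ker {F E G : Type u} [AddCommGroup F] [AddCommGroup E] [AddCommGroup G]
    [Module A F] [Module A E] [Module A G] (h : F →ₗ[A] E) (f : E →ₗ[A] G) :
    LinearMap.ker h ≃ₗ[A] LinearMap.ker (kerRestr h f) :=
  LinearEquiv.ofBijective
    (LinearMap.codRestrict _ (LinearMap.codRestrict _ (LinearMap.ker h).subtype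
      (fun x => by simp)) (fun x => by
        rw [LinearMap.mem_ker]; exact Subtype.ext x.2)) (by
    constructor
    · intro x y hxy
      have h1 := Subtype.ext_iff.1 hxy
      have h2 := Subtype.ext_iff.1 h1
      exact Subtype.ext h2
    · rintro ⟨⟨x, h1⟩, h2⟩
      exact ⟨⟨x, congrArg Subtype.val h2⟩, rfl⟩)

lemma FlatDimLE.ker : ∀ {n : ℕ} {E G : Type u} [AddCommGroup E] [AddCommGroup G] [Module A E]
    [Module A G] [Module.Flat A G] (f : E →ₗ[A] G), Function.Surjective f →
    FlatDimLE A n E → FlatDimLE A n (LinearMap.ker f)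
  | 0, E, G, _, _, _, _, _, f, hf, h => by
    have : Module.Flat A E := h
    exact flat_ker f hf
  | n+1, E, G, _, _, _, _, _, f, hf, ⟨F, _, _, h, h1, h2, h3⟩ =>
    ⟨_, _, _, kerRestr h f, flat_ker _ (by simpa using hf.comp h2), kerRestr_surj h f h2,
      h3.of_equiv (kerRestr_ker h f)⟩

lemma flatDim_ext_aux {F E G : Type u} [AddCommGroup F] [AddCommGroup E] [AddCommGroup G]
    [Module A F] [Module A E] [Module A G] [Module.Flat A F] [Module.Flat A G]
    (f : E →ₗ[A] G) (hf : Function.Surjective f) (h : F →ₗ[A] LinearMap.ker f)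
    (h2 : Function.Surjective h) :
    ∃ ψ : F × (E →₀ A) →ₗ[A] E, Module.Flat A (F × (E →₀ A)) ∧ Function.Surjective ψ ∧
      ∃ (H Z : Type u) (_ : AddCommGroup H) (_ : AddCommGroup Z) (_ : Module A H) (_ : Module A Z)
        (g : Z →ₗ[A] H), Module.Flat A H ∧ Function.Surjective g ∧
        Nonempty (LinearMap.ker h ≃ₗ[A] LinearMap.ker g) ∧ Nonempty (Z ≃ₗ[A] LinearMap.ker ψ) := by
  let φ : (E →₀ A) →ₗ[A] E := Finsupp.linearCombination A id
  have hφ : Function.Surjective φ :=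
    Finsupp.linearCombination_surjective _ Function.surjective_id
  have hfk : Module.Flat A (LinearMap.ker (f.comp φ)) := flat_ker _ (by simpa using hf.comp hφ)
  let ψ : F × (E →₀ A) →ₗ[A] E := ((LinearMap.ker f).subtype.comp h).coprod φ
  have hfl : Module.Flat A (F × (E →₀ A)) := by
    have e : F ≃ₗ[A] LinearMap.ker (LinearMap.snd A F (E →₀ A)) := by
      rw [← LinearMap.range_inl]
      exact LinearEquiv.ofInjective _ LinearMap.inl_injective
    have : Module.Flat A (LinearMap.ker (LinearMap.snd A F (E →₀ A))) :=
      Module.Flat.of_linearEquiv e.symm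
    exact flat_ext (LinearMap.snd A F (E →₀ A)) LinearMap.snd_surjective
  let g : LinearMap.ker ψ →ₗ[A] LinearMap.ker (f.comp φ) :=
    (LinearMap.snd A F (E →₀ A)).restrict (fun x hx => by
      have : (h x.1 : E) + φ x.2 = 0 := by simpa [ψ] using hx
      have h5 : f (h x.1) = 0 := (h x.1).2
      simpa [h5] using congrArg f this)
  refine ⟨ψ, hfl, ?_, LinearMap.ker (f.comp φ), LinearMap.ker ψ, inferInstance, inferInstance,
    inferInstance, inferInstance, g, hfk, ?_, ⟨?_⟩, ⟨LinearEquiv.refl _ _⟩⟩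
  · intro x
    obtain ⟨y, rfl⟩ := hφ x
    exact ⟨(0, y), by simp [ψ]⟩
  · rintro ⟨y, hy⟩
    obtain ⟨x, hx⟩ := h2 (-⟨φ y, by simpa using hy⟩)
    exact ⟨⟨(x, y), by simp [ψ, hx]⟩, Subtype.ext rfl⟩
  · refine LinearEquiv.ofBijective (LinearMap.codRestrict _ (LinearMap.codRestrict _
      ((LinearMap.inl A F (E →₀ A)).comp (LinearMap.ker h).subtype) ?_) ?_) ⟨?_, ?_⟩
    · intro x; simp [ψ]
    · intro x; exact Subtype.ext rfl
    · intro x y hxy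
      exact Subtype.ext (Prod.ext_iff.1 (Subtype.ext_iff.1 (Subtype.ext_iff.1 hxy))).1
    · rintro ⟨⟨⟨x, y⟩, h6⟩, h7⟩
      have h8 : y = 0 := congrArg Subtype.val h7
      subst h8
      refine ⟨⟨x, ?_⟩, rfl⟩
      have : (h x : E) + φ 0 = 0 := by simpa [ψ] using h6
      exact Subtype.ext (by simpa using this)

lemma FlatDimLE.ext {n : ℕ} : ∀ {E G : Type u} [AddCommGroup E] [AddCommGroup G] [Module A E]
    [Module A G] [Module.Flat A G] (f : E →ₗ[A] G), Function.Surjective f →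
    FlatDimLE A n (LinearMap.ker f) → FlatDimLE A n E := by
  induction n with
  | zero =>
    intro E G _ _ _ _ _ f hf h
    have : Module.Flat A (LinearMap.ker f) := h
    exact flat_ext f hf
  | succ n ih =>
    intro E G _ _ _ _ _ f hf h
    obtain ⟨F, _, _, h, h1, h2, h3⟩ := h
    obtain ⟨ψ, a1, a2, H, Z, _, _, _, _, g, a3, a4, ⟨e⟩, ⟨e'⟩⟩ := flatDim_ext_aux f hf h h2
    have h4 := ih g a4 (h3.of_equiv e)
    exact ⟨F × (E →₀ A), inferInstance, inferInstance, ψ, a1, a2, h4.of_equiv e'⟩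

lemma FlatDimLE.indep {n : ℕ} {N F : Type u} [AddCommGroup N] [AddCommGroup F] [Module A N]
    [Module A F] [Module.Flat A F] (f : F →ₗ[A] N) (hf : Function.Surjective f)
    (h : FlatDimLE A (n+1) N) : FlatDimLE A n (LinearMap.ker f) := by
  obtain ⟨F₂, _, _, g, h1, h2, h3⟩ := h
  let ψ : F × F₂ →ₗ[A] N := f.coprod (-g)
  have hψ : ∀ x, x ∈ LinearMap.ker ψ ↔ f x.1 = g x.2 := fun x => by
    simp [ψ, ← sub_eq_add_neg, sub_eq_zero]
  let a : LinearMap.ker ψ →ₗ[A] F := (LinearMap.fst A F F₂).comp (LinearMap.ker ψ).subtype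
  let b : LinearMap.ker ψ →ₗ[A] F₂ := (LinearMap.snd A F F₂).comp (LinearMap.ker ψ).subtype
  have ha : Function.Surjective a := fun x => by
    obtain ⟨y, hy⟩ := h2 (f x)
    exact ⟨⟨(x, y), (hψ _).2 hy.symm⟩, rfl⟩
  have hb : Function.Surjective b := fun y => by
    obtain ⟨x, hx⟩ := hf (g y)
    exact ⟨⟨(x, y), (hψ _).2 hx⟩, rfl⟩
  have e1 : LinearMap.ker g ≃ₗ[A] LinearMap.ker a := by
    refine LinearEquiv.ofBijective (LinearMap.codRestrict _ (LinearMap.codRestrict _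
        ((LinearMap.inr A F F₂).comp (LinearMap.ker g).subtype) ?_) ?_) ⟨?_, ?_⟩
    · intro x; rw [hψ]; simp
    · intro x; rfl
    · intro x y hxy
      exact Subtype.ext (Prod.ext_iff.1 (Subtype.ext_iff.1 (Subtype.ext_iff.1 hxy))).2
    · rintro ⟨⟨⟨x, y⟩, h6⟩, h7⟩
      have h8 : x = 0 := h7
      subst h8
      rw [hψ] at h6
      exact ⟨⟨y, by simpa using h6.symm⟩, rfl⟩
  have e2 : LinearMap.ker b ≃ₗ[A] LinearMap.ker f := by
    refine LinearEquiv.symm (LinearEquiv.ofBijective (LinearMap.codRestrict _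
      (LinearMap.codRestrict _ ((LinearMap.inl A F F₂).comp (LinearMap.ker f).subtype) ?_) ?_)
        ⟨?_, ?_⟩)
    · intro x; rw [hψ]; simp
    · intro x; rfl
    · intro x y hxy
      exact Subtype.ext (Prod.ext_iff.1 (Subtype.ext_iff.1 (Subtype.ext_iff.1 hxy))).1
    · rintro ⟨⟨⟨x, y⟩, h6⟩, h7⟩
      have h8 : y = 0 := h7
      subst h8
      rw [hψ] at h6
      exact ⟨⟨x, by simpa using h6⟩, rfl⟩
  exact (FlatDimLE.ker b hb (FlatDimLE.ext a ha (h3.of_equiv e1))).of_equiv e2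

lemma FlatDimLE.tensor (B : Type u) [CommRing B] [Algebra A B] [Module.Flat A B] :
    ∀ {n : ℕ} {N : Type u} [AddCommGroup N] [Module A N], FlatDimLE A n N →
      FlatDimLE B n (B ⊗[A] N)
  | 0, N, _, _, h => by
    have : Module.Flat A N := h
    exact (inferInstance : Module.Flat B (B ⊗[A] N))
  | n+1, N, _, _, ⟨F, _, _, f, h1, h2, h3⟩ =>
    ⟨B ⊗[A] F, _, _, f.baseChange B, inferInstance, LinearMap.lTensor_surjective B h2,
      (FlatDimLE.tensor B h3).of_equiv (LinearMap.tensorKerEquiv B B f)⟩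

lemma FlatDimLE.isBaseChange {B : Type u} [CommRing B] [Algebra A B] [Module.Flat A B]
    {n : ℕ} {N N' : Type u} [AddCommGroup N] [Module A N] [AddCommGroup N'] [Module A N']
    [Module B N'] [IsScalarTower A B N'] {f : N →ₗ[A] N'} (hf : IsBaseChange B f)
    (h : FlatDimLE A n N) : FlatDimLE B n N' :=
  (h.tensor B).of_equiv hf.equiv

open Polynomial in
lemma flatDimLE_poly_zero {N : Type u} [AddCommGroup N] [Module A N] [Module A[X] N]
    [IsScalarTower A A[X] N] [Module.Flat A N] : FlatDimLE A[X] 1 N := by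
  let xN : N →ₗ[A] N := LinearMap.restrictScalars A (LinearMap.lsmul A[X] N X)
  let δ : (A[X] ⊗[A] N) →ₗ[A[X]] (A[X] ⊗[A] N) := (X : A[X]) • LinearMap.id - xN.baseChange A[X]
  let π : (A[X] ⊗[A] N) →ₗ[A[X]] N := LinearMap.liftBaseChange A[X] (LinearMap.id : N →ₗ[A] N)
  have hδ : ∀ p n, δ (p ⊗ₜ n) = (X * p) ⊗ₜ n - p ⊗ₜ ((X : A[X]) • n) := fun p n => by
    simp only [δ, LinearMap.sub_apply, LinearMap.smul_apply, LinearMap.id_apply, smul_tmul',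
      LinearMap.baseChange_tmul, smul_eq_mul]; rfl
  have hπ : ∀ p n, π (p ⊗ₜ n) = p • n := fun p n => by
    simp only [π, LinearMap.liftBaseChange_tmul]; rfl
  have hπs : Function.Surjective π := fun n => ⟨1 ⊗ₜ n, by simp [hπ]⟩
  have h1 : ∀ t, π (δ t) = 0 := by
    intro t
    induction t with
    | zero => simp
    | add x y hx hy => simp [hx, hy]
    | tmul p n => rw [hδ, map_sub, hπ, hπ, smul_smul, mul_comm, sub_self]
  have h2 : ∀ (p : A[X]) (n : N), p ⊗ₜ n - (1 : A[X]) ⊗ₜ[A] (p • n) ∈ LinearMap.range δ := by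
    intro p
    induction p using Polynomial.induction_on' with
    | add p q hp hq =>
      intro n
      convert add_mem (hp n) (hq n) using 1
      rw [add_tmul, add_smul, tmul_add]; abel
    | monomial k a =>
      induction k with
      | zero =>
        intro n
        convert zero_mem (LinearMap.range δ) using 1
        have : (monomial 0 a : A[X]) = algebraMap A A[X] a := rfl
        rw [this, algebraMap_smul, Algebra.algebraMap_eq_smul_one, smul_tmul, sub_self]
      | succ k ih =>
        intro n
        have e : (monomial (k+1) a : A[X]) = X * monomial k a := by
          rw [X_mul_monomial]
        have := add_mem (ih ((X : A[X]) • n)) (LinearMap.mem_range_self δ (monomial k a ⊗ₜ n))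
        rw [hδ] at this
        convert this using 1
        rw [e, mul_comm, mul_smul]; abel
  have h3 : ∀ t, t - (1 : A[X]) ⊗ₜ[A] (π t) ∈ LinearMap.range δ := by
    intro t
    induction t with
    | zero => simp
    | add x y hx hy =>
      convert add_mem hx hy using 1
      rw [map_add, tmul_add]; abel
    | tmul p n => rw [hπ]; exact h2 p n
  have hinj : Function.Injective δ := by
    let e := PolynomialModule.polynomialTensorProductLEquivPolynomialModule A N
    have he : ∀ p n i, (e (p ⊗ₜ n)).coeff i = p.coeff i • n := by
      intro p n i
      have : e (p ⊗ₜ n) = p • PolynomialModule.single A 0 n := by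
        simp [e, PolynomialModule.polynomialTensorProductLEquivPolynomialModule]; rfl
      rw [this, PolynomialModule.smul_single_apply]; simp
    have hc : ∀ i t, (e (δ t)).coeff (i+1) =
        (e t).coeff i - (X : A[X]) • (e t).coeff (i+1) := by
      intro i t
      induction t with
      | zero => simp
      | add x y hx hy =>
        simp only [map_add, PolynomialModule.coeff_add, Finsupp.add_apply, hx, hy, smul_add]; abel
      | tmul p n =>
        have : ∀ x y : PolynomialModule A N, (x - y).coeff = x.coeff - y.coeff := fun _ _ => rfl
        rw [hδ, map_sub, this, Finsupp.sub_apply, he, he, he, he, coeff_X_mul,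
          smul_comm (p.coeff (i + 1)) (X : A[X]) n]
    rw [injective_iff_map_eq_zero]
    intro t ht
    apply e.injective
    rw [map_zero]
    by_contra hne
    have hfs : (e t).coeff ≠ 0 := fun h => hne (by simpa using h)
    obtain ⟨i, hi, hmax⟩ := Finset.exists_max_image _ id (Finsupp.support_nonempty_iff.2 hfs)
    have hi' : (e t).coeff i ≠ 0 := by simpa using hi
    have h0 : (e t).coeff (i+1) = 0 := by
      by_contra h
      have := hmax (i+1) (by simpa using h)
      simp at this
    have := hc i t
    rw [ht, h0] at this
    simp at this
    exact hi' this.symm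
  refine ⟨_, _, _, π, inferInstance, hπs, ?_⟩
  have hk : LinearMap.ker π = LinearMap.range δ := by
    ext t; constructor
    · intro h; simpa [LinearMap.mem_ker.1 h] using h3 t
    · rintro ⟨s, rfl⟩; exact h1 s
  rw [hk]
  exact (Module.Flat.of_linearEquiv (LinearEquiv.ofInjective δ hinj).symm : Module.Flat _ _)

open Polynomial in
lemma FlatDimLE.poly : ∀ {n : ℕ} {N : Type u} [AddCommGroup N] [Module A N] [Module A[X] N]
    [IsScalarTower A A[X] N], FlatDimLE A n N → FlatDimLE A[X] (n+1) N
  | 0, N, _, _, _, _, h => by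
    have : Module.Flat A N := h
    exact flatDimLE_poly_zero
  | n+1, N, _, _, _, _, h => by
    let φ : (N →₀ A[X]) →ₗ[A[X]] N := Finsupp.linearCombination A[X] id
    have hφ : Function.Surjective φ :=
      Finsupp.linearCombination_surjective _ Function.surjective_id
    refine ⟨_, _, _, φ, inferInstance, hφ, ?_⟩
    have hi := FlatDimLE.indep (A := A) (φ.restrictScalars A) hφ h
    have : IsScalarTower A A[X] (LinearMap.ker φ) :=
      ⟨fun a p x => Subtype.ext (smul_assoc a p x.1)⟩
    exact FlatDimLE.poly (n := n) (N := LinearMap.ker φ) hi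

lemma flatDimLE_succ : ∀ {n : ℕ} {N : Type u} [AddCommGroup N] [Module A N],
    FlatDimLE A n N → FlatDimLE A (n+1) N
  | 0, N, _, _, h => by
    refine ⟨N, _, _, LinearMap.id, h, Function.surjective_id, ?_⟩
    rw [LinearMap.ker_id]
    exact (inferInstance : Module.Flat A (⊥ : Submodule A N))
  | n+1, N, _, _, ⟨F, _, _, f, h1, h2, h3⟩ => ⟨F, _, _, f, h1, h2, flatDimLE_succ h3⟩
end FD

section RS
open RingTheory.Sequence
variable {A B : Type u} [CommRing A] [CommRing B]

lemma grs_iff {I : Ideal A} : GeneratedByRegularSequence A I ↔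
    I ≠ ⊤ ∧ ∃ rs : List A, IsWeaklyRegular A rs ∧ Ideal.ofList rs = I := by
  constructor
  · rintro ⟨rs, h, rfl⟩
    refine ⟨fun h' => h.top_ne_smul ?_, rs, h.toIsWeaklyRegular, rfl⟩
    rw [smul_eq_mul, Ideal.mul_top]; exact h'.symm
  · rintro ⟨h, rs, h2, rfl⟩
    refine ⟨rs, ⟨h2, fun h' => h ?_⟩, rfl⟩
    rw [smul_eq_mul, Ideal.mul_top] at h'; exact h'.symm

lemma mem_of_ofList_le {rs : List A} {I : Ideal A} (h : Ideal.ofList rs ≤ I) :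
    ∀ r ∈ rs, r ∈ I := fun _ hr => h (Ideal.subset_span hr)

lemma ofList_le {rs : List A} {I : Ideal A} (h : ∀ r ∈ rs, r ∈ I) : Ideal.ofList rs ≤ I :=
  Ideal.span_le.2 h

lemma ofList_perm {rs ss : List A} (h : rs.Perm ss) : Ideal.ofList rs = Ideal.ofList ss :=
  le_antisymm (ofList_le fun _ hr => Ideal.subset_span (h.subset hr))
    (ofList_le fun _ hr => Ideal.subset_span (h.symm.subset hr))

lemma wreg_append_iff (f : A →+* B) (hf : Function.Surjective f) {rs : List A}
    (hk : Ideal.ofList rs = RingHom.ker f) (ys : List A) :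
    IsWeaklyRegular A (rs ++ ys) ↔ IsWeaklyRegular A rs ∧ IsWeaklyRegular B (ys.map f) := by
  let _ := f.toAlgebra
  rw [isWeaklyRegular_append_iff]
  have h1 : (Ideal.ofList rs • ⊤ : Submodule A A) = LinearMap.ker (Algebra.linearMap A B) := by
    rw [hk, smul_eq_mul, Ideal.mul_top]; ext; rfl
  have e : (A ⧸ (Ideal.ofList rs • ⊤ : Submodule A A)) ≃ₗ[A] B := by
    rw [h1]
    exact LinearMap.quotKerEquivOfSurjective (Algebra.linearMap A B) hf
  have h2 : ys.map f = ys.map (algebraMap A B) := rfl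
  rw [e.isWeaklyRegular_congr, h2, isWeaklyRegular_map_algebraMap_iff]

lemma grs_comap (f : A →+* B) (hf : Function.Surjective f)
    (hI : GeneratedByRegularSequence A (RingHom.ker f)) (K : Ideal B)
    (hK : GeneratedByRegularSequence B K) : GeneratedByRegularSequence A (K.comap f) := by
  rw [grs_iff] at *
  obtain ⟨-, rs, h1, h2⟩ := hI
  obtain ⟨hne, ss, h3, rfl⟩ := hK
  obtain ⟨ts, rfl⟩ := List.map_surjective_iff.2 hf ss
  refine ⟨fun h => hne (Ideal.comap_eq_top_iff.1 h), rs ++ ts,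
    (wreg_append_iff f hf h2 ts).2 ⟨h1, h3⟩, ?_⟩
  rw [← Ideal.map_ofList, Ideal.comap_map_of_surjective' f hf, Ideal.ofList_append, h2, sup_comm]

lemma grs_of_equiv (e : A ≃+* B) {I : Ideal B} (h : GeneratedByRegularSequence B I) :
    GeneratedByRegularSequence A (I.comap (e : A →+* B)) := by
  refine grs_comap _ e.surjective ?_ I h
  rw [grs_iff] at *
  have : RingHom.ker (e : A →+* B) = ⊥ := (RingHom.injective_iff_ker_eq_bot _).1 e.injective
  rw [this]
  refine ⟨fun h' => h.1 ?_, [], by simp, by simp⟩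
  rw [Ideal.eq_top_iff_one]
  have h2 : (1 : A) ∈ (⊥ : Ideal A) := by rw [h']; trivial
  have h3 : (1 : A) = 0 := h2
  have : (1 : B) = 0 := by rw [← map_one e, h3, map_zero]
  rw [this]; exact zero_mem _

section loc
variable [IsLocalRing A]

lemma exchange_aux (g : A) (W Y : List A) (h : g ∈ Ideal.ofList W ⊔ Ideal.ofList Y) :
    g ∈ Ideal.ofList W ⊔ maximalIdeal A * Ideal.ofList Y ∨
    ∃ Y₁ y Y₂ b, Y = Y₁ ++ y :: Y₂ ∧ IsUnit b ∧ g - b * y ∈ Ideal.ofList (W ++ (Y₁ ++ Y₂)) := by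
  induction Y generalizing g with
  | nil => left; simpa using h
  | cons y Y ih =>
    rw [Ideal.ofList_cons] at h
    obtain ⟨w, hw, z, hz, rfl⟩ := Submodule.mem_sup.1 h
    obtain ⟨a', ha, r, hr, rfl⟩ := Submodule.mem_sup.1 hz
    obtain ⟨a, rfl⟩ := Ideal.mem_span_singleton'.1 ha
    by_cases hu : IsUnit a
    · refine Or.inr ⟨[], y, Y, a, rfl, hu, ?_⟩
      have e : w + (a * y + r) - a * y = w + r := by ring
      rw [e, Ideal.ofList_append, List.nil_append]
      exact Submodule.add_mem_sup hw hr
    · rcases ih (w + r) (Submodule.add_mem_sup hw hr) with h1 | ⟨Y₁, y', Y₂, b, rfl, hb, h2⟩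
      · left
        rw [Ideal.ofList_cons, Ideal.mul_sup]
        have h3 : a * y ∈ maximalIdeal A * Ideal.span {y} :=
          Ideal.mul_mem_mul ((mem_maximalIdeal _).2 hu) (Ideal.mem_span_singleton_self y)
        have : w + (a * y + r) = (w + r) + a * y := by ring
        rw [this]
        refine add_mem ?_ (Ideal.mem_sup_right (Ideal.mem_sup_left h3))
        have hle : Ideal.ofList W ⊔ maximalIdeal A * Ideal.ofList Y ≤ Ideal.ofList W ⊔
            (maximalIdeal A * Ideal.span {y} ⊔ maximalIdeal A * Ideal.ofList Y) :=
          sup_le_sup_left le_sup_right _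
        exact hle h1
      · refine Or.inr ⟨y :: Y₁, y', Y₂, b, rfl, hb, ?_⟩
        have e : w + (a * y + r) - b * y' = (w + r - b * y') + a * y := by ring
        rw [e]
        refine add_mem (Ideal.span_mono ?_ h2)
          (Ideal.mul_mem_left _ _ (Ideal.subset_span (by simp)))
        intro x hx
        simp only [List.mem_append, List.mem_cons, Set.mem_ofPred_eq] at hx ⊢
        tauto

variable [IsNoetherianRing A]

lemma wreg_perm {rs ss : List A} (h : IsWeaklyRegular A rs) (hp : rs.Perm ss)
    (hm : Ideal.ofList rs ≤ maximalIdeal A) : IsWeaklyRegular A ss :=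
  isWeaklyRegular_of_perm_of_subset_maximalIdeal h hp (mem_of_ofList_le hm)

lemma wreg_exchange {K : Ideal A} {W Y : List A} (h : IsWeaklyRegular A (W ++ Y))
    (hK : Ideal.ofList (W ++ Y) = K) (hm : K ≤ maximalIdeal A) {g : A} (hgK : g ∈ K)
    (hg : g ∉ Ideal.ofList W ⊔ maximalIdeal A * K) :
    ∃ Y', Y'.length + 1 = Y.length ∧ IsWeaklyRegular A (W ++ [g] ++ Y') ∧
      Ideal.ofList (W ++ [g] ++ Y') = K := by
  have hg1 : g ∈ Ideal.ofList W ⊔ Ideal.ofList Y := by rw [← Ideal.ofList_append, hK]; exact hgK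
  rcases exchange_aux g W Y hg1 with h1 | ⟨Y₁, y, Y₂, b, rfl, hb, h2⟩
  · have hYK : Ideal.ofList Y ≤ K := by rw [← hK, Ideal.ofList_append]; exact le_sup_right
    have hle : Ideal.ofList W ⊔ maximalIdeal A * Ideal.ofList Y ≤ Ideal.ofList W ⊔
        maximalIdeal A * K := sup_le_sup le_rfl (Ideal.mul_mono_right hYK)
    exact absurd (hle h1) hg
  have hp : (W ++ (Y₁ ++ y :: Y₂)).Perm ((W ++ (Y₁ ++ Y₂)) ++ [y]) := by
    rw [List.append_assoc]
    refine List.Perm.append_left _ ?_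
    exact List.perm_middle.trans (List.perm_append_singleton y (Y₁ ++ Y₂)).symm
  have h3 := wreg_perm h hp (hK.trans_le hm)
  rw [isWeaklyRegular_append_iff, isWeaklyRegular_singleton_iff] at h3
  have hgr : IsSMulRegular (A ⧸ (Ideal.ofList (W ++ (Y₁ ++ Y₂)) • ⊤ : Submodule A A)) g := by
    have : ∀ x : A ⧸ (Ideal.ofList (W ++ (Y₁ ++ Y₂)) • ⊤ : Submodule A A),
        g • x = b • y • x := by
      intro x
      obtain ⟨x, rfl⟩ := Submodule.mkQ_surjective _ x
      rw [smul_smul, ← sub_eq_zero, ← sub_smul, ← map_smul]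
      refine (Submodule.Quotient.mk_eq_zero _).2 ?_
      exact Submodule.smul_mem_smul h2 trivial
    intro x z hxz
    simp only [this] at hxz
    exact h3.2 (hb.isSMulRegular _ hxz)
  have h4 : IsWeaklyRegular A ((W ++ (Y₁ ++ Y₂)) ++ [g]) := by
    rw [isWeaklyRegular_append_iff, isWeaklyRegular_singleton_iff]; exact ⟨h3.1, hgr⟩
  have hp2 : ((W ++ (Y₁ ++ Y₂)) ++ [g]).Perm (W ++ [g] ++ (Y₁ ++ Y₂)) := by
    rw [List.append_assoc W, List.append_assoc W]
    exact List.Perm.append_left _ List.perm_append_comm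
  have hK2 : Ideal.ofList ((W ++ (Y₁ ++ Y₂)) ++ [g]) = K := by
    rw [← hK, ofList_perm hp, Ideal.ofList_append _ [g], Ideal.ofList_append _ [y],
      Ideal.ofList_singleton, Ideal.ofList_singleton]
    obtain ⟨c, hc⟩ := hb.exists_left_inv
    apply le_antisymm <;> refine sup_le le_sup_left ?_ <;>
      rw [Ideal.span_singleton_le_iff_mem]
    · have : g = (g - b * y) + b * y := by ring
      rw [this]
      exact Submodule.add_mem_sup h2 (Ideal.mul_mem_left _ _ (Ideal.mem_span_singleton_self y))
    · have : y = -(c * (g - b * y)) + c * g := by linear_combination (-y) * hc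
      rw [this]
      exact Submodule.add_mem_sup (neg_mem (Ideal.mul_mem_left _ _ h2))
        (Ideal.mul_mem_left _ _ (Ideal.mem_span_singleton_self g))
  refine ⟨Y₁ ++ Y₂, by simp; omega, wreg_perm h4 hp2 (hK2.trans_le hm), ?_⟩
  rw [← ofList_perm hp2, hK2]

lemma wreg_not_mem {l₁ l₂ : List A} {w : A} (h : IsWeaklyRegular A (l₁ ++ w :: l₂))
    (hm : Ideal.ofList (l₁ ++ w :: l₂) ≤ maximalIdeal A) : w ∉ Ideal.ofList (l₁ ++ l₂) := by
  intro hw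
  have hp : (l₁ ++ w :: l₂).Perm ((l₁ ++ l₂) ++ [w]) :=
    List.perm_middle.trans (List.perm_append_singleton w (l₁ ++ l₂)).symm
  have h3 := wreg_perm h hp hm
  rw [isWeaklyRegular_append_iff, isWeaklyRegular_singleton_iff] at h3
  have h4 : ∀ x : A ⧸ (Ideal.ofList (l₁ ++ l₂) • ⊤ : Submodule A A), w • x = 0 := by
    intro x
    obtain ⟨x, rfl⟩ := Submodule.mkQ_surjective _ x
    rw [← map_smul]
    exact (Submodule.Quotient.mk_eq_zero _).2 (Submodule.smul_mem_smul hw trivial)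
  have h5 : Submodule.Quotient.mk (p := (Ideal.ofList (l₁ ++ l₂) • ⊤ : Submodule A A)) (1 : A) = 0 :=
    h3.2 (by simp only [h4])
  rw [Submodule.Quotient.mk_eq_zero, smul_eq_mul, Ideal.mul_top] at h5
  have h6 : Ideal.ofList (l₁ ++ l₂) ≤ maximalIdeal A := by
    refine le_trans ?_ hm
    refine ofList_le fun r hr => Ideal.subset_span ?_
    simp only [List.mem_append, List.mem_cons, Set.mem_ofPred_eq] at hr ⊢
    tauto
  exact (Ideal.ne_top_iff_one _).1 (maximalIdeal.isMaximal A).ne_top (h6 h5)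

/-- Nakayama for ideals -/
lemma ideal_le_of_le_sup {J K : Ideal A} (h : K ≤ J ⊔ maximalIdeal A * K) : K ≤ J :=
  Submodule.le_of_le_smul_of_le_jacobson_bot (IsNoetherian.noetherian K)
    (maximalIdeal_le_jacobson _) h

lemma wreg_indep {l₁ l₂ : List A} {w : A} {K : Ideal A} (h : IsWeaklyRegular A (l₁ ++ w :: l₂))
    (hK : Ideal.ofList (l₁ ++ w :: l₂) = K)
    (hm : K ≤ maximalIdeal A) : w ∉ Ideal.ofList l₁ ⊔ maximalIdeal A * K := by
  intro hw
  refine wreg_not_mem h (hK.trans_le hm) ?_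
  have hwK : w ∈ K := by rw [← hK]; exact Ideal.subset_span (by simp)
  refine ideal_le_of_le_sup (J := Ideal.ofList (l₁ ++ l₂)) (K := K) ?_ hwK
  have h1 : Ideal.ofList l₁ ⊔ maximalIdeal A * K ≤ Ideal.ofList (l₁ ++ l₂) ⊔ maximalIdeal A * K := by
    rw [Ideal.ofList_append]; exact sup_le_sup_right le_sup_left _
  conv_lhs => rw [← hK]
  refine ofList_le fun r hr => ?_
  simp only [List.mem_append, List.mem_cons] at hr
  by_cases hr2 : r = w
  · rw [hr2]; exact h1 hw
  · exact Ideal.mem_sup_left (Ideal.subset_span (by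
      simp only [List.mem_append, Set.mem_ofPred_eq]; tauto))

/-- extension of an independent list to a regular generating list -/
lemma wreg_extend {K : Ideal A} (hm : K ≤ maximalIdeal A) (V : List A) : ∀ (W Y : List A),
    IsWeaklyRegular A (W ++ Y) → Ideal.ofList (W ++ Y) = K → (∀ v ∈ V, v ∈ K) →
    (∀ l₁ v l₂, V = l₁ ++ v :: l₂ → v ∉ Ideal.ofList (W ++ l₁) ⊔ maximalIdeal A * K) →
    ∃ Z, IsWeaklyRegular A (W ++ V ++ Z) ∧ Ideal.ofList (W ++ V ++ Z) = K := by
  induction V with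
  | nil => intro W Y h1 h2 _ _; exact ⟨Y, by simpa using h1, by simpa using h2⟩
  | cons v V ih =>
    intro W Y h1 h2 h3 h4
    obtain ⟨Y', -, h5, h6⟩ := wreg_exchange h1 h2 hm (h3 v (by simp))
      (by simpa using h4 [] v V rfl)
    obtain ⟨Z, h7, h8⟩ := ih (W ++ [v]) Y' h5 h6 (fun x hx => h3 x (by simp [hx]))
      (fun l₁ x l₂ h => by simpa using h4 (v :: l₁) x l₂ (by simp [h]))
    exact ⟨Z, by simpa using h7, by simpa using h8⟩

/-- a regular generating list can be chosen inside any generating set -/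
lemma wreg_choose {K : Ideal A} (hm : K ≤ maximalIdeal A) (G : Set A) (hG : Ideal.span G = K) :
    ∀ (n : ℕ) (W Y : List A), Y.length = n → IsWeaklyRegular A (W ++ Y) →
    Ideal.ofList (W ++ Y) = K → (∀ w ∈ W, w ∈ G) →
    ∃ Z : List A, IsWeaklyRegular A Z ∧ Ideal.ofList Z = K ∧ ∀ w ∈ Z, w ∈ G := by
  intro n
  induction n with
  | zero =>
    intro W Y h0 h1 h2 h3
    obtain rfl := List.length_eq_zero_iff.1 h0
    rw [List.append_nil] at h1 h2
    exact ⟨W, h1, h2, h3⟩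
  | succ n ih =>
    intro W Y h0 h1 h2 h3
    by_cases h : ∃ g ∈ G, g ∉ Ideal.ofList W ⊔ maximalIdeal A * K
    · obtain ⟨g, hg, hg2⟩ := h
      obtain ⟨Y', a1, a2, a3⟩ := wreg_exchange h1 h2 hm (hG ▸ Ideal.subset_span hg) hg2
      refine ih (W ++ [g]) Y' (by omega) a2 a3 ?_
      intro w hw
      rcases List.mem_append.1 hw with h | h
      · exact h3 w h
      · rw [List.mem_singleton.1 h]; exact hg
    · push Not at h
      have h5 : K ≤ Ideal.ofList W ⊔ maximalIdeal A * K := by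
        conv_lhs => rw [← hG]
        exact Ideal.span_le.2 h
      match Y, h0 with
      | y :: Y, _ =>
        refine absurd (h5 ?_) (wreg_indep h1 h2 hm)
        rw [← h2]; exact Ideal.subset_span (by simp)
end loc
end RS

section PD
open CategoryTheory
lemma projDimLE_of_hasPD {A : Type u} [CommRing A] (n : ℕ) : ∀ (N : ModuleCat.{u} A),
    HasProjectiveDimensionLE N n → ProjDimLE A n N := by
  induction n with
  | zero =>
    intro N h
    simp only [HasProjectiveDimensionLE, zero_add] at h
    rw [← projective_iff_hasProjectiveDimensionLT_one, ← IsProjective.iff_projective] at h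
    exact h
  | succ n ih =>
    intro N h
    have hE := N.shortExact_projectiveShortComplex
    have h1 := (hE.hasProjectiveDimensionLT_X₃_iff n inferInstance).mp h
    refine ⟨N.projectiveShortComplex.X₂, inferInstance, inferInstance,
      N.projectiveShortComplex.g.hom, ?_, ?_, ih _ h1⟩
    · rw [IsProjective.iff_projective]
      exact (inferInstance : Projective N.projectiveShortComplex.X₂)
    · exact (ModuleCat.epi_iff_surjective _).1 hE.epi_g

lemma projDimFinite_of_grs {Q B : Type u} [CommRing Q] [CommRing B] [IsLocalRing Q]
    [IsNoetherianRing Q] [Algebra Q B] (hs : Function.Surjective (algebraMap Q B))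
    (h : GeneratedByRegularSequence Q (RingHom.ker (algebraMap Q B))) : ProjDimFinite Q B := by
  obtain ⟨rs, h1, h2⟩ := h
  change Ideal.ofList rs = _ at h2
  refine ⟨rs.length, ?_⟩
  have := ModuleCat.projectiveDimension_quotient_eq_length.{u} rs h1
  have h3 : HasProjectiveDimensionLE (ModuleCat.of Q (Shrink.{u} (Q ⧸ Ideal.ofList rs))) rs.length := by
    rw [← projectiveDimension_le_iff, this]
  let e : Shrink.{u} (Q ⧸ Ideal.ofList rs) ≃ₗ[Q] B :=
    (Shrink.linearEquiv Q _).trans ((Ideal.quotientEquivAlgOfEq Q h2).trans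
      (Ideal.quotientKerAlgEquivOfSurjective (f := Algebra.ofId Q B) hs)).toLinearEquiv
  have h4 : HasProjectiveDimensionLE (ModuleCat.of Q B) rs.length :=
    ModuleCat.hasProjectiveDimensionLE_of_linearEquiv (M := ModuleCat.of Q (Shrink.{u} (Q ⧸ Ideal.ofList rs))) (N := ModuleCat.of Q B) e _
  exact projDimLE_of_hasPD _ _ h4
end PD

section LC
variable {A : Type u} [CommRing A]

/-- gluing lemma for tensor products -/
lemma tensor_glue {N P Q L : Type u} [AddCommGroup N] [Module A N] [AddCommGroup P] [Module A P]
    [AddCommGroup Q] [Module A Q] [AddCommGroup L] [Module A L] (α : P →ₗ[A] L) (β : Q →ₗ[A] L)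
    (hs : Function.Surjective (LinearMap.coprod α β)) (z : N ⊗[A] P)
    (hz : α.lTensor N z = 0) :
    ∃ w : N ⊗[A] (LinearMap.ker (LinearMap.coprod α β)),
      ((LinearMap.fst A P Q ∘ₗ (LinearMap.ker (LinearMap.coprod α β)).subtype).lTensor N) w = z ∧
      ((LinearMap.snd A P Q ∘ₗ (LinearMap.ker (LinearMap.coprod α β)).subtype).lTensor N) w = 0 := by
  have hex := lTensor_exact N (LinearMap.exact_subtype_ker_map (LinearMap.coprod α β)) hs
  have h1 : (LinearMap.coprod α β).lTensor N ((LinearMap.inl A P Q).lTensor N z) = 0 := by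
    rw [← LinearMap.lTensor_comp_apply, LinearMap.coprod_inl, hz]
  obtain ⟨w, hw⟩ := (hex _).1 h1
  refine ⟨w, ?_, ?_⟩
  · rw [LinearMap.lTensor_comp_apply, hw, ← LinearMap.lTensor_comp_apply, LinearMap.fst_comp_inl,
      LinearMap.lTensor_id, LinearMap.id_apply]
  · rw [LinearMap.lTensor_comp_apply, hw, ← LinearMap.lTensor_comp_apply, LinearMap.snd_comp_inl,
      LinearMap.lTensor_zero, LinearMap.zero_apply]

lemma inj_of_maximal_step [IsLocalRing A] {N : Type u} [AddCommGroup N] [Module A N]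
    (h : Function.Injective ((maximalIdeal A).subtype.lTensor N)) (J J' : Ideal A) (x : A)
    (hx : x ∉ J) (hmx : ∀ a ∈ maximalIdeal A, a * x ∈ J) (hJ' : J' = J ⊔ Ideal.span {x})
    (hle : J ≤ J') : Function.Injective ((Submodule.inclusion hle).lTensor N) := by
  rw [← LinearMap.ker_eq_bot, LinearMap.ker_eq_bot']
  intro z hz
  have hxJ' : x ∈ J' := by rw [hJ']; exact Ideal.mem_sup_right (Ideal.mem_span_singleton_self x)
  let β : A →ₗ[A] J' := LinearMap.toSpanSingleton A J' ⟨x, hxJ'⟩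
  obtain ⟨w, h1, h2⟩ := tensor_glue (Submodule.inclusion hle) β (by
    rintro ⟨y, hy⟩
    rw [hJ'] at hy
    obtain ⟨a, ha, b, hb, rfl⟩ := Submodule.mem_sup.1 hy
    obtain ⟨c, rfl⟩ := Ideal.mem_span_singleton'.1 hb
    exact ⟨(⟨a, ha⟩, c), by ext; simp [β]⟩) z hz
  set W := LinearMap.ker (LinearMap.coprod (Submodule.inclusion hle) β) with hW
  have hmem : ∀ q : W, (q : J × A).2 ∈ maximalIdeal A := by
    rintro ⟨⟨⟨j, hj⟩, a⟩, hq⟩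
    rw [mem_maximalIdeal, mem_nonunits_iff]
    intro hu
    rw [hW, LinearMap.mem_ker] at hq
    have hq2 := congrArg Subtype.val hq
    simp [β] at hq2
    apply hx
    obtain ⟨c, hc⟩ := hu.exists_left_inv
    have : x = -(c * j) := by linear_combination (-x) * hc + c * hq2
    rw [this]; exact neg_mem (Ideal.mul_mem_left _ _ hj)
  let s : W →ₗ[A] maximalIdeal A := LinearMap.codRestrict _ (LinearMap.snd A J A ∘ₗ W.subtype) hmem
  have hs : LinearMap.snd A J A ∘ₗ W.subtype = (maximalIdeal A).subtype ∘ₗ s := by ext; rfl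
  rw [hs, LinearMap.lTensor_comp_apply, map_eq_zero_iff _ h] at h2
  let t : maximalIdeal A →ₗ[A] J :=
    LinearMap.codRestrict _ (-(LinearMap.toSpanSingleton A A x ∘ₗ (maximalIdeal A).subtype))
      (fun a => by simpa using hmx a a.2)
  have ht : LinearMap.fst A J A ∘ₗ W.subtype = t ∘ₗ s := by
    ext ⟨⟨⟨j, hj⟩, a⟩, hq⟩
    rw [hW, LinearMap.mem_ker] at hq
    have hq2 := congrArg Subtype.val hq
    simp [β] at hq2
    change j = -(a * x)
    linear_combination hq2
  rw [← h1, ht, LinearMap.lTensor_comp_apply, h2, map_zero]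

lemma inj_of_pow_le [IsLocalRing A] [IsNoetherianRing A] {N : Type u} [AddCommGroup N] [Module A N]
    (h : Function.Injective ((maximalIdeal A).subtype.lTensor N)) (k : ℕ) (J : Ideal A) :
    maximalIdeal A ^ k ≤ J → Function.Injective (J.subtype.lTensor N) := by
  induction J using WellFoundedGT.induction with
  | ind J ih =>
    intro hk
    by_cases hJ : J = ⊤
    · subst hJ
      have : (Submodule.subtype (⊤ : Ideal A)) = (Submodule.topEquiv : (⊤ : Ideal A) ≃ₗ[A] A) := rfl
      rw [this]
      exact (LinearEquiv.lTensor N (Submodule.topEquiv : (⊤ : Ideal A) ≃ₗ[A] A)).injective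
    · have hex : ∃ n, maximalIdeal A ^ n ≤ J := ⟨k, hk⟩
      classical
      let n := Nat.find hex
      have hn : maximalIdeal A ^ n ≤ J := Nat.find_spec hex
      have hn0 : n ≠ 0 := by
        intro h0; rw [h0] at hn; apply hJ; rw [eq_top_iff]; simpa using hn
      have hn1 : ¬ maximalIdeal A ^ (n-1) ≤ J := Nat.find_min hex (by omega)
      obtain ⟨x, hx, hxJ⟩ := Set.not_subset.1 hn1
      have hmx : ∀ a ∈ maximalIdeal A, a * x ∈ J := fun a ha => hn (by
        obtain ⟨m, hm⟩ := Nat.exists_eq_succ_of_ne_zero hn0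
        rw [hm, pow_succ']
        rw [hm] at hx
        exact Ideal.mul_mem_mul ha hx)
      have hlt : J < J ⊔ Ideal.span {x} := by
        refine lt_of_le_of_ne le_sup_left fun he => hxJ ?_
        rw [he]; exact Ideal.mem_sup_right (Ideal.mem_span_singleton_self x)
      have h1 := ih _ hlt (hk.trans le_sup_left)
      have h2 := inj_of_maximal_step h J _ x hxJ hmx rfl le_sup_left
      have : J.subtype = (J ⊔ Ideal.span {x}).subtype ∘ₗ Submodule.inclusion le_sup_left := rfl
      rw [this, LinearMap.lTensor_comp]
      exact h1.comp h2

/-- local criterion of flatness -/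
theorem flat_of_maximalIdeal [IsLocalRing A] [IsNoetherianRing A] {B : Type u} [CommRing B]
    [IsLocalRing B] [IsNoetherianRing B] [Algebra A B] [IsLocalHom (algebraMap A B)]
    (h : Function.Injective ((maximalIdeal A).subtype.lTensor B)) : Module.Flat A B := by
  rw [Module.Flat.iff_lTensor_injective']
  intro I
  rw [← LinearMap.ker_eq_bot, LinearMap.ker_eq_bot']
  intro z hz

  have hK := Ideal.iInf_pow_smul_eq_bot_of_isLocalRing (M := B ⊗[A] I) (maximalIdeal B)
    (maximalIdeal.isMaximal B).ne_top
  suffices hh : z ∈ (⨅ i : ℕ, maximalIdeal B ^ i • ⊤ : Submodule B (B ⊗[A] I)) by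
    rw [hK] at hh; exact hh
  rw [Submodule.mem_iInf]
  intro n
  obtain ⟨k0, hk0⟩ := Ideal.exists_pow_inf_eq_pow_smul (maximalIdeal A) I
  set k := n + k0
  have hAR : ∀ y ∈ maximalIdeal A ^ k, y ∈ I → y ∈ maximalIdeal A ^ n * I := by
    intro y hy hyI
    have : y ∈ (maximalIdeal A ^ k • ⊤ : Ideal A) ⊓ I := ⟨by simpa using hy, hyI⟩
    rw [hk0 k (by omega)] at this
    have e : k - k0 = n := by omega
    rw [e] at this
    exact Ideal.mul_mono_right inf_le_right this
  have hinj := inj_of_pow_le h k (I ⊔ maximalIdeal A ^ k) le_sup_right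
  have hle : I ≤ I ⊔ maximalIdeal A ^ k := le_sup_left
  have hle2 : maximalIdeal A ^ k ≤ I ⊔ maximalIdeal A ^ k := le_sup_right
  have hz2 : (Submodule.inclusion hle).lTensor B z = 0 := by
    apply hinj
    rw [map_zero, ← hz, ← LinearMap.lTensor_comp_apply]
    rfl
  obtain ⟨w, h1, -⟩ := tensor_glue (Submodule.inclusion hle) (Submodule.inclusion hle2) (by
    rintro ⟨y, hy⟩
    obtain ⟨a, ha, b, hb, rfl⟩ := Submodule.mem_sup.1 hy
    exact ⟨(⟨a, ha⟩, ⟨b, hb⟩), by ext; simp⟩) z hz2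
  rw [← h1]
  clear h1 hz2 hz
  have key : ∀ (y : A) (hy : y ∈ maximalIdeal A ^ n * I), ∃ (hyI : y ∈ I), ∀ (v : B),
      v ⊗ₜ[A] (⟨y, hyI⟩ : I) ∈ (maximalIdeal B ^ n • ⊤ : Submodule B (B ⊗[A] I)) := by
    intro y hy
    refine Submodule.mul_induction_on hy ?_ ?_
    · intro a ha i hi
      refine ⟨I.mul_mem_left _ hi, fun v => ?_⟩
      have : v ⊗ₜ[A] (⟨a * i, I.mul_mem_left _ hi⟩ : I) = algebraMap A B a • (v ⊗ₜ[A] (⟨i, hi⟩ : I)) := by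
        rw [algebraMap_smul, ← TensorProduct.tmul_smul]; rfl
      rw [this]
      refine Submodule.smul_mem_smul ?_ trivial
      have : maximalIdeal A ^ n ≤ (maximalIdeal B ^ n).comap (algebraMap A B) := by
        rw [← Ideal.map_le_iff_le_comap, Ideal.map_pow]
        exact Ideal.pow_right_mono (((IsLocalRing.local_hom_TFAE (algebraMap A B)).out 0 2).1 ‹_›) n
      exact this ha
    · rintro a b ⟨haI, ha⟩ ⟨hbI, hb⟩
      refine ⟨add_mem haI hbI, fun v => ?_⟩
      have : v ⊗ₜ[A] (⟨a + b, add_mem haI hbI⟩ : I) =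
          v ⊗ₜ[A] (⟨a, haI⟩ : I) + v ⊗ₜ[A] (⟨b, hbI⟩ : I) := by
        rw [← TensorProduct.tmul_add]; rfl
      rw [this]; exact add_mem (ha v) (hb v)
  induction w using TensorProduct.induction_on with
  | zero => rw [map_zero]; exact zero_mem _
  | add a b ha hb => rw [map_add]; exact add_mem ha hb
  | tmul v q =>
    obtain ⟨⟨⟨i, hi⟩, ⟨j, hj⟩⟩, hq⟩ := q
    have hij := congrArg Subtype.val (LinearMap.mem_ker.1 hq)
    simp at hij
    have e : i = -j := by linear_combination hij
    obtain ⟨_, h9⟩ := key i (hAR i (by rw [e]; exact neg_mem hj) hi)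
    simpa using h9 v
/-- regular sequences give injectivity -/
lemma inj_of_wreg {N : Type u} [AddCommGroup N] [Module A N] (rs : List A)
    (h : RingTheory.Sequence.IsWeaklyRegular N rs) :
    Function.Injective ((Ideal.ofList rs).subtype.lTensor N) := by
  induction rs using List.reverseRecOn with
  | nil =>
    have : Subsingleton (N ⊗[A] (Ideal.ofList ([] : List A))) := by
      rw [Ideal.ofList_nil]; infer_instance
    exact Function.injective_of_subsingleton _
  | append_singleton rs x ih =>
    rw [RingTheory.Sequence.isWeaklyRegular_append_iff,
      RingTheory.Sequence.isWeaklyRegular_singleton_iff] at h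
    have ih := ih h.1
    set J := Ideal.ofList rs with hJ
    set J' := Ideal.ofList (rs ++ [x]) with hJ'
    have hJ'2 : J' = J ⊔ Ideal.span {x} := by
      rw [hJ', Ideal.ofList_append, Ideal.ofList_singleton]
    have hle : J ≤ J' := by rw [hJ'2]; exact le_sup_left
    have hxJ : x ∈ J' := by rw [hJ'2]; exact Ideal.mem_sup_right (Ideal.mem_span_singleton_self x)
    have hdec : ∀ z : N ⊗[A] J', ∃ (z0 : N ⊗[A] J) (n : N),
        z = (Submodule.inclusion hle).lTensor N z0 + n ⊗ₜ ⟨x, hxJ⟩ := by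
      intro z
      induction z using TensorProduct.induction_on with
      | zero => exact ⟨0, 0, by simp⟩
      | add a b ha hb =>
        obtain ⟨z1, n1, rfl⟩ := ha
        obtain ⟨z2, n2, rfl⟩ := hb
        exact ⟨z1 + z2, n1 + n2, by rw [map_add, TensorProduct.add_tmul]; abel⟩
      | tmul v q =>
        obtain ⟨q, hq⟩ := q
        have hq' := hq
        rw [hJ'2] at hq'
        obtain ⟨a, ha, b, hb, rfl⟩ := Submodule.mem_sup.1 hq'
        obtain ⟨c, rfl⟩ := Ideal.mem_span_singleton'.1 hb
        refine ⟨v ⊗ₜ ⟨a, ha⟩, c • v, ?_⟩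
        rw [LinearMap.lTensor_tmul, TensorProduct.smul_tmul, ← TensorProduct.tmul_add]
        rfl
    have hrange : ∀ n ∈ (J • ⊤ : Submodule A N), ∃ z1 : N ⊗[A] J,
        n ⊗ₜ[A] (⟨x, hxJ⟩ : J') = (Submodule.inclusion hle).lTensor N z1 := by
      intro n hn
      refine Submodule.smul_induction_on hn ?_ ?_
      · intro j hj v _
        refine ⟨(x • v) ⊗ₜ ⟨j, hj⟩, ?_⟩
        rw [LinearMap.lTensor_tmul, TensorProduct.smul_tmul, TensorProduct.smul_tmul]
        congr 1
        ext
        exact mul_comm _ _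
      · rintro a b ⟨z1, h1⟩ ⟨z2, h2⟩
        exact ⟨z1 + z2, by rw [map_add, TensorProduct.add_tmul, h1, h2]⟩
    have hmap : ∀ z0 : N ⊗[A] J, TensorProduct.rid A N (J.subtype.lTensor N z0) ∈
        (J • ⊤ : Submodule A N) := by
      intro z0
      induction z0 using TensorProduct.induction_on with
      | zero => simp
      | add a b ha hb => rw [map_add, map_add]; exact add_mem ha hb
      | tmul v q =>
        rw [LinearMap.lTensor_tmul, TensorProduct.rid_tmul]
        exact Submodule.smul_mem_smul q.2 trivial
    rw [← LinearMap.ker_eq_bot, LinearMap.ker_eq_bot']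
    intro z hz
    obtain ⟨z0, n, rfl⟩ := hdec z
    have hcomp : J'.subtype ∘ₗ Submodule.inclusion hle = J.subtype := rfl
    have hn : n ∈ (J • ⊤ : Submodule A N) := by
      have h3 := congrArg (TensorProduct.rid A N) hz
      rw [map_add, ← LinearMap.lTensor_comp_apply, hcomp, map_add, LinearMap.lTensor_tmul,
        TensorProduct.rid_tmul, map_zero] at h3
      have h4 : x • n ∈ (J • ⊤ : Submodule A N) := by
        have := neg_mem (hmap z0)
        rwa [← eq_neg_of_add_eq_zero_right h3] at this
      rw [← Submodule.Quotient.mk_eq_zero] at h4 ⊢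
      apply h.2
      simpa using h4
    obtain ⟨z1, hz1⟩ := hrange n hn
    rw [hz1, ← map_add] at hz ⊢
    rw [← LinearMap.lTensor_comp_apply, hcomp] at hz
    rw [(map_eq_zero_iff _ ih).1 hz, map_zero]

lemma map_maximalIdeal_le [IsLocalRing A] {B : Type u} [CommRing B] [IsLocalRing B] [Algebra A B]
    [IsLocalHom (algebraMap A B)] : (maximalIdeal A).map (algebraMap A B) ≤ maximalIdeal B :=
  ((IsLocalRing.local_hom_TFAE (algebraMap A B)).out 0 2).1 ‹_›

section loc
variable [IsLocalRing A] [IsNoetherianRing A] {B : Type u} [CommRing B]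
    [IsLocalRing B] [IsNoetherianRing B] [Algebra A B] [IsLocalHom (algebraMap A B)]

/-- FL -/
theorem flat_of_wreg (rs : List A) (hrs : Ideal.ofList rs = maximalIdeal A)
    (h : RingTheory.Sequence.IsWeaklyRegular B (rs.map (algebraMap A B))) : Module.Flat A B := by
  apply flat_of_maximalIdeal
  rw [← hrs]
  exact inj_of_wreg _ ((RingTheory.Sequence.isWeaklyRegular_map_algebraMap_iff _ _ _).1 h)



/-- FIB -/
theorem flat_quot_of_regular [Module.Flat A B] (u : B) (hu : u ∈ maximalIdeal B)
    (hreg : ∀ v : B, u * v ∈ (maximalIdeal A).map (algebraMap A B) →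
      v ∈ (maximalIdeal A).map (algebraMap A B)) :
    Module.Flat A (B ⧸ Ideal.span {u}) ∧ IsSMulRegular B u := by
  set J := Ideal.span {u}
  have hJne : J ≠ ⊤ := fun h => (maximalIdeal.isMaximal B).ne_top (top_le_iff.1 (h ▸
    (Ideal.span_singleton_le_iff_mem _).2 hu))
  have : Nontrivial (B ⧸ J) := Ideal.Quotient.nontrivial_iff.2 hJne
  have : IsLocalRing (B ⧸ J) := IsLocalRing.of_surjective' _ Ideal.Quotient.mk_surjective
  have hl : IsLocalHom (algebraMap A (B ⧸ J)) := by
    have : IsLocalHom (Ideal.Quotient.mk J) := .of_surjective _ Ideal.Quotient.mk_surjective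
    have h2 : algebraMap A (B ⧸ J) = (Ideal.Quotient.mk J).comp (algebraMap A B) := rfl
    rw [h2]; infer_instance
  set m := maximalIdeal A
  have hmB : ∀ v, v ∈ m.map (algebraMap A B) → ∃ y : B ⊗[A] m,
      TensorProduct.rid A B (m.subtype.lTensor B y) = v := by
    intro v hv
    refine Submodule.span_induction ?_ ?_ ?_ ?_ hv
    · rintro _ ⟨a, ha, rfl⟩
      exact ⟨1 ⊗ₜ ⟨a, ha⟩, by simp [Algebra.algebraMap_eq_smul_one]⟩
    · exact ⟨0, by simp⟩
    · rintro _ _ _ _ ⟨y1, rfl⟩ ⟨y2, rfl⟩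
      exact ⟨y1 + y2, by simp⟩
    · rintro b _ - ⟨y, rfl⟩
      refine ⟨(LinearMap.mulLeft A b).rTensor m y, ?_⟩
      induction y using TensorProduct.induction_on with
      | zero => simp
      | add y1 y2 h1 h2 => simp only [map_add, h1, h2, smul_add]
      | tmul c q => simp
  let π : B →ₗ[A] B ⧸ J := (Ideal.Quotient.mkₐ A J).toLinearMap
  have hπ : Function.Surjective π := Ideal.Quotient.mk_surjective
  have hflat : Module.Flat A (B ⧸ J) := by
    apply flat_of_maximalIdeal
    rw [← LinearMap.ker_eq_bot, LinearMap.ker_eq_bot']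
    intro z hz
    obtain ⟨y, rfl⟩ := LinearMap.rTensor_surjective m hπ z
    have h1 : π (TensorProduct.rid A B (m.subtype.lTensor B y)) = 0 := by
      have h2 : TensorProduct.rid A (B ⧸ J) (m.subtype.lTensor (B ⧸ J) (π.rTensor m y)) =
          π (TensorProduct.rid A B (m.subtype.lTensor B y)) := by
        clear hz
        induction y using TensorProduct.induction_on with
        | zero => simp
        | add y1 y2 h1 h2 => simp only [map_add, h1, h2]
        | tmul c q => simp
      rw [← h2, hz, map_zero]
    obtain ⟨v, hv⟩ := Ideal.mem_span_singleton'.1 (Ideal.Quotient.eq_zero_iff_mem.1 h1)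
    have hmem : ∀ y : B ⊗[A] m, TensorProduct.rid A B (m.subtype.lTensor B y) ∈
        m.map (algebraMap A B) := by
      intro y
      induction y using TensorProduct.induction_on with
      | zero => simp
      | add y1 y2 h1 h2 => rw [map_add, map_add]; exact add_mem h1 h2
      | tmul c q =>
        simp only [LinearMap.lTensor_tmul, TensorProduct.rid_tmul, Algebra.smul_def]
        exact Ideal.mul_mem_right _ _ (Ideal.mem_map_of_mem _ q.2)
    obtain ⟨y', hy'⟩ := hmB v (hreg v (by rw [mul_comm, hv]; exact hmem y))
    have hy : y = (LinearMap.mulLeft A u).rTensor m y' := by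
      have hinj := (Module.Flat.iff_lTensor_injective' (R := A) (M := B)).1 ‹_› m
      apply hinj
      apply (TensorProduct.rid A B).injective
      rw [← hv, ← hy']
      clear hy' hv h1 hz
      induction y' using TensorProduct.induction_on with
      | zero => simp
      | add y1 y2 h1 h2 => simp only [map_add, ← h1, ← h2, add_mul]
      | tmul c q => simp [mul_comm]
    rw [hy, ← LinearMap.rTensor_comp_apply]
    have : π ∘ₗ LinearMap.mulLeft A u = 0 := by
      ext b
      exact Ideal.Quotient.eq_zero_iff_mem.2 (Ideal.mul_mem_right _ _ (Ideal.mem_span_singleton_self u))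
    rw [this, LinearMap.rTensor_zero, LinearMap.zero_apply]
  refine ⟨hflat, ?_⟩
  have hker : Module.Flat A (LinearMap.ker π) := flat_ker π hπ
  let μ : B →ₗ[A] LinearMap.ker π := LinearMap.codRestrict _ (LinearMap.mulLeft A u) (fun b =>
    Ideal.Quotient.eq_zero_iff_mem.2 (Ideal.mul_mem_right _ _ (Ideal.mem_span_singleton_self u)))
  have hμ : Function.Surjective μ := by
    rintro ⟨b, hb⟩
    obtain ⟨c, hc⟩ := Ideal.mem_span_singleton'.1 (Ideal.Quotient.eq_zero_iff_mem.1 hb)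
    exact ⟨c, Subtype.ext ((mul_comm u c).trans hc)⟩
  have hinf := LinearMap.ker_inf_smul_top_eq_smul_of_flat m μ hμ
  let K : Ideal B := LinearMap.ker (LinearMap.mulLeft B u)
  have hK : K = ⊥ := by
    rw [eq_bot_iff]
    apply ideal_le_of_le_sup
    rw [bot_sup_eq]
    intro v hv
    have hv' : u * v = 0 := hv
    have h1 : v ∈ m.map (algebraMap A B) := hreg v (by rw [hv']; exact zero_mem _)
    have h2 : v ∈ LinearMap.ker μ ⊓ m • (⊤ : Submodule A B) := by
      refine ⟨Subtype.ext hv', ?_⟩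
      rwa [Ideal.smul_top_eq_map]
    rw [hinf] at h2
    refine Submodule.smul_induction_on h2 ?_ ?_
    · intro a ha w hw
      rw [Algebra.smul_def]
      exact Ideal.mul_mem_mul (map_maximalIdeal_le (Ideal.mem_map_of_mem _ ha))
        (congrArg Subtype.val hw)
    · intro a b ha hb; exact add_mem ha hb
  intro a b hab
  have : a - b ∈ K := by
    change u * (a - b) = 0
    rw [mul_sub, sub_eq_zero]; exact hab
  rw [hK] at this
  exact sub_eq_zero.1 this
end loc
end LC

section WRsec
open RingTheory.Sequence

lemma list_lift {α β : Type*} (p : α → β) (S : Set α) (ws : List β)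
    (h : ∀ w ∈ ws, ∃ v ∈ S, p v = w) : ∃ vs : List α, vs.map p = ws ∧ ∀ v ∈ vs, v ∈ S := by
  induction ws with
  | nil => exact ⟨[], rfl, by simp⟩
  | cons w ws ih =>
    obtain ⟨v, hv, rfl⟩ := h w (by simp)
    obtain ⟨vs, rfl, h2⟩ := ih fun w hw => h w (by simp [hw])
    exact ⟨v :: vs, rfl, by simpa using ⟨hv, h2⟩⟩

lemma isLocalRing_quot {B : Type u} [CommRing B] [IsLocalRing B] {J : Ideal B}
    (hJ : J ≤ maximalIdeal B) : IsLocalRing (B ⧸ J) := by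
  have : Nontrivial (B ⧸ J) := Ideal.Quotient.nontrivial_iff.2 fun h =>
    (maximalIdeal.isMaximal B).ne_top (top_le_iff.1 (h ▸ hJ))
  exact IsLocalRing.of_surjective' _ Ideal.Quotient.mk_surjective

lemma map_maximalIdeal_of_surj {B C : Type u} [CommRing B] [CommRing C] [IsLocalRing B]
    [IsLocalRing C] (f : B →+* C) (hf : Function.Surjective f) :
    (maximalIdeal B).map f = maximalIdeal C := by
  have hl : IsLocalHom f := .of_surjective _ hf
  have h1 := ((IsLocalRing.local_hom_TFAE f).out 0 4).1 hl
  rw [← h1, Ideal.map_comap_of_surjective f hf]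

lemma wreg_mk {B : Type u} [CommRing B] {I : Ideal B} {rs : List B} :
    IsWeaklyRegular (B ⧸ I) (rs.map (Ideal.Quotient.mk I)) ↔ IsWeaklyRegular (B ⧸ I) rs :=
  isWeaklyRegular_map_algebraMap_iff (B ⧸ I) (B ⧸ I) rs

lemma wreg_quot_append {B : Type u} [CommRing B] {I : Ideal B} {rs ss : List B} :
    IsWeaklyRegular (B ⧸ I) (rs ++ ss) ↔
      IsWeaklyRegular (B ⧸ I) rs ∧ IsWeaklyRegular (B ⧸ (I ⊔ Ideal.ofList rs)) ss := by
  have hle : I ≤ I ⊔ Ideal.ofList rs := le_sup_left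
  rw [← wreg_mk, List.map_append, wreg_append_iff (Ideal.Quotient.factor hle)
    (Ideal.Quotient.factor_surjective hle), wreg_mk, List.map_map, ← wreg_mk (rs := ss)]
  · rfl
  · rw [← Ideal.map_ofList, Ideal.Quotient.factor_ker, Ideal.map_sup, Ideal.map_quotient_self,
      bot_sup_eq]

lemma wreg_surj {A B : Type u} [CommRing A] [CommRing B] (f : A →+* B)
    (hf : Function.Surjective f) {I : Ideal A} (hI : RingHom.ker f = I) {rs : List A} :
    IsWeaklyRegular B (rs.map f) ↔ IsWeaklyRegular (A ⧸ I) rs := by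
  subst hI
  let _ := f.toAlgebra
  have h2 : rs.map f = rs.map (algebraMap A B) := rfl
  rw [h2, isWeaklyRegular_map_algebraMap_iff]
  exact (Ideal.quotientKerAlgEquivOfSurjective (f := Algebra.ofId A B) hf).symm.toLinearEquiv.isWeaklyRegular_congr rs

lemma wreg_quot_quot {B : Type u} [CommRing B] {I J : Ideal B} {rs : List B} :
    IsWeaklyRegular ((B ⧸ J) ⧸ I.map (Ideal.Quotient.mk J)) (rs.map (Ideal.Quotient.mk J)) ↔
      IsWeaklyRegular (B ⧸ (I ⊔ J)) rs := by
  rw [← wreg_mk, List.map_map]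
  exact wreg_surj (DoubleQuot.quotQuotMk J I)
    (Ideal.Quotient.mk_surjective.comp Ideal.Quotient.mk_surjective)
    (by rw [DoubleQuot.ker_quotQuotMk, sup_comm])

/-- FIB, list version -/
lemma fib_list' {A : Type u} [CommRing A] [IsLocalRing A] [IsNoetherianRing A] (n : ℕ) :
    ∀ {B : Type u} [CommRing B] [IsLocalRing B] [IsNoetherianRing B] [Algebra A B]
    [IsLocalHom (algebraMap A B)] [Module.Flat A B] (rs : List B), rs.length = n →
    Ideal.ofList rs ≤ maximalIdeal B →
    IsWeaklyRegular (B ⧸ (maximalIdeal A).map (algebraMap A B)) rs →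
    IsWeaklyRegular B rs ∧ Module.Flat A (B ⧸ Ideal.ofList rs) := by
  induction n with
  | zero =>
    intro B _ _ _ _ _ _ rs h0 _ _
    obtain rfl := List.length_eq_zero_iff.1 h0
    refine ⟨by simp, ?_⟩
    rw [Ideal.ofList_nil]
    exact Module.Flat.of_linearEquiv (AlgEquiv.quotientBot A B).toLinearEquiv
  | succ n ih =>
    intro B _ _ _ _ _ _ rs h0 hm hr
    obtain ⟨u, rs, rfl⟩ := List.exists_cons_of_length_eq_add_one h0
    have hum : u ∈ maximalIdeal B := hm (Ideal.subset_span (by simp))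
    rw [← List.singleton_append, wreg_quot_append, isWeaklyRegular_singleton_iff,
      Ideal.ofList_singleton] at hr
    obtain ⟨hr1, hr2⟩ := hr
    obtain ⟨h1, h2⟩ := flat_quot_of_regular (A := A) u hum (fun v hv => by
      rw [← Ideal.Quotient.eq_zero_iff_mem] at hv ⊢
      exact hr1 (by simp only [smul_zero]; exact hv))
    set J := Ideal.span {u}
    have hJm : J ≤ maximalIdeal B := (Ideal.span_singleton_le_iff_mem _).2 hum
    have : IsLocalRing (B ⧸ J) := isLocalRing_quot hJm
    have hl : IsLocalHom (algebraMap A (B ⧸ J)) := by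
      have : IsLocalHom (Ideal.Quotient.mk J) := .of_surjective _ Ideal.Quotient.mk_surjective
      have h2 : algebraMap A (B ⧸ J) = (Ideal.Quotient.mk J).comp (algebraMap A B) := rfl
      rw [h2]; infer_instance
    have hmap : (maximalIdeal A).map (algebraMap A (B ⧸ J)) =
        ((maximalIdeal A).map (algebraMap A B)).map (Ideal.Quotient.mk J) := by
      rw [Ideal.map_map]; rfl
    obtain ⟨h3, h4⟩ := ih (B := B ⧸ J) (rs.map (Ideal.Quotient.mk J)) (by simpa using h0) (by
        rw [← Ideal.map_ofList, ← map_maximalIdeal_of_surj _ (Ideal.Quotient.mk_surjective (I := J))]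
        refine Ideal.map_mono (le_trans ?_ hm)
        rw [Ideal.ofList_cons]; exact le_sup_right) (by
        rw [hmap, wreg_quot_quot]
        exact hr2)
    constructor
    · rw [← List.singleton_append, wreg_append_iff (Ideal.Quotient.mk J)
        Ideal.Quotient.mk_surjective (by rw [Ideal.ofList_singleton, Ideal.mk_ker]),
        isWeaklyRegular_singleton_iff]
      exact ⟨h2, h3⟩
    · rw [← Ideal.map_ofList] at h4
      have e := DoubleQuot.quotQuotEquivQuotSupₐ A J (Ideal.ofList rs)
      rw [Ideal.ofList_cons]
      have h5 : Module.Flat A ((B ⧸ J) ⧸ Ideal.map (Ideal.Quotient.mkₐ A J) (Ideal.ofList rs)) := h4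
      exact Module.Flat.of_linearEquiv e.symm.toLinearEquiv

lemma fib_list {A : Type u} [CommRing A] [IsLocalRing A] [IsNoetherianRing A]
    {B : Type u} [CommRing B] [IsLocalRing B] [IsNoetherianRing B] [Algebra A B]
    [IsLocalHom (algebraMap A B)] [Module.Flat A B] (rs : List B)
    (hm : Ideal.ofList rs ≤ maximalIdeal B)
    (h : IsWeaklyRegular (B ⧸ (maximalIdeal A).map (algebraMap A B)) rs) :
    IsWeaklyRegular B rs ∧ Module.Flat A (B ⧸ Ideal.ofList rs) := fib_list' _ rs rfl hm h

/-- weakly regular algebras -/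
def WR (A B : Type u) [CommRing A] [CommRing B] [IsLocalRing A] [IsLocalRing B] [Algebra A B] :
    Prop :=
  IsLocalHom (algebraMap A B) ∧ Module.Flat A B ∧ ∃ rs : List B,
    IsWeaklyRegular (B ⧸ (maximalIdeal A).map (algebraMap A B)) rs ∧
    (maximalIdeal A).map (algebraMap A B) ⊔ Ideal.ofList rs = maximalIdeal B

lemma maximalIdeal_quot {B : Type u} [CommRing B] [IsLocalRing B] {J : Ideal B} [IsLocalRing (B ⧸ J)] :
    maximalIdeal (B ⧸ J) = (maximalIdeal B).map (Ideal.Quotient.mk J) :=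
  (map_maximalIdeal_of_surj _ Ideal.Quotient.mk_surjective).symm

lemma sup_ofList_iff {B : Type u} [CommRing B] {J : Ideal B} {rs : List B} {m : Ideal B} (hJ : J ≤ m) :
    J ⊔ Ideal.ofList rs = m ↔
    Ideal.ofList (rs.map (Ideal.Quotient.mk J)) = m.map (Ideal.Quotient.mk J) := by
  have key : ∀ K : Ideal B, (K.map (Ideal.Quotient.mk J)).comap (Ideal.Quotient.mk J) = K ⊔ J :=
    fun K => by rw [Ideal.comap_map_of_surjective' _ Ideal.Quotient.mk_surjective, Ideal.mk_ker]
  rw [← Ideal.map_ofList]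
  constructor
  · rintro rfl; rw [Ideal.map_sup, Ideal.map_quotient_self, bot_sup_eq]
  · intro h
    have := congrArg (Ideal.comap (Ideal.Quotient.mk J)) h
    rw [key, key, sup_eq_left.2 hJ] at this
    rw [sup_comm, this]

lemma wr_iff {A B : Type u} [CommRing A] [CommRing B] [IsLocalRing A] [IsLocalRing B]
    [IsNoetherianRing B] [Algebra A B] : WR A B ↔ IsWeaklyRegularHom A B (algebraMap A B) := by
  have e : (algebraMap A B).toAlgebra = ‹Algebra A B› := Algebra.algebra_ext _ _ fun _ => rfl
  unfold WR IsWeaklyRegularHom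
  rw [e]
  refine and_congr_right fun hl => and_congr_right fun hf => ?_
  have hle : (maximalIdeal A).map (algebraMap A B) ≤ maximalIdeal B := map_maximalIdeal_le
  have hloc := isLocalRing_quot hle
  constructor
  · rintro ⟨rs, h1, h2⟩
    refine ⟨inferInstance, hloc, grs_iff.2 ⟨(maximalIdeal.isMaximal _).ne_top, _, wreg_mk.2 h1, ?_⟩⟩
    rw [maximalIdeal_quot]
    exact (sup_ofList_iff hle).1 h2
  · rintro ⟨-, h, hg⟩
    obtain ⟨-, rs, h1, h2⟩ := grs_iff.1 hg
    obtain ⟨rs, rfl⟩ := List.map_surjective_iff.2 Ideal.Quotient.mk_surjective rs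
    refine ⟨rs, wreg_mk.1 h1, ?_⟩
    rw [sup_ofList_iff hle, h2, maximalIdeal_quot]

lemma WR.comp {A B C : Type u} [CommRing A] [CommRing B] [CommRing C] [IsLocalRing A]
    [IsLocalRing B] [IsLocalRing C] [Algebra A B] [Algebra B C] [Algebra A C] [IsScalarTower A B C]
    (h1 : WR A B) (h2 : WR B C) : WR A C := by
  obtain ⟨a1, a2, rs, a3, a4⟩ := h1
  obtain ⟨b1, b2, ss, b3, b4⟩ := h2
  have hl : IsLocalHom (algebraMap A C) := by
    rw [IsScalarTower.algebraMap_eq A B C]; infer_instance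
  refine ⟨hl, Module.Flat.trans A B C, rs.map (algebraMap B C) ++ ss, ?_, ?_⟩
  · rw [wreg_quot_append]
    have e : (maximalIdeal A).map (algebraMap A C) =
        ((maximalIdeal A).map (algebraMap A B)).map (algebraMap B C) := by
      rw [Ideal.map_map, ← IsScalarTower.algebraMap_eq]
    constructor
    · have h3 := IsWeaklyRegular.isWeaklyRegular_lTensor (M₂ := C) a3
      rw [isWeaklyRegular_map_algebraMap_iff, e]
      refine (LinearEquiv.isWeaklyRegular_congr ?_ rs).1 h3
      exact ((Algebra.TensorProduct.quotIdealMapEquivTensorQuot C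
        ((maximalIdeal A).map (algebraMap A B))).symm.toLinearEquiv.restrictScalars B)
    · rw [e, ← Ideal.map_ofList, ← Ideal.map_sup, a4]; exact b3
  · rw [Ideal.ofList_append, ← sup_assoc, ← Ideal.map_ofList, IsScalarTower.algebraMap_eq A B C,
      ← Ideal.map_map, ← Ideal.map_sup, a4, b4]
lemma mem_mul_of_wreg {A B : Type u} [CommRing A] [CommRing B] (f : A →+* B)
    (hf : Function.Surjective f) (zs : List A) (h : IsWeaklyRegular B (zs.map f)) (n : A)
    (hn : n ∈ RingHom.ker f) (hz : n ∈ Ideal.ofList zs) : n ∈ RingHom.ker f * Ideal.ofList zs := by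
  let _ := f.toAlgebra
  have h1 := inj_of_wreg zs ((isWeaklyRegular_map_algebraMap_iff B B zs).1 h)
  set J := Ideal.ofList zs
  let N := LinearMap.ker (Algebra.linearMap A B)
  have hex := rTensor_exact J (LinearMap.exact_subtype_ker_map (Algebra.linearMap A B)) hf
  have h2 : (Algebra.linearMap A B).rTensor J ((1 : A) ⊗ₜ (⟨n, hz⟩ : J)) = 0 := by
    apply h1
    rw [map_zero]
    apply (TensorProduct.rid A B).injective
    have : algebraMap A B n = 0 := hn
    simpa [Algebra.smul_def] using this
  obtain ⟨w, hw⟩ := (hex _).1 h2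
  have h3 : ∀ w : N ⊗[A] J, TensorProduct.lift
      ((LinearMap.lsmul A A).compl₂ J.subtype) (N.subtype.rTensor J w) ∈ RingHom.ker f * J := by
    intro w
    induction w using TensorProduct.induction_on with
    | zero => simp
    | add a b ha hb => rw [map_add, map_add]; exact add_mem ha hb
    | tmul a b =>
      have h9 : (a : A) * b ∈ RingHom.ker f * J :=
        Ideal.mul_mem_mul (show (a : A) ∈ RingHom.ker f from a.2) b.2
      simpa using h9
  have h4 := h3 w
  rw [hw] at h4
  simpa using h4

lemma grs_bot {A : Type u} [CommRing A] [Nontrivial A] : GeneratedByRegularSequence A ⊥ :=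
  grs_iff.2 ⟨bot_ne_top, [], by simp, by simp⟩

lemma grs_singleton {A : Type u} [CommRing A] [IsLocalRing A] {w : A} (h : IsSMulRegular A w)
    (hw : w ∈ maximalIdeal A) : GeneratedByRegularSequence A (Ideal.span {w}) :=
  grs_iff.2 ⟨fun h' => (maximalIdeal.isMaximal A).ne_top (top_le_iff.1 (h' ▸
    (Ideal.span_singleton_le_iff_mem _).2 hw)), [w], by simpa using h, by simp⟩

/-- surjections of regular local rings -/
theorem grs_ker_of_regular {B : Type u} [CommRing B] [IsLocalRing B] (zs : List B)
    (hzs : IsWeaklyRegular B zs) (hz : Ideal.ofList zs = maximalIdeal B) (n : ℕ) :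
    ∀ {A : Type u} [CommRing A] [IsLocalRing A] [IsNoetherianRing A] (xs : List A),
    xs.length = n → IsWeaklyRegular A xs → Ideal.ofList xs = maximalIdeal A →
    ∀ (f : A →+* B), Function.Surjective f → GeneratedByRegularSequence A (RingHom.ker f) := by
  induction n with
  | zero =>
    intro A _ _ _ xs h0 h1 h2 f hf
    obtain rfl := List.length_eq_zero_iff.1 h0
    rw [Ideal.ofList_nil] at h2
    have : RingHom.ker f ≤ maximalIdeal A := IsLocalRing.le_maximalIdeal (RingHom.ker_ne_top f)
    rw [← h2, le_bot_iff] at this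
    rw [this]; exact grs_bot
  | succ n ih =>
    intro A _ _ _ xs h0 h1 h2 f hf
    have hNm : RingHom.ker f ≤ maximalIdeal A := IsLocalRing.le_maximalIdeal (RingHom.ker_ne_top f)
    by_cases hN : RingHom.ker f ≤ maximalIdeal A * maximalIdeal A
    · obtain ⟨zs, rfl⟩ := List.map_surjective_iff.2 hf zs
      have hzm : Ideal.ofList zs ⊔ RingHom.ker f = maximalIdeal A := by
        rw [← Ideal.comap_map_of_surjective' f hf, Ideal.map_ofList, hz]
        have hl : IsLocalHom f := .of_surjective _ hf
        exact ((IsLocalRing.local_hom_TFAE f).out 0 4).1 hl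
      have hmz : maximalIdeal A ≤ Ideal.ofList zs := by
        apply ideal_le_of_le_sup
        conv_lhs => rw [← hzm]
        exact sup_le_sup le_rfl hN
      have : RingHom.ker f ≤ ⊥ := by
        apply ideal_le_of_le_sup
        intro x hx
        rw [bot_sup_eq, mul_comm]
        refine Ideal.mul_mono_right ?_ (mem_mul_of_wreg f hf zs hzs x hx (hmz (hNm hx)))
        rw [← hzm]; exact le_sup_left
      rw [le_bot_iff.1 this]; exact grs_bot
    · obtain ⟨w, hw, hw2⟩ := Set.not_subset.1 hN
      obtain ⟨Y, b1, b2, b3⟩ := wreg_exchange (W := []) (Y := xs) h1 h2 le_rfl (hNm hw)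
        (by simpa using hw2)
      rw [List.nil_append] at b2 b3
      have hwm : w ∈ maximalIdeal A := hNm hw
      set J := Ideal.span {w}
      have hJm : J ≤ maximalIdeal A := (Ideal.span_singleton_le_iff_mem _).2 hwm
      have := isLocalRing_quot hJm
      rw [wreg_append_iff (Ideal.Quotient.mk J) Ideal.Quotient.mk_surjective
        (by rw [Ideal.ofList_singleton, Ideal.mk_ker]), isWeaklyRegular_singleton_iff] at b2
      have hJf : ∀ a ∈ J, f a = 0 := by
        intro a ha
        have : J ≤ RingHom.ker f := (Ideal.span_singleton_le_iff_mem _).2 hw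
        exact this ha
      have h5 := ih (A := A ⧸ J) (Y.map (Ideal.Quotient.mk J)) (by simp; omega) b2.2 (by
        rw [maximalIdeal_quot, ← b3, ← Ideal.map_ofList, Ideal.ofList_append, Ideal.map_sup,
          Ideal.ofList_singleton, Ideal.map_quotient_self, bot_sup_eq])
        (Ideal.Quotient.lift J f hJf) (Ideal.Quotient.lift_surjective_of_surjective _ _ hf)
      have h6 := grs_comap (Ideal.Quotient.mk J) Ideal.Quotient.mk_surjective
        (by rw [Ideal.mk_ker]; exact grs_singleton b2.1 hwm) _ h5
      convert h6 using 1
      ext x; rfl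

/-- A1 -/
theorem grs_ker_of_WR {R V T : Type u} [CommRing R] [CommRing V] [CommRing T] [IsLocalRing R]
    [IsLocalRing V] [IsLocalRing T] [IsNoetherianRing R] [IsNoetherianRing V]
    [Algebra R V] [Algebra R T] (hV : WR R V) (hT : WR R T) (f : V →ₐ[R] T)
    (hf : Function.Surjective f) : GeneratedByRegularSequence V (RingHom.ker f) := by
  obtain ⟨a1, a2, xs, a3, a4⟩ := hV
  obtain ⟨b1, b2, zs, b3, b4⟩ := hT
  set IV := (maximalIdeal R).map (algebraMap R V) with hIV
  set IT := (maximalIdeal R).map (algebraMap R T) with hIT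
  have hmap : IV.map (f : V →+* T) = IT := by
    rw [hIV, Ideal.map_map, f.comp_algebraMap]
  have hVm : IV ≤ maximalIdeal V := map_maximalIdeal_le
  have hTm : IT ≤ maximalIdeal T := map_maximalIdeal_le
  have := isLocalRing_quot hVm
  have := isLocalRing_quot hTm
  have hsup : RingHom.ker f ⊔ IV = IT.comap f := by
    rw [sup_comm, ← hmap]
    exact (Ideal.comap_map_of_surjective' (f : V →+* T) hf _).symm
  let g : V ⧸ IV →+* T ⧸ IT := Ideal.quotientMap IT (f : V →+* T) (by
    intro x hx; exact (hsup ▸ (Ideal.mem_sup_right hx : x ∈ RingHom.ker f ⊔ IV)))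
  have hg : Function.Surjective g := Ideal.quotientMap_surjective hf
  obtain ⟨-, ws, c1, c2⟩ := grs_iff.1 (grs_ker_of_regular (zs.map (Ideal.Quotient.mk IT))
    (wreg_mk.2 b3) (by rw [maximalIdeal_quot, ← sup_ofList_iff hTm, b4]) _
    (xs.map (Ideal.Quotient.mk IV)) rfl (wreg_mk.2 a3)
    (by rw [maximalIdeal_quot, ← sup_ofList_iff hVm, a4]) g hg)
  obtain ⟨vs, rfl, hvs⟩ := list_lift (Ideal.Quotient.mk IV) (RingHom.ker f : Ideal V) ws (by
    intro w hw
    have h1 : w ∈ RingHom.ker g := by rw [← c2]; exact Ideal.subset_span hw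
    obtain ⟨v, rfl⟩ := Ideal.Quotient.mk_surjective w
    have h2 : v ∈ IT.comap f := by
      have h2 : f v ∈ IT := Ideal.Quotient.eq_zero_iff_mem.1
        (show Ideal.Quotient.mk IT (f v) = 0 from h1)
      exact h2
    rw [← hsup] at h2
    obtain ⟨a, ha, b, hb, rfl⟩ := Submodule.mem_sup.1 h2
    exact ⟨a, ha, by rw [map_add, Ideal.Quotient.eq_zero_iff_mem.2 hb, add_zero]⟩)
  have hkm : RingHom.ker f ≤ maximalIdeal V := IsLocalRing.le_maximalIdeal (RingHom.ker_ne_top f)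
  have hvk : Ideal.ofList vs ≤ RingHom.ker f := ofList_le hvs
  obtain ⟨d1, d2⟩ := fib_list (A := R) vs (hvk.trans hkm) (wreg_mk.1 c1)
  refine grs_iff.2 ⟨RingHom.ker_ne_top f, vs, d1, le_antisymm hvk ?_⟩
  apply ideal_le_of_le_sup
  intro v hv
  have h3 : v ∈ Ideal.ofList vs ⊔ IV := by
    have h4 : Ideal.Quotient.mk IV v ∈ RingHom.ker g := by
      change Ideal.Quotient.mk IT (f v) = 0
      rw [show f v = 0 from hv, map_zero]
    rw [← c2, ← Ideal.map_ofList] at h4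
    have h5 : v ∈ ((Ideal.ofList vs).map (Ideal.Quotient.mk IV)).comap (Ideal.Quotient.mk IV) := h4
    rwa [Ideal.comap_map_of_surjective' _ Ideal.Quotient.mk_surjective, Ideal.mk_ker] at h5
  obtain ⟨a, ha, b, hb, rfl⟩ := Submodule.mem_sup.1 h3
  refine add_mem (Ideal.mem_sup_left ha) (Ideal.mem_sup_right ?_)
  have hbk : f b = 0 := by
    have h6 : f (a + b) = 0 := hv
    rw [map_add, show f a = 0 from hvk ha, zero_add] at h6
    exact h6
  have h7 : b ∈ LinearMap.ker f.toLinearMap ⊓ (maximalIdeal R) • (⊤ : Submodule R V) :=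
    ⟨hbk, by rwa [Ideal.smul_top_eq_map]⟩
  rw [LinearMap.ker_inf_smul_top_eq_smul_of_flat _ _ hf] at h7
  refine Submodule.smul_induction_on h7 ?_ ?_
  · intro r hr w hw
    rw [Algebra.smul_def]
    exact Ideal.mul_mem_mul (hVm (Ideal.mem_map_of_mem _ hr)) hw
  · intro a b ha hb; exact add_mem ha hb
end WRsec

section Compl
open RingTheory.Sequence

lemma adic_ext {A B : Type u} [CommRing A] [CommRing B] (I : Ideal A) (J : Ideal B)
    [IsAdicComplete J B] (φ : A →+* B) (h : I.map φ ≤ J) :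
    ∃ F : AdicCompletion I A →+* B, ∀ a, F (algebraMap A _ a) = φ a := by
  have hn : ∀ n, I ^ n ≤ (J ^ n).comap φ := fun n => by
    rw [← Ideal.map_le_iff_le_comap, Ideal.map_pow]; exact Ideal.pow_right_mono h n
  refine ⟨IsAdicComplete.liftRingHom J (fun n => (Ideal.quotientMap (J ^ n) φ (hn n)).comp
    (AdicCompletion.evalₐ I n).toRingHom) ?_, ?_⟩
  · intro m n hle
    ext x
    obtain ⟨x, rfl⟩ := AdicCompletion.mk_surjective I A x
    simp
    rw [eq_comm, Ideal.Quotient.mk_eq_mk_iff_sub_mem, ← map_sub]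
    have h1 := x.2 hle
    rw [SModEq.sub_mem, smul_eq_mul, Ideal.mul_top] at h1
    exact hn m h1
  · intro a
    refine eq_of_sub_eq_zero (IsHausdorff.haus (I := J) inferInstance _ fun n => ?_)
    rw [SModEq.zero, smul_eq_mul, Ideal.mul_top, ← Ideal.Quotient.eq_zero_iff_mem, map_sub,
      IsAdicComplete.mk_liftRingHom]
    · simp [AdicCompletion.algebraMap_apply]

lemma mem_pow_completion {A : Type u} [CommRing A] [IsNoetherianRing A] (I : Ideal A) (n : ℕ)
    (y : AdicCompletion I A) : y ∈ I.map (algebraMap A (AdicCompletion I A)) ^ n ↔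
    AdicCompletion.evalₐ I n y = 0 := by
  have h := AdicCompletion.pow_smul_top_eq_ker_eval (I := I) (M := A) (n := n)
    (IsNoetherian.noetherian I)
  have h2 := SetLike.ext_iff.1 h y
  rw [← Ideal.map_pow, ← Submodule.restrictScalars_mem A, ← Ideal.smul_top_eq_map, h2, LinearMap.mem_ker,
    ← AdicCompletion.factor_eval_eq_evalₐ I y (by simp)]
  refine ⟨fun h => by rw [h, map_zero], fun h => ?_⟩
  rw [← AdicCompletion.factor_evalₐ_eq_eval I y (by simp), ← AdicCompletion.factor_eval_eq_evalₐ I y (by simp), h, map_zero]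

lemma mvps_eval {A B : Type u} [CommRing A] [CommRing B] (J : Ideal B) [IsAdicComplete J B] {n : ℕ}
    (φ : A →+* B) (b : Fin n → B) (hb : ∀ i, b i ∈ J) : ∃ F : MvPowerSeries (Fin n) A →+* B,
    (∀ a, F (MvPowerSeries.C a) = φ a) ∧ ∀ i, F (MvPowerSeries.X i) = b i := by
  obtain ⟨F, hF⟩ := adic_ext (MvPolynomial.idealOfVars (Fin n) A) J (MvPolynomial.eval₂Hom φ b) (by
    rw [MvPolynomial.idealOfVars, Ideal.map_span, Ideal.span_le]
    rintro _ ⟨_, ⟨i, rfl⟩, rfl⟩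
    simpa using hb i)
  have key : ∀ p : MvPolynomial (Fin n) A, F.comp
      (MvPowerSeries.toAdicCompletionAlgEquiv (Fin n) A).toRingEquiv.toRingHom p =
      MvPolynomial.eval₂Hom φ b p := by
    intro p
    rw [← hF]
    have := MvPowerSeries.toAdicCompletion_coe p
    exact congrArg F this
  refine ⟨F.comp (MvPowerSeries.toAdicCompletionAlgEquiv (Fin n) A).toRingEquiv.toRingHom, ?_, ?_⟩
  · intro a
    have := key (MvPolynomial.C a)
    rw [MvPolynomial.coe_C] at this
    rw [this]; simp
  · intro i
    have := key (MvPolynomial.X i)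
    rw [MvPolynomial.coe_X] at this
    rw [this]; simp

instance noeth_completion {A : Type u} [CommRing A] [IsNoetherianRing A] (I : Ideal A) :
    IsNoetherianRing (AdicCompletion I A) := by
  obtain ⟨n, x, hx⟩ := Submodule.fg_iff_exists_fin_generating_family.1 (IsNoetherian.noetherian I)
  have hx' : Ideal.span (Set.range x) = I := hx
  have hc := AdicCompletion.isAdicComplete_self I (IsNoetherian.noetherian I)
  obtain ⟨F, hF1, hF2⟩ := mvps_eval (I.map (algebraMap A (AdicCompletion I A)))
    (algebraMap A (AdicCompletion I A)) (fun i => algebraMap _ _ (x i))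
    (fun i => Ideal.mem_map_of_mem _ (hx' ▸ Ideal.subset_span ⟨i, rfl⟩))
  have hmap : (Ideal.span (Set.range (MvPowerSeries.X (R := A) (σ := Fin n)))).map F =
      I.map (algebraMap A (AdicCompletion I A)) := by
    have h9 := congrArg (Ideal.map (algebraMap A (AdicCompletion I A))) hx'
    rw [← h9, Ideal.map_span, Ideal.map_span, ← Set.range_comp, ← Set.range_comp]
    congr 2; ext1 i; simp [hF2]
  have : IsHausdorff ((Ideal.span (Set.range (MvPowerSeries.X (R := A) (σ := Fin n)))).map F)
    (AdicCompletion I A) := by rw [hmap]; infer_instance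
  refine isNoetherianRing_of_surjective _ _ F (surjective_of_mk_map_comp_surjective
    (I := Ideal.span (Set.range (MvPowerSeries.X (R := A) (σ := Fin n)))) F ?_)
  rw [hmap]
  intro y
  obtain ⟨y, rfl⟩ := Ideal.Quotient.mk_surjective y
  obtain ⟨a, ha⟩ := Ideal.Quotient.mk_surjective (AdicCompletion.evalOneₐ I y)
  refine ⟨MvPowerSeries.C a, ?_⟩
  simp only [RingHom.comp_apply, hF1]
  rw [Ideal.Quotient.mk_eq_mk_iff_sub_mem, ← AdicCompletion.ker_evalOneₐ_eq_map _ (IsNoetherian.noetherian I),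
    RingHom.mem_ker, map_sub, sub_eq_zero]
  exact ((AdicCompletion.evalOneₐ I).commutes a).trans ha

lemma surj_of_residue {A B : Type u} [CommRing A] [CommRing B] [IsLocalRing A] [IsLocalRing B]
    [IsAdicComplete (maximalIdeal A) A] [IsHausdorff (maximalIdeal B) B] (f : A →+* B)
    (h1 : (maximalIdeal A).map f = maximalIdeal B)
    (h2 : ∀ b, ∃ a, b - f a ∈ maximalIdeal B) : Function.Surjective f := by
  have : IsHausdorff ((maximalIdeal A).map f) B := by rw [h1]; infer_instance
  refine surjective_of_mk_map_comp_surjective (I := maximalIdeal A) f ?_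
  intro y
  obtain ⟨y, rfl⟩ := Ideal.Quotient.mk_surjective y
  obtain ⟨a, ha⟩ := h2 y
  refine ⟨a, ?_⟩
  rw [RingHom.comp_apply, eq_comm, Ideal.Quotient.mk_eq_mk_iff_sub_mem, h1]
  exact ha

/-- the completion -/
abbrev Cp (A : Type u) [CommRing A] [IsLocalRing A] : Type u := AdicCompletion (maximalIdeal A) A

lemma Cp.residue {A : Type u} [CommRing A] [IsLocalRing A] [IsNoetherianRing A] (n : ℕ) (y : Cp A) :
    ∃ a, y - algebraMap A (Cp A) a ∈ maximalIdeal (Cp A) ^ n := by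
  obtain ⟨a, ha⟩ := Ideal.Quotient.mk_surjective (AdicCompletion.evalₐ (maximalIdeal A) n y)
  refine ⟨a, ?_⟩
  rw [AdicCompletion.maximalIdeal_eq_map, mem_pow_completion, map_sub, ← ha, sub_eq_zero]
  exact ((AdicCompletion.evalₐ _ n).commutes a).symm

lemma Cp.wr {A : Type u} [CommRing A] [IsLocalRing A] [IsNoetherianRing A] : WR A (Cp A) := by
  refine ⟨inferInstance, inferInstance, [], by simp, ?_⟩
  rw [AdicCompletion.maximalIdeal_eq_map]; simp

/-- Lemma C -/
theorem Cp.map {A B : Type u} [CommRing A] [IsLocalRing A] [IsNoetherianRing A] [CommRing B]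
    [IsLocalRing B] [IsNoetherianRing B] (f : A →+* B) (hf : Function.Surjective f)
    (hg : GeneratedByRegularSequence A (RingHom.ker f)) :
    ∃ F : Cp A →+* Cp B, (∀ a, F (algebraMap A _ a) = algebraMap B _ (f a)) ∧
      Function.Surjective F ∧ GeneratedByRegularSequence (Cp A) (RingHom.ker F) := by
  have hm := map_maximalIdeal_of_surj f hf
  obtain ⟨F, hF⟩ := adic_ext (maximalIdeal A) (maximalIdeal (Cp B))
    ((algebraMap B (Cp B)).comp f) (by
      rw [← Ideal.map_map, hm, AdicCompletion.maximalIdeal_eq_map])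
  have hF' : F.comp (algebraMap A (Cp A)) = (algebraMap B (Cp B)).comp f := RingHom.ext hF
  have hFm : (maximalIdeal (Cp A)).map F = maximalIdeal (Cp B) := by
    rw [AdicCompletion.maximalIdeal_eq_map, Ideal.map_map, hF', ← Ideal.map_map, hm,
      AdicCompletion.maximalIdeal_eq_map]
  refine ⟨F, hF, surj_of_residue F hFm fun b => ?_, ?_⟩
  · obtain ⟨c, hc⟩ := Cp.residue 1 b
    obtain ⟨a, rfl⟩ := hf c
    exact ⟨algebraMap A _ a, by rw [hF]; simpa using hc⟩
  · obtain ⟨-, rs, h1, h2⟩ := grs_iff.1 hg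
    refine grs_iff.2 ⟨RingHom.ker_ne_top F, rs.map (algebraMap A (Cp A)), ?_, ?_⟩
    · exact IsWeaklyRegular.of_flat (S := Cp A) h1
    · rw [← Ideal.map_ofList, h2]
      set K := (RingHom.ker f).map (algebraMap A (Cp A))
      apply le_antisymm
      · rw [Ideal.map_le_iff_le_comap]
        intro a ha
        change F _ = 0
        rw [hF, RingHom.comp_apply, show f a = 0 from ha, map_zero]
      · intro z hz
        rw [← Ideal.Quotient.eq_zero_iff_mem]
        refine IsHausdorff.haus (I := maximalIdeal (Cp A)) inferInstance _ fun n => ?_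
        rw [SModEq.zero]
        obtain ⟨a, ha⟩ := Cp.residue n z
        have h3 : f a ∈ maximalIdeal B ^ n := by
          have h4 := Ideal.mem_map_of_mem F ha
          rw [Ideal.map_pow, hFm, map_sub, show F z = 0 from hz, zero_sub, neg_mem_iff, hF,
            AdicCompletion.maximalIdeal_eq_map, mem_pow_completion] at h4
          rw [← Ideal.Quotient.eq_zero_iff_mem]
          exact ((AdicCompletion.evalₐ _ n).commutes (f a)).symm.trans h4
        rw [← hm, ← Ideal.map_pow, ← Ideal.mem_comap, Ideal.comap_map_of_surjective' f hf] at h3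
        obtain ⟨b, hb, c, hc, rfl⟩ := Submodule.mem_sup.1 h3

        have h5 : z - algebraMap A (Cp A) c ∈ maximalIdeal (Cp A) ^ n := by
          have : z - algebraMap A (Cp A) c = (z - algebraMap A (Cp A) (b + c)) +
            algebraMap A (Cp A) b := by rw [map_add]; ring
          rw [this]
          refine add_mem ha ?_
          rw [AdicCompletion.maximalIdeal_eq_map, ← Ideal.map_pow]
          exact Ideal.mem_map_of_mem _ hb
        have h6 : Ideal.Quotient.mk K z = (z - algebraMap A (Cp A) c) • (1 : Cp A ⧸ K) := by
          have : Ideal.Quotient.mk K (algebraMap A (Cp A) c) = 0 :=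
            Ideal.Quotient.eq_zero_iff_mem.2 (Ideal.mem_map_of_mem _ hc)
          rw [Algebra.smul_def, mul_one]
          change _ = Ideal.Quotient.mk K _
          rw [map_sub, this, sub_zero]
        rw [h6]
        exact Submodule.smul_mem_smul h5 trivial

end Compl

section PolyWR
open RingTheory.Sequence Polynomial

lemma exists_wreg_of_prime {D : Type u} [CommRing D] [IsLocalRing D] (q : Ideal D[X])
    (hq : (maximalIdeal D).map (C : D →+* D[X]) ≤ q) :
    ∃ rs : List D[X], IsWeaklyRegular (D[X] ⧸ (maximalIdeal D).map (C : D →+* D[X])) rs ∧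
      (maximalIdeal D).map (C : D →+* D[X]) ⊔ Ideal.ofList rs = q := by
  let f : D[X] →+* (ResidueField D)[X] := mapRingHom (residue D)
  have hf : Function.Surjective f := map_surjective _ residue_surjective
  have hk : RingHom.ker f = (maximalIdeal D).map (C : D →+* D[X]) := by
    rw [ker_mapRingHom, ker_residue]
  obtain ⟨g, hg⟩ := (IsPrincipalIdealRing.principal (q.map f)).principal
  obtain ⟨g, rfl⟩ := hf g
  have hq2 : q = (maximalIdeal D).map (C : D →+* D[X]) ⊔ Ideal.span {g} := by
    have h1 := Ideal.comap_map_of_surjective' f hf q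
    have h2 := Ideal.comap_map_of_surjective' f hf (Ideal.span {g})
    rw [hk, sup_eq_left.2 hq] at h1
    rw [hk] at h2
    rw [← h1, sup_comm, ← h2, Ideal.map_span, Set.image_singleton, hg]
  by_cases h0 : f g = 0
  · refine ⟨[], by simp, ?_⟩
    rw [hq2]
    have : g ∈ (maximalIdeal D).map (C : D →+* D[X]) := hk ▸ h0
    simpa using this
  · refine ⟨[g], ?_, by rw [hq2]; simp⟩
    rw [← wreg_surj f hf hk, List.map_singleton, isWeaklyRegular_singleton_iff]
    exact fun a b h => mul_left_cancel₀ h0 h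

lemma wr_poly {D : Type u} [CommRing D] [IsLocalRing D] (q : Ideal D[X]) [q.IsPrime]
    (hq : q.comap (C : D →+* D[X]) = maximalIdeal D) : WR D (Localization.AtPrime q) := by
  set B := Localization.AtPrime q
  have hq' : (maximalIdeal D).map (C : D →+* D[X]) ≤ q := Ideal.map_le_iff_le_comap.2 hq.ge
  obtain ⟨rs, h1, h2⟩ := exists_wreg_of_prime q hq'
  have e : (maximalIdeal D).map (algebraMap D B) =
      ((maximalIdeal D).map (C : D →+* D[X])).map (algebraMap D[X] B) := by
    rw [Ideal.map_map]; rfl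
  have hl : IsLocalHom (algebraMap D B) := by
    refine ((IsLocalRing.local_hom_TFAE _).out 0 2).2 ?_
    rw [e, ← Localization.AtPrime.map_eq_maximalIdeal]
    exact Ideal.map_mono hq'
  have : Module.Flat D[X] B := IsLocalization.flat B q.primeCompl
  refine ⟨hl, Module.Flat.trans D D[X] B, rs.map (algebraMap D[X] B), ?_, ?_⟩
  · have h3 := IsWeaklyRegular.isWeaklyRegular_lTensor (M₂ := B) h1
    rw [isWeaklyRegular_map_algebraMap_iff, e]
    refine (LinearEquiv.isWeaklyRegular_congr ?_ rs).1 h3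
    exact ((Algebra.TensorProduct.quotIdealMapEquivTensorQuot B
      ((maximalIdeal D).map (C : D →+* D[X]))).symm.toLinearEquiv.restrictScalars D[X])
  · rw [e, ← Ideal.map_ofList, ← Ideal.map_sup, h2, Localization.AtPrime.map_eq_maximalIdeal]

lemma wreg_mvPoly (A : Type u) [CommRing A] (n : ℕ) :
    IsWeaklyRegular (MvPolynomial (Fin n) A) (List.ofFn (MvPolynomial.X (R := A) (σ := Fin n))) ∧
    Ideal.ofList (List.ofFn (MvPolynomial.X (R := A) (σ := Fin n))) =
      RingHom.ker (MvPolynomial.constantCoeff (R := A) (σ := Fin n)) := by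
  induction n with
  | zero =>
    refine ⟨by simp, ?_⟩
    rw [List.ofFn_zero, Ideal.ofList_nil, eq_comm, ← RingHom.injective_iff_ker_eq_bot]
    intro a b h
    rw [MvPolynomial.eq_C_of_isEmpty a, MvPolynomial.eq_C_of_isEmpty b]
    exact congrArg _ h
  | succ n ih =>
    let f : MvPolynomial (Fin (n+1)) A →ₐ[A] MvPolynomial (Fin n) A :=
      MvPolynomial.aeval (Fin.cons 0 MvPolynomial.X)
    have hf : Function.Surjective f := by
      have : f.comp (MvPolynomial.rename Fin.succ) = AlgHom.id A _ := by ext i; simp [f]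
      exact fun x => ⟨_, DFunLike.congr_fun this x⟩
    have hker : Ideal.ofList [(MvPolynomial.X 0 : MvPolynomial (Fin (n+1)) A)] =
        RingHom.ker (f : _ →+* MvPolynomial (Fin n) A) := by
      have h3 : (Polynomial.aeval (0 : MvPolynomial (Fin n) A)).toRingHom.comp
          (MvPolynomial.finSuccEquiv A n).toRingEquiv.toRingHom = (f : _ →+* _) := by
        refine MvPolynomial.ringHom_ext (fun a => ?_) fun i => ?_
        · change Polynomial.aeval 0 (MvPolynomial.finSuccEquiv A n (MvPolynomial.C a)) = f _
          rw [MvPolynomial.finSuccEquiv_apply]; simp [f]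
        · change Polynomial.aeval 0 (MvPolynomial.finSuccEquiv A n (MvPolynomial.X i)) = f _
          refine Fin.cases ?_ (fun i => ?_) i
          · rw [MvPolynomial.finSuccEquiv_X_zero]; simp [f]
          · rw [MvPolynomial.finSuccEquiv_X_succ]; simp [f]
      ext x
      rw [← h3, Ideal.ofList_singleton, Ideal.mem_span_singleton,
        ← map_dvd_iff (MvPolynomial.finSuccEquiv A n), MvPolynomial.finSuccEquiv_X_zero,
        Polynomial.X_dvd_iff, RingHom.mem_ker, Polynomial.coeff_zero_eq_aeval_zero]
      rfl
    have hcc : (MvPolynomial.constantCoeff (R := A) (σ := Fin n)).comp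
        (f : MvPolynomial (Fin (n+1)) A →+* MvPolynomial (Fin n) A) =
        MvPolynomial.constantCoeff := by
      ext i
      · simp [f]
      · refine Fin.cases ?_ (fun i => ?_) i <;> simp [f]
    have hmap : (List.ofFn fun i : Fin n => (MvPolynomial.X i.succ : MvPolynomial (Fin (n+1)) A)).map
        (f : _ →+* MvPolynomial (Fin n) A) = List.ofFn MvPolynomial.X := by
      rw [List.map_ofFn]; congr 1; ext1 i; simp [f]
    have hreg : IsSMulRegular (MvPolynomial (Fin (n+1)) A) (MvPolynomial.X (0 : Fin (n+1)) : MvPolynomial (Fin (n+1)) A) := by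
      intro a b h
      exact MvPolynomial.X_mul_cancel_left_iff.1 h
    rw [List.ofFn_succ, ← List.singleton_append]
    constructor
    · rw [wreg_append_iff (f : _ →+* MvPolynomial (Fin n) A) hf hker, hmap,
        isWeaklyRegular_singleton_iff]
      exact ⟨hreg, ih.1⟩
    · have h5 := Ideal.comap_map_of_surjective' (f : MvPolynomial (Fin (n+1)) A →+* MvPolynomial (Fin n) A) hf
        (Ideal.ofList (List.ofFn fun i : Fin n => MvPolynomial.X i.succ))
      rw [Ideal.ofList_append, hker, sup_comm, ← h5, Ideal.map_ofList, hmap, ih.2, ← hcc]; rfl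
end PolyWR

section Lift
open RingTheory.Sequence

/-- square-zero lifting property when `p` is nilpotent -/
def LP (C : Type u) [CommRing C] (p : ℕ) : Prop :=
  ∀ (A A' : Type u) (_ : CommRing A) (_ : CommRing A') (q : A →+* A'), Function.Surjective q →
    (∀ x y, q x = 0 → q y = 0 → x * y = 0) → IsNilpotent (p : A) → ∀ f : C →+* A',
    ∃ g : C →+* A, q.comp g = f

lemma glue_quot {C A : Type u} [CommRing C] [CommRing A] (I J : Ideal A) (a : C →+* A ⧸ I)
    (b : C →+* A ⧸ J) (h : (Ideal.Quotient.factor (le_sup_left : I ≤ I ⊔ J)).comp a =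
      (Ideal.Quotient.factor (le_sup_right : J ≤ I ⊔ J)).comp b) :
    ∃ c : C →+* A ⧸ (I ⊓ J), (Ideal.Quotient.factor (inf_le_left : I ⊓ J ≤ I)).comp c = a ∧
      (Ideal.Quotient.factor (inf_le_right : I ⊓ J ≤ J)).comp c = b := by
  let j : A ⧸ (I ⊓ J) →+* (A ⧸ I) × (A ⧸ J) :=
    (Ideal.Quotient.factor inf_le_left).prod (Ideal.Quotient.factor inf_le_right)
  have hj : Function.Injective j := by
    rw [injective_iff_map_eq_zero]
    intro x hx
    obtain ⟨x, rfl⟩ := Ideal.Quotient.mk_surjective x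
    rw [Prod.ext_iff] at hx
    exact Ideal.Quotient.eq_zero_iff_mem.2
      ⟨Ideal.Quotient.eq_zero_iff_mem.1 hx.1, Ideal.Quotient.eq_zero_iff_mem.1 hx.2⟩
  have hr : ∀ c, ∃ y, j y = (a c, b c) := by
    intro c
    have hc := DFunLike.congr_fun h c
    simp only [RingHom.comp_apply] at hc
    obtain ⟨x, hx⟩ := Ideal.Quotient.mk_surjective (a c)
    obtain ⟨y, hy⟩ := Ideal.Quotient.mk_surjective (b c)
    rw [← hx, ← hy, Ideal.Quotient.factor_mk, Ideal.Quotient.factor_mk,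
      Ideal.Quotient.mk_eq_mk_iff_sub_mem] at hc
    obtain ⟨u, hu, v, hv, huv⟩ := Submodule.mem_sup.1 hc
    refine ⟨Ideal.Quotient.mk _ (x - u), ?_⟩
    rw [← hx, ← hy]
    refine Prod.ext ?_ ?_
    · change Ideal.Quotient.mk I (x - u) = _
      rw [map_sub, Ideal.Quotient.eq_zero_iff_mem.2 hu, sub_zero]
    · change Ideal.Quotient.mk J (x - u) = _
      rw [Ideal.Quotient.mk_eq_mk_iff_sub_mem]
      rwa [show x - u - y = v by rw [sub_right_comm, ← huv]; ring]
  choose c hc using hr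
  refine ⟨⟨⟨⟨c, hj ?_⟩, fun x y => hj ?_⟩, hj ?_, fun x y => hj ?_⟩, ?_, ?_⟩
  any_goals simp [hc]
  · ext x; exact congrArg Prod.fst (hc x)
  · ext x; exact congrArg Prod.snd (hc x)

variable {C A : Type u} [CommRing C] [CommRing A]

lemma lift_step {p : ℕ} (hC : LP C p) (m : Ideal A) (hp : (p : A) ∈ m) (K : Ideal A)
    (n : ℕ) (f : C →+* A ⧸ (K ⊔ m ^ (n + 2)))
    (g : C →+* A ⧸ m ^ (n + 1))
    (h : (Ideal.Quotient.factor (le_sup_right : _ ≤ K ⊔ m ^ (n + 1))).comp g =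
      (Ideal.Quotient.factor (sup_le_sup_left (Ideal.pow_le_pow_right (by omega)) K)).comp f) :
    ∃ g' : C →+* A ⧸ m ^ (n + 2),
      (Ideal.Quotient.factor (Ideal.pow_le_pow_right (by omega))).comp g' = g ∧
      (Ideal.Quotient.factor (le_sup_right : _ ≤ K ⊔ m ^ (n + 2))).comp g' = f := by
  have hsup : m ^ (n + 1) ⊔ (K ⊔ m ^ (n + 2)) = K ⊔ m ^ (n + 1) := by
    rw [sup_comm, sup_assoc, sup_eq_right.2 (Ideal.pow_le_pow_right (by omega) : m ^ (n+2) ≤ m ^ (n+1))]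
  obtain ⟨c, hc1, hc2⟩ := glue_quot (m ^ (n + 1)) (K ⊔ m ^ (n + 2)) g f (by
    have h2 := congrArg ((Ideal.Quotient.factor hsup.ge).comp) h
    rw [← RingHom.comp_assoc, ← RingHom.comp_assoc, Ideal.Quotient.factor_comp,
      Ideal.Quotient.factor_comp] at h2
    exact h2)
  have hle : m ^ (n + 2) ≤ m ^ (n + 1) ⊓ (K ⊔ m ^ (n + 2)) :=
    le_inf (Ideal.pow_le_pow_right (by omega)) le_sup_right
  obtain ⟨g', hg'⟩ := hC _ _ _ _ (Ideal.Quotient.factor hle) (Ideal.Quotient.factor_surjective hle) (by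
    intro x y hx hy
    obtain ⟨x, rfl⟩ := Ideal.Quotient.mk_surjective x
    obtain ⟨y, rfl⟩ := Ideal.Quotient.mk_surjective y
    rw [Ideal.Quotient.factor_mk, Ideal.Quotient.eq_zero_iff_mem] at hx hy
    rw [← map_mul, Ideal.Quotient.eq_zero_iff_mem]
    have := Ideal.mul_mem_mul hx.1 hy.1
    rw [← pow_add] at this
    exact Ideal.pow_le_pow_right (by omega) this) (by
    refine ⟨n + 2, ?_⟩
    rw [← map_natCast (Ideal.Quotient.mk (m ^ (n+2))), ← map_pow, Ideal.Quotient.eq_zero_iff_mem]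
    exact Ideal.pow_mem_pow hp _) c
  refine ⟨g', ?_, ?_⟩
  · rw [← hc1, ← hg', ← RingHom.comp_assoc, Ideal.Quotient.factor_comp]
  · rw [← hc2, ← hg', ← RingHom.comp_assoc, Ideal.Quotient.factor_comp]

variable [IsLocalRing A]

theorem lift_quot [IsNoetherianRing A] [IsAdicComplete (maximalIdeal A) A]
    {p : ℕ} (hC : LP C p) (hp : (p : A) ∈ maximalIdeal A) (K : Ideal A) (hK : K ≤ maximalIdeal A)
    (f : C →+* A ⧸ K) : ∃ g : C →+* A, (Ideal.Quotient.mk K).comp g = f := by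
  set m := maximalIdeal A
  let ff : ∀ n, C →+* A ⧸ (K ⊔ m ^ n) := fun n => (Ideal.Quotient.factor le_sup_left).comp f
  let T : ℕ → Type u := fun n => {g : C →+* A ⧸ m ^ (n + 1) //
    (Ideal.Quotient.factor (le_sup_right : _ ≤ K ⊔ m ^ (n + 1))).comp g = ff (n + 1)}
  have hstep : ∀ n (g : T n), ∃ g' : T (n + 1),
      (Ideal.Quotient.factor (Ideal.pow_le_pow_right (by omega))).comp g'.1 = g.1 := by
    intro n g
    obtain ⟨g', h1, h2⟩ := lift_step hC m hp K n (ff (n + 2)) g.1 (by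
      rw [g.2, ← RingHom.comp_assoc, Ideal.Quotient.factor_comp])
    exact ⟨⟨g', h2⟩, h1⟩
  have h0 : Nonempty (T 0) := by
    have e : K ≤ m ^ (0 + 1) := by simpa using hK
    refine ⟨⟨(Ideal.Quotient.factor e).comp f, ?_⟩⟩
    rw [← RingHom.comp_assoc, Ideal.Quotient.factor_comp]
  choose s hs using hstep
  let G : ∀ n, T n := fun n => Nat.rec h0.some s n
  have ha : StrictMono (fun n : ℕ => n + 1) := fun a b h => by simpa using h
  have hG : ∀ {n}, (Ideal.Quotient.factorPow m (ha.monotone n.le_succ)).comp (G (n + 1)).1 = (G n).1 :=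
    fun {n} => hs n (G n)
  refine ⟨IsAdicComplete.StrictMono.liftRingHom m ha (fun n => (G n).1) hG, ?_⟩
  ext c
  rw [← sub_eq_zero]
  refine IsHausdorff.haus (I := m) (inferInstance : IsHausdorff m (A ⧸ K)) _ fun n => ?_
  rw [SModEq.zero]
  set g := IsAdicComplete.StrictMono.liftRingHom m ha (fun n => (G n).1) hG
  have h1 : Ideal.Quotient.mk (m ^ (n + 1)) (g c) = (G n).1 c :=
    IsAdicComplete.StrictMono.mk_liftRingHom m ha (fun n => (G n).1) hG c
  have h2 := DFunLike.congr_fun (G n).2 c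
  rw [RingHom.comp_apply, ← h1, Ideal.Quotient.factor_mk] at h2
  obtain ⟨x, hx⟩ := Ideal.Quotient.mk_surjective (f c)
  rw [RingHom.comp_apply, ← hx]
  simp only [ff, RingHom.comp_apply] at h2
  rw [← hx, Ideal.Quotient.factor_mk, Ideal.Quotient.mk_eq_mk_iff_sub_mem] at h2
  obtain ⟨u, hu, v, hv, huv⟩ := Submodule.mem_sup.1 h2
  have h3 : Ideal.Quotient.mk K (g c) - Ideal.Quotient.mk K x = v • (1 : A ⧸ K) := by
    rw [← map_sub, ← huv, map_add, Ideal.Quotient.eq_zero_iff_mem.2 hu, zero_add, Algebra.smul_def,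
      mul_one]; rfl
  rw [h3]
  exact Submodule.smul_mem_smul (Ideal.pow_le_pow_right (by omega) hv) trivial

theorem lift_surj [IsNoetherianRing A] [IsAdicComplete (maximalIdeal A) A]
    {p : ℕ} (hC : LP C p) (hp : (p : A) ∈ maximalIdeal A) {B : Type u} [CommRing B] [Nontrivial B]
    (π : A →+* B) (hπ : Function.Surjective π) (f : C →+* B) : ∃ g : C →+* A, π.comp g = f := by
  let e := RingHom.quotientKerEquivOfSurjective hπ
  obtain ⟨g, hg⟩ := lift_quot hC hp (RingHom.ker π) (le_maximalIdeal (RingHom.ker_ne_top π))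
    (e.symm.toRingHom.comp f)
  refine ⟨g, ?_⟩
  ext c
  have := congrArg e (DFunLike.congr_fun hg c)
  simp [e] at this
  exact this
end Lift

section UUsec
open RingTheory.Sequence

/-- the list `[p]`, or `[]` if `p = 0` -/
def pl (p : ℕ) (C : Type u) [CommRing C] : List C := if p = 0 then [] else [(p : C)]

lemma pl_map (p : ℕ) {C D : Type u} [CommRing C] [CommRing D] (f : C →+* D) :
    (pl p C).map f = pl p D := by
  unfold pl; split <;> simp

variable (C : Type u) [CommRing C] [IsLocalRing C] (n : ℕ)

/-- the ideal `(m, X)` -/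
noncomputable abbrev qq : Ideal (MvPolynomial (Fin n) C) :=
  (maximalIdeal C).comap (MvPolynomial.constantCoeff : MvPolynomial (Fin n) C →+* C)

instance qq_prime : (qq C n).IsPrime := inferInstance

/-- localized polynomial ring -/
abbrev UL : Type u := Localization.AtPrime (qq C n)

/-- completed localized polynomial ring -/
abbrev UU : Type u := Cp (UL C n)

/-- structure map -/
noncomputable def Uι : MvPolynomial (Fin n) C →+* UU C n :=
  (algebraMap (UL C n) (UU C n)).comp (algebraMap _ (UL C n))

lemma UU_wreg [IsNoetherianRing C] (rs : List C) (h : IsWeaklyRegular C rs)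
    (hm : Ideal.ofList rs = maximalIdeal C) :
    IsWeaklyRegular (UU C n) (List.ofFn (fun i => Uι C n (MvPolynomial.X i)) ++
      rs.map ((Uι C n).comp MvPolynomial.C)) ∧
    Ideal.ofList (List.ofFn (fun i => Uι C n (MvPolynomial.X i)) ++
      rs.map ((Uι C n).comp MvPolynomial.C)) = maximalIdeal (UU C n) := by
  obtain ⟨h1, h2⟩ := wreg_mvPoly C n
  have hs : Function.Surjective (MvPolynomial.constantCoeff : MvPolynomial (Fin n) C →+* C) :=
    fun c => ⟨MvPolynomial.C c, by simp⟩
  let L : List (MvPolynomial (Fin n) C) := List.ofFn MvPolynomial.X ++ rs.map MvPolynomial.C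
  have hL : IsWeaklyRegular (MvPolynomial (Fin n) C) L := by
    rw [wreg_append_iff _ hs h2]
    refine ⟨h1, ?_⟩
    rw [List.map_map]
    convert h
    simp [Function.comp_def]
  have hq : Ideal.ofList L = qq C n := by
    rw [Ideal.ofList_append, h2, ← Ideal.map_ofList, hm]
    apply le_antisymm
    · refine sup_le (fun x hx => ?_) (Ideal.map_le_iff_le_comap.2 fun x hx => ?_)
      · rw [Ideal.mem_comap, RingHom.mem_ker.1 hx]; exact zero_mem _
      · simpa [Ideal.mem_comap] using hx
    · intro x hx
      rw [← sub_add_cancel x (MvPolynomial.C (MvPolynomial.constantCoeff x))]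
      refine add_mem (Ideal.mem_sup_left ?_) (Ideal.mem_sup_right (Ideal.mem_map_of_mem _ hx))
      simp [RingHom.mem_ker]
  have hfl : Module.Flat (MvPolynomial (Fin n) C) (UL C n) :=
    IsLocalization.flat _ (qq C n).primeCompl
  have hL1 := hL.of_flat (S := UL C n)
  have hL2 := hL1.of_flat (S := UU C n)
  have e : (L.map (algebraMap _ (UL C n))).map (algebraMap _ (UU C n)) =
      List.ofFn (fun i => Uι C n (MvPolynomial.X i)) ++
      rs.map ((Uι C n).comp MvPolynomial.C) := by
    simp only [L, List.map_append, List.map_map, List.map_ofFn]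
    rfl
  rw [← e]
  refine ⟨hL2, ?_⟩
  rw [← Ideal.map_ofList, ← Ideal.map_ofList, hq, Localization.AtPrime.map_eq_maximalIdeal,
    AdicCompletion.maximalIdeal_eq_map]

variable {C n}
lemma UU_eval [IsNoetherianRing C] {B : Type u} [CommRing B] [IsLocalRing B]
    [IsAdicComplete (maximalIdeal B) B] (φ : C →+* B)
    (hφ : (maximalIdeal C).map φ ≤ maximalIdeal B) (b : Fin n → B) (hb : ∀ i, b i ∈ maximalIdeal B) :
    ∃ F : UU C n →+* B, (∀ c, F (Uι C n (MvPolynomial.C c)) = φ c) ∧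
      ∀ i, F (Uι C n (MvPolynomial.X i)) = b i := by
  let E : MvPolynomial (Fin n) C →+* B := MvPolynomial.eval₂Hom φ b
  have hloc : IsLocalHom φ := ((IsLocalRing.local_hom_TFAE φ).out 0 2).2 hφ
  have hE : ∀ f, E f - φ (MvPolynomial.constantCoeff f) ∈ maximalIdeal B := by
    intro f
    rw [← Ideal.Quotient.mk_eq_mk_iff_sub_mem]
    have : ((Ideal.Quotient.mk (maximalIdeal B)).comp E) =
      ((Ideal.Quotient.mk (maximalIdeal B)).comp (φ.comp MvPolynomial.constantCoeff)) := by
      ext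
      · simp [E]
      · simp [E, Ideal.Quotient.eq_zero_iff_mem, hb]
    exact DFunLike.congr_fun this f
  have hqE : ∀ f, f ∈ qq C n ↔ E f ∈ maximalIdeal B := by
    intro f
    have h1 : E f ∈ maximalIdeal B ↔ φ (MvPolynomial.constantCoeff f) ∈ maximalIdeal B := by
      refine ⟨fun h => ?_, fun h => ?_⟩
      · have := sub_mem h (hE f); rwa [sub_sub_cancel] at this
      · have := add_mem (hE f) h; rwa [sub_add_cancel] at this
    rw [h1, Ideal.mem_comap, mem_maximalIdeal, mem_maximalIdeal, mem_nonunits_iff, mem_nonunits_iff,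
      isUnit_map_iff φ]
  have hu : ∀ y : (qq C n).primeCompl, IsUnit (E y) := by
    intro y
    by_contra h
    exact y.2 ((hqE _).2 ((mem_maximalIdeal _).2 h))
  let E1 : UL C n →+* B := IsLocalization.lift hu
  obtain ⟨F, hF⟩ := adic_ext (maximalIdeal (UL C n)) (maximalIdeal B) E1 (by
    rw [← Localization.AtPrime.map_eq_maximalIdeal, Ideal.map_map, Ideal.map_le_iff_le_comap]
    intro x hx
    simpa [E1] using (hqE x).1 hx)
  have hFE : ∀ f, F (Uι C n f) = E f := fun f => by simp [Uι, hF, E1]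
  exact ⟨F, fun c => by simp [hFE, E], fun i => by simp [hFE, E]⟩

lemma UU_uniq [IsNoetherianRing C] {B : Type u} [CommRing B] [IsLocalRing B]
    [IsHausdorff (maximalIdeal B) B] (F G : UU C n →+* B)
    (hF : (maximalIdeal (UU C n)).map F ≤ maximalIdeal B)
    (hG : (maximalIdeal (UU C n)).map G ≤ maximalIdeal B)
    (h1 : ∀ c, F (Uι C n (MvPolynomial.C c)) = G (Uι C n (MvPolynomial.C c)))
    (h2 : ∀ i, F (Uι C n (MvPolynomial.X i)) = G (Uι C n (MvPolynomial.X i))) : F = G := by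
  have h3 : F.comp (Uι C n) = G.comp (Uι C n) := by
    ext x
    · exact h1 x
    · exact h2 x
  have h4 : F.comp (algebraMap (UL C n) (UU C n)) = G.comp (algebraMap (UL C n) (UU C n)) :=
    IsLocalization.ringHom_ext (qq C n).primeCompl h3
  ext y
  rw [← sub_eq_zero]
  refine IsHausdorff.haus (I := maximalIdeal B) inferInstance _ fun k => ?_
  rw [SModEq.zero, smul_eq_mul, Ideal.mul_top]
  obtain ⟨a, ha⟩ := Cp.residue k y
  have e : F y - G y = F (y - algebraMap _ _ a) - G (y - algebraMap _ _ a) := by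
    have := DFunLike.congr_fun h4 a
    simp only [RingHom.comp_apply] at this
    rw [map_sub, map_sub, this]; ring
  rw [e]
  have key : ∀ H : UU C n →+* B, (maximalIdeal (UU C n)).map H ≤ maximalIdeal B →
      H (y - algebraMap _ _ a) ∈ maximalIdeal B ^ k := fun H hH => by
    have := Ideal.mem_map_of_mem H ha
    rw [Ideal.map_pow] at this
    exact Ideal.pow_right_mono hH k this
  exact sub_mem (key F hF) (key G hG)
end UUsec

section WRquot
open RingTheory.Sequence

lemma pushout_surj {A A1 B B1 : Type u} [CommRing A] [CommRing A1] [CommRing B] [CommRing B1]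
    [Algebra A A1] [Algebra A B] [Algebra A B1] [Algebra A1 B1] [Algebra B B1]
    [IsScalarTower A A1 B1] [IsScalarTower A B B1] (hA : Function.Surjective (algebraMap A A1))
    (hB : Function.Surjective (algebraMap B B1))
    (hk : RingHom.ker (algebraMap B B1) = (RingHom.ker (algebraMap A A1)).map (algebraMap A B))
    : Algebra.IsPushout A A1 B B1 := by
  let φ : A1 ⊗[A] B →ₐ[A1] B1 := Algebra.TensorProduct.lift (Algebra.ofId A1 B1)
    (IsScalarTower.toAlgHom A B B1) (fun _ _ => Commute.all _ _)
  have h1 : ∀ b : B, φ (1 ⊗ₜ b) = algebraMap B B1 b := fun b => by simp [φ]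
  have hall : ∀ t : A1 ⊗[A] B, ∃ b : B, t = 1 ⊗ₜ b := by
    intro t
    induction t with
    | zero => exact ⟨0, by simp⟩
    | add x y hx hy =>
      obtain ⟨a, rfl⟩ := hx; obtain ⟨b, rfl⟩ := hy
      exact ⟨a + b, by rw [TensorProduct.tmul_add]⟩
    | tmul x y =>
      obtain ⟨a, rfl⟩ := hA x
      refine ⟨a • y, ?_⟩
      rw [TensorProduct.tmul_smul, Algebra.algebraMap_eq_smul_one, TensorProduct.smul_tmul']
  have hb : Function.Bijective φ := by
    constructor
    · rw [injective_iff_map_eq_zero]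
      intro t ht
      obtain ⟨b, rfl⟩ := hall t
      rw [h1] at ht
      have hb : b ∈ RingHom.ker (algebraMap B B1) := ht
      rw [hk] at hb
      have : (RingHom.ker (algebraMap A A1)).map (algebraMap A B) ≤
          RingHom.ker (Algebra.TensorProduct.includeRight : B →ₐ[A] A1 ⊗[A] B) := by
        rw [Ideal.map_le_iff_le_comap]
        intro a ha
        rw [Ideal.mem_comap, RingHom.mem_ker, AlgHom.commutes, Algebra.TensorProduct.algebraMap_apply,
          RingHom.mem_ker.1 ha, TensorProduct.zero_tmul]
      exact this hb
    · intro x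
      obtain ⟨b, rfl⟩ := hB x
      exact ⟨_, h1 b⟩
  exact ⟨IsBaseChange.of_equiv (AlgEquiv.ofBijective φ hb).toLinearEquiv h1⟩

lemma flat_surj {A A1 B B1 : Type u} [CommRing A] [CommRing A1] [CommRing B] [CommRing B1]
    [Algebra A A1] [Algebra A B] [Algebra A B1] [Algebra A1 B1] [Algebra B B1]
    [IsScalarTower A A1 B1] [IsScalarTower A B B1] (hA : Function.Surjective (algebraMap A A1))
    (hB : Function.Surjective (algebraMap B B1))
    (hk : RingHom.ker (algebraMap B B1) = (RingHom.ker (algebraMap A A1)).map (algebraMap A B))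
    [Module.Flat A B] : Module.Flat A1 B1 := by
  have := pushout_surj hA hB hk
  exact Module.Flat.isBaseChange A A1 B B1 this.out

lemma WR.quot {A A1 B B1 : Type u} [CommRing A] [CommRing A1] [CommRing B] [CommRing B1]
    [IsLocalRing A] [IsLocalRing A1] [IsLocalRing B] [IsLocalRing B1]
    [Algebra A A1] [Algebra A B] [Algebra A B1] [Algebra A1 B1] [Algebra B B1]
    [IsScalarTower A A1 B1] [IsScalarTower A B B1] (hA : Function.Surjective (algebraMap A A1))
    (hB : Function.Surjective (algebraMap B B1))
    (hk : RingHom.ker (algebraMap B B1) = (RingHom.ker (algebraMap A A1)).map (algebraMap A B))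
    (h : WR A B) : WR A1 B1 := by
  obtain ⟨h1, h2, rs, h3, h4⟩ := h
  have hA1 := map_maximalIdeal_of_surj (algebraMap A A1) hA
  have hB1 := map_maximalIdeal_of_surj (algebraMap B B1) hB
  have hm : (maximalIdeal A1).map (algebraMap A1 B1) =
      ((maximalIdeal A).map (algebraMap A B)).map (algebraMap B B1) := by
    rw [← hA1, Ideal.map_map, Ideal.map_map, ← IsScalarTower.algebraMap_eq,
      ← IsScalarTower.algebraMap_eq]
  have hle : (maximalIdeal A1).map (algebraMap A1 B1) ≤ maximalIdeal B1 := by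
    rw [hm, ← hB1]; exact Ideal.map_mono map_maximalIdeal_le
  refine ⟨((IsLocalRing.local_hom_TFAE (algebraMap A1 B1)).out 0 2).2 hle, flat_surj hA hB hk,
    rs.map (algebraMap B B1), ?_, ?_⟩
  · rw [← wreg_mk, List.map_map, ← RingHom.coe_comp]
    refine (wreg_surj ((Ideal.Quotient.mk _).comp (algebraMap B B1))
      (Ideal.Quotient.mk_surjective.comp hB) ?_).2 h3
    rw [← RingHom.comap_ker, Ideal.mk_ker, hm, Ideal.comap_map_of_surjective' _ hB, hk]
    exact sup_eq_left.2 (Ideal.map_mono (le_maximalIdeal (RingHom.ker_ne_top _)))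
  · rw [hm, ← Ideal.map_ofList, ← Ideal.map_sup, h4, hB1]

lemma wr_of_wreg {A B : Type u} [CommRing A] [CommRing B] [IsLocalRing A] [IsLocalRing B]
    [IsNoetherianRing A] [IsNoetherianRing B] [Algebra A B] [IsLocalHom (algebraMap A B)]
    (rs : List A) (ss : List B) (h1 : Ideal.ofList rs = maximalIdeal A)
    (h2 : IsWeaklyRegular B (rs.map (algebraMap A B) ++ ss))
    (h3 : Ideal.ofList (rs.map (algebraMap A B) ++ ss) = maximalIdeal B) : WR A B := by
  have hm : (maximalIdeal A).map (algebraMap A B) = Ideal.ofList (rs.map (algebraMap A B)) := by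
    rw [← h1, Ideal.map_ofList]
  rw [wreg_append_iff (Ideal.Quotient.mk ((maximalIdeal A).map (algebraMap A B)))
    Ideal.Quotient.mk_surjective (by rw [Ideal.mk_ker, hm]), wreg_mk] at h2
  refine ⟨inferInstance, flat_of_wreg rs h1 h2.1, ss, h2.2, ?_⟩
  rw [hm, ← Ideal.ofList_append, h3]
end WRquot

section CD
open RingTheory.Sequence

/-- `C` is a Cohen ring for `k` -/
structure CohenData (k : Type u) [Field k] (p : ℕ) (C : Type u) [CommRing C] [IsLocalRing C] :
    Prop where
  wreg : IsWeaklyRegular C (pl p C)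
  max : Ideal.ofList (pl p C) = maximalIdeal C
  lp : LP C p
  res : ∃ σ : C →+* k, Function.Surjective σ

variable {k : Type u} [Field k] {p : ℕ} {C : Type u} [CommRing C] [IsLocalRing C]
  [IsNoetherianRing C]

lemma pl_le {B : Type u} [CommRing B] {I : Ideal B} (h : (p : B) ∈ I) : Ideal.ofList (pl p B) ≤ I := by
  refine ofList_le fun r hr => ?_
  unfold pl at hr
  split at hr <;> simp at hr
  rwa [hr]

lemma CohenData.map_le (h : CohenData k p C) {B : Type u} [CommRing B] [IsLocalRing B]
    (hB : (p : B) ∈ maximalIdeal B) (g : C →+* B) : (maximalIdeal C).map g ≤ maximalIdeal B := by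
  rw [← h.max, Ideal.map_ofList, pl_map]
  exact pl_le hB

lemma CohenData.UU_wreg (h : CohenData k p C) (n : ℕ) :
    IsWeaklyRegular (UU C n) (List.ofFn (fun i => Uι C n (MvPolynomial.X i)) ++ pl p (UU C n)) ∧
    Ideal.ofList (List.ofFn (fun i => Uι C n (MvPolynomial.X i)) ++ pl p (UU C n)) =
      maximalIdeal (UU C n) := by

  have := _root_.UU_wreg C n _ h.wreg h.max
  rwa [pl_map] at this

lemma CohenData.surj {B : Type u} [CommRing B] [IsLocalRing B] [IsNoetherianRing B]
    [IsAdicComplete (maximalIdeal B) B] (h : CohenData (ResidueField B) p C)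
    (hB : (p : B) ∈ maximalIdeal B) {n : ℕ} (b : Fin n → B) (hb : Ideal.span (Set.range b) = maximalIdeal B) :
    ∃ F : UU C n →+* B, Function.Surjective F ∧ ∀ i, F (Uι C n (MvPolynomial.X i)) = b i := by

  obtain ⟨σ, hσ⟩ := h.res
  obtain ⟨φ, hφ⟩ := lift_surj h.lp hB (residue B) residue_surjective σ
  have hbi : ∀ i, b i ∈ maximalIdeal B := fun i => hb ▸ Ideal.subset_span ⟨i, rfl⟩
  obtain ⟨F, hF1, hF2⟩ := UU_eval φ (h.map_le hB φ) b hbi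
  refine ⟨F, surj_of_residue F ?_ ?_, hF2⟩
  · rw [← (h.UU_wreg n).2, Ideal.ofList_append, Ideal.map_sup, Ideal.map_ofList, Ideal.map_ofList,
      pl_map, List.map_ofFn]
    have e : Ideal.ofList (List.ofFn (F ∘ fun i => Uι C n (MvPolynomial.X i))) = maximalIdeal B := by
      rw [← hb]
      unfold Ideal.ofList
      congr 1
      ext x
      simp [hF2, List.mem_ofFn]
    rw [e]
    exact sup_eq_left.2 (pl_le hB)
  · intro x
    obtain ⟨c, hc⟩ := hσ (residue B x)
    refine ⟨Uι C n (MvPolynomial.C c), ?_⟩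
    rw [hF1, ← residue_eq_zero_iff, map_sub, ← hc, ← hφ]
    simp
end CD

section ThmE
open RingTheory.Sequence

theorem cohen_fact_aux (hcd : ∀ (k : Type u) [Field k] (p : ℕ) [CharP k p],
    ∃ (C : Type u) (_ : CommRing C) (_ : IsLocalRing C) (_ : IsNoetherianRing C), CohenData k p C)
    {P B : Type u} [CommRing P] [CommRing B] [IsLocalRing P] [IsLocalRing B]
    [IsNoetherianRing P] [IsNoetherianRing B] [IsAdicComplete (maximalIdeal P) P]
    [IsAdicComplete (maximalIdeal B) B] (f : P →+* B) [IsLocalHom f] :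
    ∃ (V : Type u) (_ : CommRing V) (_ : IsLocalRing V) (_ : IsNoetherianRing V) (_ : Algebra P V)
      (g : V →+* B), WR P V ∧ Function.Surjective g ∧ ∀ x, g (algebraMap P V x) = f x := by
  have hfm : (maximalIdeal P).map f ≤ maximalIdeal B :=
    ((IsLocalRing.local_hom_TFAE f).out 0 2).1 ‹_›
  let p := ringChar (ResidueField P)
  have hc : CharP (ResidueField P) p := ringChar.charP _
  have hc' : CharP (ResidueField B) p :=
    charP_of_injective_ringHom (ResidueField.map f).injective p
  have hp : (p : P) ∈ maximalIdeal P := by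
    rw [← residue_eq_zero_iff, map_natCast, CharP.cast_eq_zero]
  have hp' : (p : B) ∈ maximalIdeal B := by
    rw [← residue_eq_zero_iff, map_natCast, CharP.cast_eq_zero]
  obtain ⟨C, _, _, _, hC⟩ := hcd (ResidueField P) p
  obtain ⟨C', _, _, _, hC'⟩ := hcd (ResidueField B) p
  obtain ⟨n, x, hx⟩ := Submodule.fg_iff_exists_fin_generating_family.1
    (IsNoetherian.noetherian (maximalIdeal P))
  obtain ⟨n', y, hy⟩ := Submodule.fg_iff_exists_fin_generating_family.1
    (IsNoetherian.noetherian (maximalIdeal B))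
  obtain ⟨F, hF, hFx⟩ := hC.surj hp x hx
  obtain ⟨F', hF', hFx'⟩ := hC'.surj hp' (Fin.append (fun i => f (x i)) y) (by
    apply le_antisymm
    · rw [Ideal.span_le]
      rintro _ ⟨i, rfl⟩
      refine Fin.addCases (fun i => ?_) (fun i => ?_) i
      · rw [Fin.append_left]
        exact hfm (Ideal.mem_map_of_mem _ (hx ▸ Ideal.subset_span ⟨i, rfl⟩))
      · rw [Fin.append_right]
        exact hy.le (Ideal.subset_span ⟨i, rfl⟩)
    · rw [← hy]
      refine Ideal.span_mono ?_
      rintro _ ⟨i, rfl⟩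
      exact ⟨Fin.natAdd n i, Fin.append_right _ _ i⟩)
  have hU := hC.UU_wreg n
  have hU' := hC'.UU_wreg (n + n')
  have hpU' : (p : UU C' (n + n')) ∈ maximalIdeal (UU C' (n + n')) := by
    rw [mem_maximalIdeal, mem_nonunits_iff]
    intro h
    have := h.map F'
    rw [map_natCast] at this
    exact hp' this
  obtain ⟨χ, hχ⟩ := lift_surj hC.lp hpU' F' hF' ((f.comp F).comp ((Uι C n).comp MvPolynomial.C))
  have hXm : ∀ i, Uι C' (n + n') (MvPolynomial.X i) ∈ maximalIdeal (UU C' (n + n')) := fun i =>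
    mem_of_ofList_le hU'.2.le _ (List.mem_append_left _ (List.mem_ofFn.2 ⟨i, rfl⟩))
  obtain ⟨G, hG1, hG2⟩ := UU_eval χ (hC.map_le hpU' χ)
    (fun i : Fin n => Uι C' (n + n') (MvPolynomial.X (Fin.castAdd n' i))) (fun i => hXm _)
  have hpl : (pl p (UU C n)).map G = pl p (UU C' (n + n')) := pl_map p G
  have hGm : (maximalIdeal (UU C n)).map G ≤ maximalIdeal (UU C' (n + n')) := by
    rw [← hU.2, Ideal.map_ofList, List.map_append, hpl, Ideal.ofList_append]
    refine sup_le (ofList_le fun r hr => ?_) (pl_le hpU')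
    rw [List.map_ofFn, List.mem_ofFn] at hr
    obtain ⟨i, rfl⟩ := hr
    simp only [Function.comp_apply, hG2]
    exact hXm _
  have hFm := (map_maximalIdeal_of_surj F hF).le
  have hFm' := (map_maximalIdeal_of_surj F' hF').le
  have hcomm : F'.comp G = f.comp F := by
    apply UU_uniq
    · rw [← Ideal.map_map]; exact (Ideal.map_mono hGm).trans hFm'
    · rw [← Ideal.map_map]; exact (Ideal.map_mono hFm).trans hfm
    · intro c
      rw [RingHom.comp_apply, hG1]
      exact DFunLike.congr_fun hχ c
    · intro i
      rw [RingHom.comp_apply, RingHom.comp_apply, hG2, hFx', Fin.append_left, hFx]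
  let U := UU C n
  let U' := UU C' (n + n')
  let _ : Algebra U U' := G.toAlgebra
  have hGl : IsLocalHom (algebraMap U U') := ((IsLocalRing.local_hom_TFAE G).out 0 2).2 hGm
  have hWR : WR U U' := by
    let ss : List U' := List.ofFn fun i => Uι C' (n + n') (MvPolynomial.X (Fin.natAdd n i))
    have hperm : (List.ofFn (fun i => Uι C' (n + n') (MvPolynomial.X i)) ++ pl p U').Perm
        ((List.ofFn (fun i => Uι C n (MvPolynomial.X i)) ++ pl p U).map (algebraMap U U') ++ ss) := by
      have e : (List.ofFn (fun i => Uι C n (MvPolynomial.X i)) ++ pl p U).map (algebraMap U U') =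
        List.ofFn (fun i => Uι C' (n + n') (MvPolynomial.X (Fin.castAdd n' i))) ++ pl p U' := by
        rw [List.map_append, List.map_ofFn, pl_map]
        congr 2
        funext i
        exact hG2 i
      rw [e, List.ofFn_add, List.append_assoc, List.append_assoc]
      exact List.Perm.append_left _ List.perm_append_comm
    refine wr_of_wreg _ ss hU.2 (wreg_perm hU'.1 hperm hU'.2.le) ?_
    rw [← ofList_perm hperm, hU'.2]
  let K : Ideal U' := (RingHom.ker F).map G
  have hKB : K ≤ RingHom.ker F' := by
    rw [Ideal.map_le_iff_le_comap]
    intro a ha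
    have := DFunLike.congr_fun hcomm a
    rw [RingHom.comp_apply, RingHom.comp_apply, RingHom.mem_ker.1 ha, map_zero] at this
    exact this
  have hKm : K ≤ maximalIdeal U' := hKB.trans (le_maximalIdeal (RingHom.ker_ne_top _))
  let V := U' ⧸ K
  have : IsLocalRing V := isLocalRing_quot hKm
  let e := RingHom.quotientKerEquivOfSurjective hF
  let h : P →+* V := (Ideal.quotientMap K G Ideal.le_comap_map).comp e.symm.toRingHom
  have hh : ∀ u, h (F u) = Ideal.Quotient.mk K (G u) := by
    intro u
    have : e.symm (F u) = Ideal.Quotient.mk _ u := by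
      rw [RingEquiv.symm_apply_eq]; rfl
    change Ideal.quotientMap K G Ideal.le_comap_map (e.symm (F u)) = _
    rw [this, Ideal.quotientMap_mk]
  let _ : Algebra P V := h.toAlgebra
  let _ : Algebra U P := F.toAlgebra

  have : IsScalarTower U P V := IsScalarTower.of_algebraMap_eq fun u => (hh u).symm
  have : IsScalarTower U U' V := IsScalarTower.of_algebraMap_eq fun u => rfl
  let g : V →+* B := Ideal.Quotient.lift K F' hKB
  refine ⟨V, inferInstance, inferInstance, inferInstance, inferInstance, g,
    WR.quot (A := U) (B := U') hF Ideal.Quotient.mk_surjective ?_ hWR,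
    Ideal.Quotient.lift_surjective_of_surjective _ _ hF', ?_⟩
  · exact Ideal.mk_ker
  · intro x
    obtain ⟨u, rfl⟩ := hF x
    change g (h (F u)) = _
    rw [hh]
    exact DFunLike.congr_fun hcomm u

theorem cohen_fact' (hcd : ∀ (k : Type u) [Field k] (p : ℕ) [CharP k p],
    ∃ (C : Type u) (_ : CommRing C) (_ : IsLocalRing C) (_ : IsNoetherianRing C), CohenData k p C)
    {P B : Type u} [CommRing P] [CommRing B] [IsLocalRing P] [IsLocalRing B]
    [IsNoetherianRing P] [IsNoetherianRing B]
    [IsAdicComplete (maximalIdeal B) B] (f : P →+* B) [IsLocalHom f] :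
    ∃ (V : Type u) (_ : CommRing V) (_ : IsLocalRing V) (_ : IsNoetherianRing V) (_ : Algebra P V)
      (g : V →+* B), WR P V ∧ IsAdicComplete (maximalIdeal V) V ∧ Function.Surjective g ∧
      ∀ x, g (algebraMap P V x) = f x := by
  have hfm : (maximalIdeal P).map f ≤ maximalIdeal B :=
    ((IsLocalRing.local_hom_TFAE f).out 0 2).1 ‹_›
  obtain ⟨f', hf'⟩ := adic_ext (maximalIdeal P) (maximalIdeal B) f hfm
  have : IsLocalHom f' := by
    refine ((IsLocalRing.local_hom_TFAE f').out 0 2).2 ?_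
    rw [AdicCompletion.maximalIdeal_eq_map, Ideal.map_map]
    convert hfm
    ext x; exact hf' x
  obtain ⟨V0, _, _, _, _, g0, hV, hg0, hg1⟩ := cohen_fact_aux hcd (P := Cp P) f'
  have hgm : (maximalIdeal V0).map g0 ≤ maximalIdeal B := (map_maximalIdeal_of_surj g0 hg0).le
  obtain ⟨g, hg⟩ := adic_ext (maximalIdeal V0) (maximalIdeal B) g0 hgm
  let _ : Algebra P V0 := ((algebraMap (Cp P) V0).comp (algebraMap P (Cp P))).toAlgebra
  have : IsScalarTower P (Cp P) V0 := IsScalarTower.of_algebraMap_eq fun u => rfl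

  have : IsScalarTower P V0 (Cp V0) := IsScalarTower.of_algebraMap_eq fun u => rfl
  refine ⟨Cp V0, inferInstance, inferInstance, inferInstance, inferInstance, g,
    (Cp.wr.comp hV).comp Cp.wr, inferInstance, fun b => ?_, fun x => ?_⟩
  · obtain ⟨v, rfl⟩ := hg0 b
    exact ⟨_, hg v⟩
  · change g (algebraMap V0 (Cp V0) (algebraMap (Cp P) V0 (algebraMap P (Cp P) x))) = _
    rw [hg, hg1, hf']
end ThmE

section CohenRing
open RingTheory.Sequence MvPolynomial

/-- universal derivation of a polynomial ring -/
noncomputable def dP (σ : Type u) : Derivation ℤ (MvPolynomial σ ℤ) (σ →₀ MvPolynomial σ ℤ) :=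
  mkDerivation ℤ (fun a => Finsupp.single a 1)

lemma dP_X {σ : Type u} (a : σ) : dP σ (X a) = Finsupp.single a 1 := mkDerivation_X _ _ _

lemma dP_apply {σ : Type u} (f : MvPolynomial σ ℤ) (a : σ) : dP σ f a = pderiv a f := by
  classical
  have : (Finsupp.lapply a : (σ →₀ MvPolynomial σ ℤ) →ₗ[MvPolynomial σ ℤ] _).compDer (dP σ) =
      pderiv a := by
    apply derivation_ext
    intro i
    simp [dP_X, pderiv_X, Finsupp.single_apply, Pi.single_apply]
  exact DFunLike.congr_fun this f

lemma lc_mul_zero {P A σ : Type u} [CommRing P] [CommRing A] [Algebra P A] (z : σ → A) (y : A)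
    (h : ∀ a, z a * y = 0) (w : σ →₀ P) : Finsupp.linearCombination P z w * y = 0 := by
  induction w using Finsupp.induction_linear with
  | zero => simp
  | add f g hf hg => rw [map_add, add_mul, hf, hg, add_zero]
  | single a r => rw [Finsupp.linearCombination_single, smul_mul_assoc, h, smul_zero]

lemma taylor {σ A : Type u} [CommRing A] [Algebra (MvPolynomial σ ℤ) A] (E : MvPolynomial σ ℤ →+* A)
    (z : σ → A) (hE : ∀ a, E (X a) = algebraMap (MvPolynomial σ ℤ) A (X a) + z a) (hz : ∀ a b, z a * z b = 0)
    (f : MvPolynomial σ ℤ) :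
    E f = algebraMap _ A f + Finsupp.linearCombination (MvPolynomial σ ℤ) z (dP σ f) := by
  induction f using MvPolynomial.induction_on with
  | C r =>
    rw [show (C r : MvPolynomial σ ℤ) = ((r : ℤ) : MvPolynomial σ ℤ) from (eq_intCast C r)]
    simp
  | add f g hf hg => simp only [map_add, hf, hg]; ring
  | mul_X f a hf =>
    have h0 := lc_mul_zero (P := MvPolynomial σ ℤ) z (z a) (fun b => hz b a) (dP σ f)
    rw [map_mul, hf, hE, Derivation.leibniz, dP_X, map_add, map_smul, map_smul,
      Finsupp.linearCombination_single, map_mul, one_smul, Algebra.smul_def, Algebra.smul_def]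
    linear_combination h0

lemma solve {P A σ B k : Type u} [CommRing P] [CommRing A] [Algebra P A] [Field k] (π : P →+* k)
    (hπ : Function.Surjective π) (v : B → (σ →₀ P))
    (hv : LinearIndependent k fun b => (v b).mapRange π (map_zero π))
    (N : Ideal A) (p : A) (hp : IsNilpotent p)
    (hN : ∀ x, π x = 0 → ∀ y ∈ N, ∃ y' ∈ N, algebraMap P A x * y = p * y')
    (c : B → A) (hc : ∀ b, c b ∈ N) :
    ∃ z : σ → A, (∀ a, z a ∈ N) ∧ ∀ b, Finsupp.linearCombination P z (v b) = c b := by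
  classical
  have hmem : ∀ {τ : Type u} (z : τ → A) (_ : ∀ a, z a ∈ N) (w : τ →₀ P),
      Finsupp.linearCombination P z w ∈ N := by
    intro τ z hz w
    rw [Finsupp.linearCombination_apply]
    exact Submodule.sum_mem _ fun a _ => by
      change w a • z a ∈ N
      rw [Algebra.smul_def]; exact N.mul_mem_left _ (hz a)
  have hone : ∀ c : B → A, (∀ b, c b ∈ N) → ∃ z : σ → A, (∀ a, z a ∈ N) ∧
      ∀ b, ∃ y ∈ N, c b - Finsupp.linearCombination P z (v b) = p * y := by
    intro c hc
    obtain ⟨s, hs⟩ := LinearMap.exists_leftInverse_of_injective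
      (Finsupp.linearCombination k fun b => (v b).mapRange π (map_zero π))
      (LinearMap.ker_eq_bot.2 hv)
    have hlift : ∀ a : σ, ∃ w : B →₀ P, w.mapRange π (map_zero π) = s (Finsupp.single a 1) :=
      fun a => Finsupp.mapRange_surjective π (map_zero π) hπ _
    choose S hS using hlift
    have hred : ∀ w : σ →₀ P, (Finsupp.linearCombination P S w).mapRange π (map_zero π) =
        s (w.mapRange π (map_zero π)) := by
      intro w
      induction w using Finsupp.induction_linear with
      | zero => simp
      | add f g hf hg =>
        rw [map_add, Finsupp.mapRange_add (by simp), hf, hg, Finsupp.mapRange_add (by simp), map_add]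
      | single a r =>
        rw [Finsupp.linearCombination_single, Finsupp.mapRange_single,
          ← mul_one (π r), ← smul_eq_mul (π r), ← Finsupp.smul_single, map_smul, ← hS]
        ext b
        simp
    refine ⟨fun a => Finsupp.linearCombination P c (S a), fun a => hmem c hc _, fun b => ?_⟩
    have h1 : Finsupp.linearCombination P (fun a => Finsupp.linearCombination P c (S a)) (v b) =
        Finsupp.linearCombination P c (Finsupp.linearCombination P S (v b)) := by
      rw [Finsupp.linearCombination_apply, Finsupp.linearCombination_apply P (v b), Finsupp.sum,
        Finsupp.sum, map_sum]
      simp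
    have h2 : c b = Finsupp.linearCombination P c (Finsupp.single b 1) := by simp
    rw [h1, h2, ← map_sub]
    set w := Finsupp.single b 1 - Finsupp.linearCombination P S (v b) with hw
    have hw0 : ∀ b', π (w b') = 0 := by
      intro b'
      have h3 := DFunLike.congr_fun hs (Finsupp.single b 1)
      have h4 := DFunLike.congr_fun (hred (v b)) b'
      simp only [LinearMap.comp_apply, Finsupp.linearCombination_single, one_smul,
        LinearMap.id_apply] at h3
      rw [h3, Finsupp.mapRange_apply] at h4
      rw [hw, Finsupp.sub_apply, map_sub, h4, sub_eq_zero]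
      simp only [Finsupp.single_apply]
      split <;> simp
    clear_value w
    have hsum : ∀ t : Finset B, ∃ y ∈ N, ∑ b' ∈ t, w b' • c b' = p * y := by
      intro t
      induction t using Finset.induction_on with
      | empty => exact ⟨0, zero_mem _, by simp⟩
      | insert b' t hb ih =>
        obtain ⟨y, hy, h⟩ := ih
        obtain ⟨y', hy', h'⟩ := hN (w b') (hw0 b') (c b') (hc b')
        exact ⟨y' + y, add_mem hy' hy, by
          rw [Finset.sum_insert hb, h, Algebra.smul_def, h', mul_add]⟩
    rw [Finsupp.linearCombination_apply]
    exact hsum _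
  have hall : ∀ j : ℕ, ∃ z : σ → A, (∀ a, z a ∈ N) ∧
      ∀ b, ∃ y ∈ N, c b - Finsupp.linearCombination P z (v b) = p ^ j * y := by
    intro j
    induction j with
    | zero => exact ⟨0, fun _ => zero_mem _, fun b => ⟨c b, hc b, by simp⟩⟩
    | succ j ih =>
      obtain ⟨z, hz, h⟩ := ih
      choose y hy hyy using h
      obtain ⟨z', hz', h'⟩ := hone y hy
      refine ⟨fun a => z a + p ^ j * z' a, fun a => add_mem (hz a) (N.mul_mem_left _ (hz' a)),
        fun b => ?_⟩
      obtain ⟨y', hy', hyy'⟩ := h' b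
      refine ⟨y', hy', ?_⟩
      have : Finsupp.linearCombination P (fun a => z a + p ^ j * z' a) (v b) =
        Finsupp.linearCombination P z (v b) + p ^ j * Finsupp.linearCombination P z' (v b) := by
        simp only [Finsupp.linearCombination_apply, Finsupp.sum, smul_add, Finset.sum_add_distrib,
          Finset.mul_sum, mul_smul_comm]
      rw [this]
      linear_combination hyy b + p ^ j * hyy'
  obtain ⟨n, hn⟩ := hp
  obtain ⟨z, hz, h⟩ := hall n
  refine ⟨z, hz, fun b => ?_⟩
  obtain ⟨y, _, hy⟩ := h b
  rw [hn, zero_mul, sub_eq_zero] at hy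
  exact hy.symm

lemma nilp_ker {A B : Type u} [CommRing A] [CommRing B] (q : A →+* B)
    (h : ∀ x y, q x = 0 → q y = 0 → x * y = 0) : IsNilpotent (RingHom.ker q) := by
  refine ⟨2, ?_⟩
  rw [pow_two, Ideal.zero_eq_bot, eq_bot_iff, Ideal.mul_le]
  intro r hr s hs
  rw [h r s hr hs]; exact zero_mem _

lemma cohen_zero (k : Type u) [Field k] [CharP k 0] :
    ∃ (C : Type u) (_ : CommRing C) (_ : IsLocalRing C) (_ : IsNoetherianRing C), CohenData k 0 C := by
  have : CharZero k := CharP.charP_to_charZero k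
  have h1 : Algebra.FormallySmooth ℚ k := by
    obtain ⟨s, hs⟩ := exists_isTranscendenceBasis ℚ k
    have : Algebra.IsAlgebraic (IntermediateField.adjoin ℚ (Set.range ((↑) : s → k))) k := by
      have := hs.isAlgebraic_field
      exact this
    exact .of_algebraicIndependent_of_isSeparable hs.1
  have h2 : Algebra.FormallySmooth ℤ ℚ := .of_isLocalization (nonZeroDivisors ℤ)
  have h3 : Algebra.FormallySmooth ℤ k := .comp ℤ ℚ k
  refine ⟨k, inferInstance, inferInstance, inferInstance, ⟨by simp [pl], ?_, ?_, RingHom.id k,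
    Function.surjective_id⟩⟩
  · simp [pl, IsLocalRing.maximalIdeal_eq_bot]
  · intro A A' _ _ q hq h _ f
    refine ⟨(Algebra.FormallySmooth.liftOfSurjective (R := ℤ) f.toIntAlgHom q.toIntAlgHom hq
      (nilp_ker q h)).toRingHom, ?_⟩
    ext x
    exact Algebra.FormallySmooth.liftOfSurjective_apply (R := ℤ) f.toIntAlgHom q.toIntAlgHom hq
      (nilp_ker q h) x
end CohenRing

section CohenFS
open RingTheory.Sequence MvPolynomial

lemma charP_of_prime {p : ℕ} [hp : Fact p.Prime] {A : Type u} [CommRing A] [Nontrivial A]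
    (h : (p : A) = 0) : CharP A p := by
  have h1 := ringChar.dvd h
  have h2 : ringChar A ≠ 1 := CharP.ringChar_ne_one
  rcases (Nat.dvd_prime hp.out).1 h1 with h3 | h3
  · exact absurd h3 h2
  · rw [← h3]; exact ringChar.charP A

lemma exists_section {p : ℕ} [Fact p.Prime] {O κ : Type u} [CommRing O] [Field κ]
    [Algebra.EssFiniteType ℤ κ] (q : O →+* κ) (hq : Function.Surjective q)
    (h : ∀ x y, q x = 0 → q y = 0 → x * y = 0) (hp : (p : O) = 0) :
    ∃ σ : κ →+* O, ∀ x, q (σ x) = x := by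
  have : Nontrivial O := q.domain_nontrivial
  have : CharP O p := charP_of_prime hp
  have : CharP κ p := charP_of_prime (by rw [← map_natCast q, hp, map_zero])
  let _ : Algebra (ZMod p) O := ZMod.algebra O p
  let _ : Algebra (ZMod p) κ := ZMod.algebra κ p
  have : IsScalarTower ℤ (ZMod p) κ := IsScalarTower.of_algebraMap_eq fun x => by simp
  have : Algebra.EssFiniteType (ZMod p) κ := Algebra.EssFiniteType.of_comp ℤ (ZMod p) κ
  have hc : ∀ r, q (algebraMap (ZMod p) O r) = algebraMap (ZMod p) κ r := fun r =>
    DFunLike.congr_fun (Subsingleton.elim (q.comp (algebraMap (ZMod p) O)) (algebraMap (ZMod p) κ)) r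
  let q' : O →ₐ[ZMod p] κ := { q with commutes' := hc }
  refine ⟨(Algebra.FormallySmooth.liftOfSurjective (R := ZMod p) (AlgHom.id _ κ) q' hq
      (nilp_ker q h)).toRingHom, fun x => ?_⟩
  exact Algebra.FormallySmooth.liftOfSurjective_apply (R := ZMod p) (AlgHom.id _ κ) q' hq
      (nilp_ker q h) x

theorem fs_key {p : ℕ} [Fact p.Prime] {k σ : Type u} [Field k] [CharP k p]
    (π : MvPolynomial σ ℤ →+* k) (hπ : Function.Surjective π) (f : MvPolynomial σ ℤ)
    (hf : π f = 0) (hd : ∀ a, π (pderiv a f) = 0) :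
    f ∈ RingHom.ker π ^ 2 ⊔ Ideal.span {(p : MvPolynomial σ ℤ)} := by
  obtain ⟨s, f, rfl⟩ := exists_finset_rename f
  let r : MvPolynomial {x // x ∈ s} ℤ →+* MvPolynomial σ ℤ :=
    (rename ((↑) : {x // x ∈ s} → σ) : _ →ₐ[ℤ] _).toRingHom
  have hd' : ∀ a : {x // x ∈ s}, π (r (pderiv a f)) = 0 := by
    intro a
    have := hd a
    rwa [pderiv_rename Subtype.val_injective] at this
  let I : Ideal (MvPolynomial {x // x ∈ s} ℤ) := RingHom.ker (π.comp r)
  have : I.IsPrime := RingHom.ker_isPrime _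
  let O := Localization.AtPrime I
  let m := maximalIdeal O
  have hpI : ((p : ℕ) : MvPolynomial {x // x ∈ s} ℤ) ∈ I := by
    rw [RingHom.mem_ker, map_natCast, CharP.cast_eq_zero]
  have hIm : I.map (algebraMap _ O) = m := Localization.AtPrime.map_eq_maximalIdeal
  have hpm : (p : O) ∈ m := by
    rw [← hIm, ← map_natCast (algebraMap (MvPolynomial {x // x ∈ s} ℤ) O)]
    exact Ideal.mem_map_of_mem _ hpI
  let J := m ^ 2 ⊔ Ideal.span {(p : O)}
  have hJ : J ≤ m := sup_le (Ideal.pow_le_self two_ne_zero) (by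
    rw [Ideal.span_singleton_le_iff_mem]; exact hpm)
  let q : O ⧸ J →+* ResidueField O := Ideal.Quotient.factor hJ
  have : Algebra.EssFiniteType (MvPolynomial {x // x ∈ s} ℤ) O :=
    .of_isLocalization _ I.primeCompl
  have : Algebra.EssFiniteType ℤ O := .comp ℤ (MvPolynomial {x // x ∈ s} ℤ) O
  have hess : Algebra.EssFiniteType ℤ (ResidueField O) := .comp ℤ O (ResidueField O)
  have hess' : @Algebra.EssFiniteType ℤ (ResidueField O) _ _ (Ring.toIntAlgebra _) := by
    convert hess
    exact Subsingleton.elim _ _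
  have hq0 : ∀ x y, q x = 0 → q y = 0 → x * y = 0 := by
    intro x y hx hy
    obtain ⟨x, rfl⟩ := Ideal.Quotient.mk_surjective x
    obtain ⟨y, rfl⟩ := Ideal.Quotient.mk_surjective y
    have hx' : x ∈ m := Ideal.Quotient.eq_zero_iff_mem.1 hx
    have hy' : y ∈ m := Ideal.Quotient.eq_zero_iff_mem.1 hy
    rw [← map_mul, Ideal.Quotient.eq_zero_iff_mem]
    refine Ideal.mem_sup_left ?_
    rw [pow_two]
    exact Ideal.mul_mem_mul hx' hy'
  have hp0 : (p : O ⧸ J) = 0 := by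
    rw [← map_natCast (Ideal.Quotient.mk J), Ideal.Quotient.eq_zero_iff_mem]
    exact Ideal.mem_sup_right (Ideal.mem_span_singleton_self _)
  obtain ⟨τ, hτ⟩ := @exists_section p _ (O ⧸ J) (ResidueField O) _ _ hess' q
    (Ideal.Quotient.factor_surjective hJ) hq0 hp0
  let ρ : MvPolynomial {x // x ∈ s} ℤ →+* ResidueField O := (residue O).comp (algebraMap _ O)
  have hρ : ∀ x, x ∈ I → ρ x = 0 := by
    intro x hx
    have : algebraMap _ O x ∈ m := hIm ▸ Ideal.mem_map_of_mem _ hx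
    exact (residue_eq_zero_iff _).2 this
  let E : MvPolynomial {x // x ∈ s} ℤ →+* O ⧸ J := (Ideal.Quotient.mk J).comp (algebraMap _ O)
  have key : E f = 0 := by
    let E0 := τ.comp ρ
    let alg : Algebra (MvPolynomial {x // x ∈ s} ℤ) (O ⧸ J) := E0.toAlgebra
    have h1 := @taylor _ _ _ alg E (fun a => E (X a) - E0 (X a))
      (fun a => (add_sub_cancel (E0 (X a)) (E (X a))).symm) (by
        have : ∀ a, q (E (X a) - E0 (X a)) = 0 := by
          intro a
          rw [map_sub]
          change _ - q (τ (ρ (X a))) = 0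
          rw [hτ, sub_eq_zero]; rfl
        exact fun a b => hq0 _ _ (this a) (this b)) f
    rw [h1]
    have h2 : E0 f = 0 := by
      change τ (ρ f) = 0
      rw [hρ f hf, map_zero]
    have h3 : ∀ a, E0 (dP _ f a) = 0 := fun a => by
      change τ (ρ _) = 0
      rw [dP_apply, hρ _ (hd' a), map_zero]
    rw [Finsupp.linearCombination_apply, Finsupp.sum, Finset.sum_eq_zero, add_zero]
    · exact h2
    · intro a _
      change E0 (dP _ f a) * _ = 0
      rw [h3, zero_mul]
  have hfJ : algebraMap _ O f ∈ (I ^ 2 ⊔ Ideal.span {((p : ℕ) : MvPolynomial {x // x ∈ s} ℤ)}).map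
      (algebraMap _ O) := by
    rw [Ideal.map_sup, Ideal.map_pow, hIm, Ideal.map_span, Set.image_singleton, map_natCast]
    exact Ideal.Quotient.eq_zero_iff_mem.1 key
  rw [IsLocalization.algebraMap_mem_map_algebraMap_iff I.primeCompl] at hfJ
  obtain ⟨g, hg, hgf⟩ := hfJ
  have h4 : r g * r f ∈ RingHom.ker π ^ 2 ⊔ Ideal.span {(p : MvPolynomial σ ℤ)} := by
    rw [← map_mul]
    have h5 := Ideal.mem_map_of_mem r hgf
    rw [Ideal.map_sup, Ideal.map_pow, Ideal.map_span, Set.image_singleton, map_natCast] at h5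
    have h6 : I.map r ≤ RingHom.ker π := by
      rw [Ideal.map_le_iff_le_comap]
      intro x hx; exact hx
    exact (sup_le_sup_right (Ideal.pow_right_mono h6 2) _) h5
  have hg0 : π (r g) ≠ 0 := hg
  obtain ⟨h, hh⟩ := hπ (π (r g))⁻¹
  have h7 : h * r g - 1 ∈ RingHom.ker π := by
    rw [RingHom.mem_ker, map_sub, map_mul, hh, inv_mul_cancel₀ hg0, map_one, sub_self]
  have h8 : (h * r g - 1) * r f ∈ RingHom.ker π ^ 2 := by
    rw [pow_two]; exact Ideal.mul_mem_mul h7 hf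
  have : rename (↑) f = h * (r g * r f) - (h * r g - 1) * r f := by
    change r f = _
    ring
  rw [this]
  exact sub_mem (Ideal.mul_mem_left _ _ h4) (Ideal.mem_sup_left h8)
end CohenFS

section CohenP
open RingTheory.Sequence MvPolynomial

lemma cohen_t {p : ℕ} [Fact p.Prime] {k σ : Type u} [Field k] [CharP k p]
    (π : MvPolynomial σ ℤ →+* k) (hπ : Function.Surjective π) :
    ∃ (B : Type u) (t : B → MvPolynomial σ ℤ), (∀ b, π (t b) = 0) ∧
      (LinearIndependent k fun b => (dP σ (t b)).mapRange π (map_zero π)) ∧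
      RingHom.ker π ≤ (Ideal.span {(p : MvPolynomial σ ℤ)} ⊔ Ideal.span (Set.range t)) ⊔
        RingHom.ker π ^ 2 := by
  classical
  let d : MvPolynomial σ ℤ → (σ →₀ k) := fun f => (dP σ f).mapRange π (map_zero π)
  have dadd : ∀ f g, d (f + g) = d f + d g := fun f g => by
    simp only [d, map_add]; rw [Finsupp.mapRange_add (by simp)]
  have dsmul : ∀ c f, π f = 0 → d (c * f) = π c • d f := fun c f hf => by
    ext a
    simp [d, Derivation.leibniz, hf]
  obtain ⟨b, hb, hspan, hli⟩ := exists_linearIndependent k {v | ∃ f, π f = 0 ∧ d f = v}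
  choose t ht using fun v : b => hb v.2
  refine ⟨b, t, fun v => (ht v).1, ?_, ?_⟩
  · have h1 : (fun v : b => (dP σ (t v)).mapRange π (map_zero π)) = Subtype.val :=
      funext fun v => (ht v).2
    rw [h1]
    exact hli
  · intro x hx
    have key : ∀ v ∈ Submodule.span k b, ∃ y ∈ Ideal.span (Set.range t), π y = 0 ∧ d y = v := by
      intro v hv
      induction hv using Submodule.span_induction with
      | mem v hv => exact ⟨t ⟨v, hv⟩, Ideal.subset_span ⟨_, rfl⟩, (ht _).1, (ht ⟨v, hv⟩).2⟩
      | zero => exact ⟨0, zero_mem _, map_zero _, by simp [d]⟩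
      | add v w _ _ h1 h2 =>
        obtain ⟨y, hy, h0, rfl⟩ := h1
        obtain ⟨y', hy', h0', rfl⟩ := h2
        exact ⟨y + y', add_mem hy hy', by rw [map_add, h0, h0', add_zero], dadd _ _⟩
      | smul c v _ h1 =>
        obtain ⟨y, hy, h0, rfl⟩ := h1
        obtain ⟨c, rfl⟩ := hπ c
        exact ⟨c * y, Ideal.mul_mem_left _ _ hy, by rw [map_mul, h0, mul_zero], dsmul c y h0⟩
    obtain ⟨y, hy, hy0, hd⟩ := key (d x) (hspan ▸ Submodule.subset_span ⟨x, hx, rfl⟩)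
    have h1 := fs_key (p := p) π hπ (x - y) (by rw [map_sub, hx, hy0, sub_zero]) (fun a => by
      have := DFunLike.congr_fun hd a
      simp only [d, Finsupp.mapRange_apply, dP_apply] at this
      rw [map_sub, map_sub, this, sub_self])
    rw [← sub_add_cancel x y]
    refine add_mem ((sup_le le_sup_right (le_sup_left.trans le_sup_left) :
      RingHom.ker π ^ 2 ⊔ Ideal.span {(p : MvPolynomial σ ℤ)} ≤ _) h1)
      (Ideal.mem_sup_left (Ideal.mem_sup_right hy))

variable {p : ℕ} {k σ B : Type u} [Field k] {π : MvPolynomial σ ℤ →+* k}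
  {t : B → MvPolynomial σ ℤ}

lemma t_lift (hπ : Function.Surjective π)
    (hli : LinearIndependent k fun b => (dP σ (t b)).mapRange π (map_zero π))
    (hgen : RingHom.ker π ≤ (Ideal.span {(p : MvPolynomial σ ℤ)} ⊔ Ideal.span (Set.range t)) ⊔
        RingHom.ker π ^ 2)
    {A A' : Type u} [CommRing A] [CommRing A'] (q : A →+* A') (hq : Function.Surjective q)
    (h2 : ∀ x y, q x = 0 → q y = 0 → x * y = 0) (hp : IsNilpotent (p : A))
    (h : MvPolynomial σ ℤ →+* A') (hh : ∀ x, π x = 0 → ∃ y, h x = p * y) (ht : ∀ b, h (t b) = 0) :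
    ∃ H : MvPolynomial σ ℤ →+* A, q.comp H = h ∧ (∀ b, H (t b) = 0) ∧
      ∀ x, π x = 0 → ∃ y, H x = p * y := by
  let E0 : MvPolynomial σ ℤ →+* A := eval₂Hom (Int.castRingHom A) fun a => (hq (h (X a))).choose
  have hE0 : q.comp E0 = h := by
    refine MvPolynomial.ringHom_ext (fun r => by simp) fun a => ?_
    simp only [E0, RingHom.comp_apply, eval₂Hom_X']
    exact (hq (h (X a))).choose_spec
  let alg : Algebra (MvPolynomial σ ℤ) A := E0.toAlgebra
  have hdec : ∀ (E : MvPolynomial σ ℤ →+* A), q.comp E = h → ∀ x, π x = 0 →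
      ∃ y n, q n = 0 ∧ E x = p * y + n := by
    intro E hE x hx
    obtain ⟨y, hy⟩ := hh x hx
    obtain ⟨y, rfl⟩ := hq y
    refine ⟨y, E x - p * y, ?_, by ring⟩
    rw [map_sub, map_mul, map_natCast, ← hy, ← hE, RingHom.comp_apply, sub_self]
  obtain ⟨z, hz, hzc⟩ := solve π hπ (fun b => dP σ (t b)) hli (RingHom.ker q) (p : A) hp (by
    intro x hx y hy
    obtain ⟨y', n, hn, h3⟩ := hdec E0 hE0 x hx
    refine ⟨y' * y, Ideal.mul_mem_left _ _ hy, ?_⟩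
    change E0 x * y = _
    rw [h3, add_mul, h2 n y hn hy]; ring) (fun b => - E0 (t b)) (fun b => by
      rw [RingHom.mem_ker, map_neg, ← RingHom.comp_apply, hE0, ht, neg_zero])
  let H : MvPolynomial σ ℤ →+* A := eval₂Hom (Int.castRingHom A) fun a => E0 (X a) + z a
  have hHX : ∀ a, H (X a) = E0 (X a) + z a := fun a => by simp [H]
  have hH : q.comp H = h := by
    refine MvPolynomial.ringHom_ext (fun r => by simp) fun a => ?_
    rw [RingHom.comp_apply, hHX, map_add, (RingHom.mem_ker).1 (hz a), add_zero, ← hE0]; rfl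
  have hHt : ∀ b, H (t b) = 0 := by
    intro b
    rw [taylor H z hHX (fun a b => h2 _ _ (hz a) (hz b)) (t b), hzc]
    exact add_neg_cancel (E0 (t b))
  refine ⟨H, hH, hHt, fun x hx => ?_⟩
  have h4 : (Ideal.span {(p : MvPolynomial σ ℤ)} ⊔ Ideal.span (Set.range t)) ⊔
        RingHom.ker π ^ 2 ≤ (Ideal.span {(p : A)}).comap H := by
    refine sup_le (sup_le ?_ ?_) ?_
    · rw [Ideal.span_singleton_le_iff_mem, Ideal.mem_comap, map_natCast]
      exact Ideal.mem_span_singleton_self _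
    · rw [Ideal.span_le]
      rintro _ ⟨b, rfl⟩
      rw [SetLike.mem_coe, Ideal.mem_comap, hHt]; exact zero_mem _
    · rw [pow_two, Ideal.mul_le]
      intro r hr s hs
      obtain ⟨y, n, hn, h5⟩ := hdec H hH r hr
      obtain ⟨y', n', hn', h6⟩ := hdec H hH s hs
      rw [Ideal.mem_comap, Ideal.mem_span_singleton, map_mul, h5, h6]
      exact ⟨p * y * y' + y * n' + n * y', by linear_combination h2 n n' hn hn'⟩
  exact Ideal.mem_span_singleton.1 (h4 (hgen hx))

lemma t_complete (hπ : Function.Surjective π)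
    (hli : LinearIndependent k fun b => (dP σ (t b)).mapRange π (map_zero π))
    (ht0 : ∀ b, π (t b) = 0)
    (hgen : RingHom.ker π ≤ (Ideal.span {(p : MvPolynomial σ ℤ)} ⊔ Ideal.span (Set.range t)) ⊔
        RingHom.ker π ^ 2)
    {W : Type u} [CommRing W] (I : Ideal W) (hI : (p : W) ∈ I) [IsAdicComplete I W]

    (h0 : MvPolynomial σ ℤ →+* W ⧸ I) (hh0 : ∀ x, π x = 0 → h0 x = 0) :
    ∃ g : MvPolynomial σ ℤ →+* W, (Ideal.Quotient.mk I).comp g = h0 ∧ ∀ b, g (t b) = 0 := by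
  let T : ℕ → Type u := fun n => {h : MvPolynomial σ ℤ →+* W ⧸ I ^ (n + 1) //
    (Ideal.Quotient.factor (Ideal.pow_le_self (n.succ_ne_zero))).comp h = h0 ∧
    (∀ b, h (t b) = 0) ∧ ∀ x, π x = 0 → ∃ y, h x = p * y}
  have hstep : ∀ n (g : T n), ∃ g' : T (n + 1),
      (Ideal.Quotient.factor (Ideal.pow_le_pow_right (by omega))).comp g'.1 = g.1 := by
    intro n g
    have hle : I ^ (n + 2) ≤ I ^ (n + 1) := Ideal.pow_le_pow_right (by omega)
    obtain ⟨H, h1, h2, h3⟩ := t_lift hπ hli hgen (Ideal.Quotient.factor hle)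
      (Ideal.Quotient.factor_surjective hle) (by
        intro x y hx hy
        obtain ⟨x, rfl⟩ := Ideal.Quotient.mk_surjective x
        obtain ⟨y, rfl⟩ := Ideal.Quotient.mk_surjective y
        rw [Ideal.Quotient.factor_mk, Ideal.Quotient.eq_zero_iff_mem] at hx hy
        rw [← map_mul, Ideal.Quotient.eq_zero_iff_mem]
        have := Ideal.mul_mem_mul hx hy
        rw [← pow_add] at this
        exact Ideal.pow_le_pow_right (by omega) this) (by
        refine ⟨n + 2, ?_⟩
        rw [← map_natCast (Ideal.Quotient.mk (I ^ (n+2))), ← map_pow, Ideal.Quotient.eq_zero_iff_mem]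
        exact Ideal.pow_mem_pow hI _) g.1 g.2.2.2 g.2.2.1
    refine ⟨⟨H, ?_, h2, h3⟩, h1⟩
    rw [← g.2.1, ← h1, ← RingHom.comp_assoc, Ideal.Quotient.factor_comp]
  have hT0 : Nonempty (T 0) := by
    have e : I ≤ I ^ (0 + 1) := by simp
    refine ⟨⟨(Ideal.Quotient.factor e).comp h0, ?_, fun b => ?_, fun x hx => ⟨0, ?_⟩⟩⟩
    · rw [← RingHom.comp_assoc, Ideal.Quotient.factor_comp]
      ext x
      · simp
      · obtain ⟨y, hy⟩ := Ideal.Quotient.mk_surjective (h0 (X x))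
        simp only [RingHom.comp_apply, ← hy, Ideal.Quotient.factor_mk]
    · rw [RingHom.comp_apply, hh0 _ (ht0 b), map_zero]
    · rw [RingHom.comp_apply, hh0 _ hx, map_zero, mul_zero]
  choose s hs using hstep
  let G : ∀ n, T n := fun n => Nat.rec hT0.some s n
  have ha : StrictMono (fun n : ℕ => n + 1) := fun a b h => by simpa using h
  have hG : ∀ {n}, (Ideal.Quotient.factorPow I (ha.monotone n.le_succ)).comp (G (n + 1)).1 = (G n).1 :=
    fun {n} => hs n (G n)
  have h1 : ∀ n x, Ideal.Quotient.mk (I ^ (n + 1))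
      (IsAdicComplete.StrictMono.liftRingHom I ha (fun n => (G n).1) hG x) = (G n).1 x :=
    fun n x => IsAdicComplete.StrictMono.mk_liftRingHom I ha (fun n => (G n).1) hG x
  refine ⟨IsAdicComplete.StrictMono.liftRingHom I ha (fun n => (G n).1) hG, ?_, fun b => ?_⟩
  · refine (RingHom.ext fun x => ?_ : _ = (Ideal.Quotient.factor (Ideal.pow_le_self
      (Nat.succ_ne_zero 0))).comp (G 0).1).trans (G 0).2.1
    rw [RingHom.comp_apply, RingHom.comp_apply, ← h1 0 x, Ideal.Quotient.factor_mk]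
  · refine IsHausdorff.haus (I := I) inferInstance _ fun n => ?_
    have h2 := h1 n (t b)
    rw [(G n).2.2.1, Ideal.Quotient.eq_zero_iff_mem] at h2
    rw [SModEq.zero, smul_eq_mul, Ideal.mul_top]
    exact Ideal.pow_le_pow_right (by omega) h2
end CohenP

section CohenP2
open RingTheory.Sequence MvPolynomial

lemma factor_dense {P C A : Type u} [CommRing P] [CommRing C] [CommRing A] (g : P →+* C) (E : P →+* A)
    (I : Ideal C) (h1 : ∀ c, ∃ x, c - g x ∈ I) (h2 : ∀ x, g x ∈ I → E x = 0) :
    ∃ F : C →+* A, ∀ c x, c - g x ∈ I → F c = E x := by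
  choose s hs using h1
  have key : ∀ c x, c - g x ∈ I → E (s c) = E x := by
    intro c x hx
    rw [← sub_eq_zero, ← map_sub]
    apply h2
    rw [map_sub, show g (s c) - g x = (c - g x) - (c - g (s c)) by ring]
    exact sub_mem hx (hs c)
  refine ⟨⟨⟨⟨fun c => E (s c), ?_⟩, fun a b => ?_⟩, ?_, fun a b => ?_⟩, key⟩
  · rw [key 1 1 (by simp), map_one]
  · change E (s (a * b)) = E (s a) * E (s b)
    rw [← map_mul]
    apply key
    rw [map_mul, show a * b - g (s a) * g (s b) = a * (b - g (s b)) + g (s b) * (a - g (s a)) by ring]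
    exact add_mem (I.mul_mem_left _ (hs b)) (I.mul_mem_left _ (hs a))
  · change E (s 0) = 0
    rw [key 0 0 (by simp), map_zero]
  · change E (s (a + b)) = E (s a) + E (s b)
    rw [← map_add]
    apply key
    rw [map_add, show a + b - (g (s a) + g (s b)) = (a - g (s a)) + (b - g (s b)) by ring]
    exact add_mem (hs a) (hs b)

variable {p : ℕ} {k σ B : Type u} [Field k] {π : MvPolynomial σ ℤ →+* k}
  {t : B → MvPolynomial σ ℤ}

lemma t_gen (hgen : RingHom.ker π ≤ (Ideal.span {(p : MvPolynomial σ ℤ)} ⊔ Ideal.span (Set.range t)) ⊔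
        RingHom.ker π ^ 2) (j : ℕ) : RingHom.ker π ≤ (Ideal.span {(p : MvPolynomial σ ℤ)} ⊔
        Ideal.span (Set.range t)) ⊔ RingHom.ker π ^ (j + 1) := by
  induction j with
  | zero => simp
  | succ j ih =>
    refine hgen.trans (sup_le le_sup_left ?_)
    rw [pow_two]
    refine (Ideal.mul_mono le_rfl ih).trans ?_
    rw [Ideal.mul_sup, ← pow_succ']
    exact sup_le_sup_right Ideal.mul_le_right _

/-- the closure of the image of `g` -/
def clos {P W : Type u} [CommRing P] [CommRing W] (g : P →+* W) (p : ℕ) : Subring W where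
  carrier := {w | ∀ n : ℕ, ∃ x, (p : W) ^ n ∣ w - g x}
  mul_mem' := by
    intro a b ha hb n
    obtain ⟨x, hx⟩ := ha n
    obtain ⟨y, hy⟩ := hb n
    refine ⟨x * y, ?_⟩
    rw [map_mul, show a * b - g x * g y = (a - g x) * b + (b - g y) * g x by ring]
    exact dvd_add (hx.mul_right _) (hy.mul_right _)
  one_mem' := fun n => ⟨1, by simp⟩
  add_mem' := by
    intro a b ha hb n
    obtain ⟨x, hx⟩ := ha n
    obtain ⟨y, hy⟩ := hb n
    refine ⟨x + y, ?_⟩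
    rw [map_add, show a + b - (g x + g y) = (a - g x) + (b - g y) by ring]
    exact dvd_add hx hy
  zero_mem' := fun n => ⟨0, by simp⟩
  neg_mem' := by
    intro a ha n
    obtain ⟨x, hx⟩ := ha n
    refine ⟨-x, ?_⟩
    rw [map_neg, show -a - -g x = -(a - g x) by ring]
    exact (dvd_neg).2 hx

theorem cohen_sub (hp0 : p ≠ 0) (hπ : Function.Surjective π)
    (hli : LinearIndependent k fun b => (dP σ (t b)).mapRange π (map_zero π))
    (hgen : RingHom.ker π ≤ (Ideal.span {(p : MvPolynomial σ ℤ)} ⊔ Ideal.span (Set.range t)) ⊔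
        RingHom.ker π ^ 2)
    {W : Type u} [CommRing W] [IsDomain W] [IsLocalRing W] (hirr : Irreducible (p : W))

    (hw : ∀ w : W, w ≠ 0 → ∃ n u, IsUnit u ∧ w = (p : W) ^ n * u)
    (g : MvPolynomial σ ℤ →+* W) (hg : ∀ x, (p : W) ∣ g x ↔ π x = 0) (hgt : ∀ b, g (t b) = 0) :
    ∃ (C : Type u) (_ : CommRing C) (_ : IsLocalRing C) (_ : IsNoetherianRing C), CohenData k p C := by
  have hpW : (p : W) ≠ 0 := hirr.ne_zero
  let C := clos g p
  have hgm : ∀ x, g x ∈ C := fun x n => ⟨x, by simp⟩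
  have hg𝔪 : ∀ n x, x ∈ RingHom.ker π ^ n → (p : W) ^ n ∣ g x := by
    intro n x hx
    rw [← Ideal.mem_span_singleton, ← Ideal.span_singleton_pow, ← Ideal.mem_comap]
    refine Ideal.le_comap_pow g n (Ideal.pow_right_mono (fun y hy => ?_) n hx)
    rw [Ideal.mem_comap, Ideal.mem_span_singleton, hg]
    exact hy
  have hgT : ∀ x ∈ Ideal.span (Set.range t), g x = 0 := by
    have : Ideal.span (Set.range t) ≤ RingHom.ker g := by
      rw [Ideal.span_le]; rintro _ ⟨b, rfl⟩; exact hgt b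
    exact fun x hx => this hx
  -- decomposition of elements of the kernel
  have hdec : ∀ j x, π x = 0 → ∃ y τ z, τ ∈ Ideal.span (Set.range t) ∧
      z ∈ RingHom.ker π ^ (j + 1) ∧ x = p * y + τ + z := by
    intro j x hx
    obtain ⟨a, ha, z, hz, rfl⟩ := Submodule.mem_sup.1 (t_gen hgen j hx)
    obtain ⟨y, hy, τ, hτ, rfl⟩ := Submodule.mem_sup.1 ha
    obtain ⟨y, rfl⟩ := Ideal.mem_span_singleton.1 hy
    exact ⟨y, τ, z, hτ, hz, rfl⟩
  have hdiv : ∀ w, (p : W) * w ∈ C → w ∈ C := by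
    intro w hw n
    obtain ⟨x, hx⟩ := hw (n + 1)
    have hpx : (p : W) ∣ g x := by
      have : (p : W) ∣ p * w - g x := (dvd_pow_self _ (Nat.succ_ne_zero n)).trans hx
      exact (dvd_sub_right (dvd_mul_right _ _)).1 this
    obtain ⟨y, τ, z, hτ, hz, rfl⟩ := hdec n x ((hg x).1 hpx)
    refine ⟨y, ?_⟩
    rw [map_add, map_add, map_mul, map_natCast, hgT τ hτ, add_zero] at hx
    have := dvd_add hx (hg𝔪 _ z hz)
    rw [show (p : W) * w - (p * g y + g z) + g z = p * (w - g y) by ring, pow_succ'] at this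
    exact (mul_dvd_mul_iff_left hpW).1 this
  have hdivn : ∀ n w, (p : W) ^ n * w ∈ C → w ∈ C := by
    intro n
    induction n with
    | zero => intro w hw; simpa using hw
    | succ n ih => intro w hw; rw [pow_succ, mul_assoc] at hw; exact hdiv _ (ih _ hw)
  have hinv : ∀ w v, w ∈ C → w * v = 1 → v ∈ C := by
    intro w v hwC hwv n
    obtain ⟨x, hx⟩ := hwC (n + 1)
    have hpx : π x ≠ 0 := by
      intro h0
      have h1 : (p : W) ∣ w - g x := (dvd_pow_self _ (Nat.succ_ne_zero n)).trans hx
      have h2 : (p : W) ∣ w := by simpa using dvd_add h1 ((hg x).2 h0)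
      exact hirr.not_isUnit (isUnit_of_dvd_unit h2 (IsUnit.of_mul_eq_one v hwv))
    obtain ⟨y, hy⟩ := hπ (π x)⁻¹
    have h1 : 1 - x * y ∈ RingHom.ker π := by
      rw [RingHom.mem_ker, map_sub, map_mul, hy, map_one, mul_inv_cancel₀ hpx, sub_self]
    have h2 : x ∣ 1 - (1 - x * y) ^ n := by
      have := sub_dvd_pow_sub_pow 1 (1 - x * y) n
      rw [one_pow, sub_sub_cancel] at this
      exact (dvd_mul_right _ _).trans this
    obtain ⟨h, hh⟩ := h2
    refine ⟨h, ?_⟩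
    have h3 := hg𝔪 n _ (Ideal.pow_mem_pow h1 n)
    have h4 : (1 - x * y) ^ n = 1 - x * h := by rw [← hh]; ring
    rw [h4, map_sub, map_one, map_mul] at h3
    have h5 : v - g h = v * (1 - g x * g h) - v * g h * (w - g x) + (w * v - 1) * g h := by ring
    rw [h5, hwv, sub_self, zero_mul, add_zero]
    exact dvd_sub (h3.mul_left _) (((pow_dvd_pow _ n.le_succ).trans hx).mul_left _)
  have hloc : IsLocalHom C.subtype := by
    refine ⟨fun a ha => ?_⟩
    obtain ⟨v, hv⟩ := ha.exists_right_inv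
    exact IsUnit.of_mul_eq_one ⟨v, hinv a v a.2 hv⟩ (Subtype.ext hv)
  have : IsLocalRing C := RingHom.domain_isLocalRing C.subtype
  have hunit : ∀ a : C, IsUnit (a : W) → IsUnit a := fun a ha => hloc.map_nonunit a ha
  have hirrC : Irreducible (p : C) := by
    refine ⟨fun h => hirr.not_isUnit (by simpa using h.map C.subtype), fun {a b} hab => ?_⟩
    have : (p : W) = a * b := by simpa using congrArg C.subtype hab
    exact (hirr.isUnit_or_isUnit this).imp (hunit a) (hunit b)
  have hdvr : IsDiscreteValuationRing C := by
    refine IsDiscreteValuationRing.ofHasUnitMulPowIrreducibleFactorization ⟨(p : C), hirrC, ?_⟩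
    intro a ha
    obtain ⟨n, u, hun, h⟩ := hw a (fun h => ha (Subtype.ext h))
    have huC : u ∈ C := hdivn n u (by rw [← h]; exact a.2)
    refine ⟨n, (hunit ⟨u, huC⟩ hun).unit, Subtype.ext ?_⟩
    rw [h]; simp
  have hnoeth : IsNoetherianRing C := inferInstance
  have hmem : ∀ n (a : C), (p : W) ^ n ∣ a → a ∈ Ideal.span {(p : C) ^ n} := by
    intro n a ⟨w, hw⟩
    rw [Ideal.mem_span_singleton]
    exact ⟨⟨w, hdivn n w (by rw [← hw]; exact a.2)⟩, Subtype.ext (by simpa using hw)⟩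
  have hmem' : ∀ n (a : C), a ∈ Ideal.span {(p : C) ^ n} → (p : W) ^ n ∣ a := by
    intro n a ha
    obtain ⟨b, rfl⟩ := Ideal.mem_span_singleton.1 ha
    exact ⟨b, by simp⟩
  let g' : MvPolynomial σ ℤ →+* C := g.codRestrict C hgm
  have hdense : ∀ n (c : C), ∃ x, c - g' x ∈ Ideal.span {(p : C) ^ n} := by
    intro n c
    obtain ⟨x, hx⟩ := c.2 n
    exact ⟨x, hmem n _ hx⟩
  refine ⟨C, inferInstance, inferInstance, hnoeth, ⟨?_, ?_, ?_, ?_⟩⟩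
  · rw [pl, if_neg hp0, isWeaklyRegular_singleton_iff]
    exact (IsSMulRegular.of_ne_zero hirrC.ne_zero)
  · rw [pl, if_neg hp0, Ideal.ofList_singleton]
    exact (hirrC.maximalIdeal_eq).symm
  · intro A A' _ _ q hq h2 hnil f
    obtain ⟨H, hH, hHt, hHm⟩ := t_lift hπ hli hgen q hq h2 hnil (f.comp g') (by
      intro x hx
      have h1 : (p : W) ^ 1 ∣ g' x := by rw [pow_one]; exact (hg x).2 hx
      have h2 := hmem 1 _ h1
      rw [pow_one] at h2
      obtain ⟨y, hy⟩ := Ideal.mem_span_singleton.1 h2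
      exact ⟨f y, by rw [RingHom.comp_apply, hy, map_mul, map_natCast]⟩) (fun b => by
      rw [RingHom.comp_apply, show g' (t b) = 0 from Subtype.ext (hgt b), map_zero])
    obtain ⟨N, hN⟩ := hnil
    have hHT : ∀ x ∈ Ideal.span (Set.range t), H x = 0 := by
      have : Ideal.span (Set.range t) ≤ RingHom.ker H := by
        rw [Ideal.span_le]; rintro _ ⟨b, rfl⟩; exact hHt b
      exact fun x hx => this hx
    have hHN : ∀ x, x ∈ RingHom.ker π ^ (N + 1) → H x = 0 := by
      intro x hx
      have : x ∈ (Ideal.span {(p : A) ^ (N + 1)}).comap H := by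
        rw [← Ideal.span_singleton_pow]
        refine Ideal.le_comap_pow H (N + 1) (Ideal.pow_right_mono (fun y hy => ?_) (N + 1) hx)
        exact Ideal.mem_span_singleton.2 (hHm y hy)
      rw [Ideal.mem_comap, pow_succ, hN, zero_mul, Ideal.span_singleton_zero] at this
      exact this
    have hker : ∀ M, M ≤ N → ∀ x, (p : W) ^ M ∣ g x → ∃ y τ z, τ ∈ Ideal.span (Set.range t) ∧
        z ∈ RingHom.ker π ^ (N + 1) ∧ x = (p : MvPolynomial σ ℤ) ^ M * y + τ + z := by
      intro M
      induction M with
      | zero => intro _ x _; exact ⟨x, 0, 0, zero_mem _, zero_mem _, by simp⟩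
      | succ M ih =>
        intro hM x hx
        obtain ⟨y, τ, z, hτ, hz, rfl⟩ := ih (by omega) x ((pow_dvd_pow _ M.le_succ).trans hx)
        rw [map_add, map_add, hgT τ hτ, add_zero, map_mul, map_pow, map_natCast] at hx
        have h3 := (pow_dvd_pow (p : W) (by omega : M + 1 ≤ N + 1)).trans (hg𝔪 _ z hz)
        rw [dvd_add_left h3, pow_succ, mul_dvd_mul_iff_left (pow_ne_zero _ hpW), hg] at hx
        obtain ⟨y', τ', z', hτ', hz', rfl⟩ := hdec N y hx
        refine ⟨y', p ^ M * τ' + τ, p ^ M * z' + z, add_mem (Ideal.mul_mem_left _ _ hτ') hτ,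
          add_mem (Ideal.mul_mem_left _ _ hz') hz, by ring⟩
    obtain ⟨F, hF⟩ := factor_dense g' H (Ideal.span {(p : C) ^ N}) (hdense N) (by
      intro x hx
      obtain ⟨y, τ, z, hτ, hz, rfl⟩ := hker N le_rfl x (hmem' N _ hx)
      rw [map_add, map_add, hHT τ hτ, hHN z hz, map_mul, map_pow, map_natCast, hN]
      simp)
    refine ⟨F, RingHom.ext fun c => ?_⟩
    obtain ⟨x, hx⟩ := hdense N c
    rw [RingHom.comp_apply, hF c x hx, ← RingHom.comp_apply, hH, RingHom.comp_apply, ← sub_eq_zero,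
      ← map_sub, ← neg_sub, map_neg, neg_eq_zero]
    obtain ⟨d, hd⟩ := Ideal.mem_span_singleton.1 hx
    rw [hd, map_mul, map_pow, map_natCast, ← map_natCast q, ← map_pow, hN, map_zero, zero_mul]
  · obtain ⟨F, hF⟩ := factor_dense g' π (Ideal.span {(p : C) ^ 1}) (hdense 1) (by
      intro x hx
      have := hmem' 1 _ hx
      rw [pow_one] at this
      exact (hg x).1 this)
    refine ⟨F, fun y => ?_⟩
    obtain ⟨x, rfl⟩ := hπ y
    exact ⟨g' x, hF _ _ (by simp)⟩

theorem cohen_prime (k : Type u) [Field k] (p : ℕ) [hp : Fact p.Prime] [CharP k p] :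
    ∃ (C : Type u) (_ : CommRing C) (_ : IsLocalRing C) (_ : IsNoetherianRing C), CohenData k p C := by
  let π : MvPolynomial k ℤ →+* k := eval₂Hom (Int.castRingHom k) id
  have hπ : Function.Surjective π := fun a => ⟨X a, by simp [π]⟩
  obtain ⟨B, t, ht0, hli, hgen⟩ := cohen_t (p := p) π hπ
  let K := AlgebraicClosure k
  have : CharP K p := charP_of_injective_algebraMap (algebraMap k K).injective p
  let W := WittVector p K
  let I : Ideal W := Ideal.span {(p : W)}
  let ε : W →+* K := WittVector.constantCoeff
  have hεs : Function.Surjective ε := WittVector.constantCoeff_surjective p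
  have hε : RingHom.ker ε = I := WittVector.ker_constantCoeff
  let e : W ⧸ I ≃+* K :=
    (Ideal.quotEquivOfEq hε.symm).trans (RingHom.quotientKerEquivOfSurjective hεs)
  obtain ⟨g, hg, hgt⟩ := t_complete (p := p) hπ hli ht0 hgen I (Ideal.mem_span_singleton_self _)
    (e.symm.toRingHom.comp ((algebraMap k K).comp π)) (fun x hx => by simp [hx])
  have hg' : ∀ x, (p : W) ∣ g x ↔ π x = 0 := by
    intro x
    rw [← Ideal.mem_span_singleton, ← Ideal.Quotient.eq_zero_iff_mem]
    change ((Ideal.Quotient.mk I).comp g) x = 0 ↔ _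
    rw [hg]
    simp
  refine cohen_sub hp.out.ne_zero hπ hli hgen (WittVector.irreducible p) ?_ g hg' hgt
  intro w hw
  obtain ⟨m, b, hb⟩ := WittVector.exists_eq_pow_p_mul' w hw
  exact ⟨m, b, b.isUnit, hb⟩

theorem cohen_exists (k : Type u) [Field k] (p : ℕ) [hp : CharP k p] :
    ∃ (C : Type u) (_ : CommRing C) (_ : IsLocalRing C) (_ : IsNoetherianRing C), CohenData k p C := by
  rcases CharP.char_is_prime_or_zero k p with h | rfl
  · have : Fact p.Prime := ⟨h⟩
    exact cohen_prime k p
  · exact cohen_zero k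
end CohenP2

section BC
open RingTheory.Sequence

lemma bc_pushout {A B A1 B1 M N : Type u} [CommRing A] [CommRing B] [CommRing A1] [CommRing B1]
    [Algebra A A1] [Algebra A B] [Algebra A B1] [Algebra A1 B1] [Algebra B B1]
    [IsScalarTower A A1 B1] [IsScalarTower A B B1] [AddCommGroup M] [AddCommGroup N]
    [Module A M] [Module A1 M] [IsScalarTower A A1 M]
    [Module A N] [Module A1 N] [Module B N] [Module B1 N]
    [IsScalarTower A A1 N] [IsScalarTower A B N] [IsScalarTower A1 B1 N] [IsScalarTower B B1 N]
    (hp : Algebra.IsPushout A B A1 B1)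
    (f : M →ₗ[A1] N) : IsBaseChange B1 f ↔ IsBaseChange B (f.restrictScalars A) := by
  have key : ∀ (x : B1 ⊗[A1] M), ((f.restrictScalars A).liftBaseChange B)
      (Algebra.IsPushout.cancelBaseChange A B A1 B1 M x) = (f.liftBaseChange B1) x := by
    intro x
    obtain ⟨y, rfl⟩ := (Algebra.IsPushout.cancelBaseChange A B A1 B1 M).symm.surjective x
    rw [LinearEquiv.apply_symm_apply]
    induction y with
    | zero => simp
    | add a b ha hb => simp [ha, hb]
    | tmul b m => simp
  have e1 : IsBaseChange B1 f ↔ Function.Bijective (f.liftBaseChange B1) := by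
    rw [IsBaseChange, IsTensorProduct]
    refine iff_of_eq (congrArg Function.Bijective ?_)
    funext x
    induction x with
    | zero => simp
    | add a b ha hb => simp [ha, hb]
    | tmul b m => simp
  have e2 : IsBaseChange B (f.restrictScalars A) ↔
      Function.Bijective ((f.restrictScalars A).liftBaseChange B) := by
    rw [IsBaseChange, IsTensorProduct]
    refine iff_of_eq (congrArg Function.Bijective ?_)
    funext x
    induction x with
    | zero => simp
    | add a b ha hb => simp [ha, hb]
    | tmul b m => simp
  rw [e1, e2, ← Function.Bijective.of_comp_iff _
    (Algebra.IsPushout.cancelBaseChange A B A1 B1 M).bijective]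
  exact iff_of_eq (congrArg Function.Bijective (funext fun x => (key x).symm))

/-- working notion of finite cidim -/
def HF (R M : Type u) [CommRing R] [IsLocalRing R] [AddCommGroup M] [Module R M] : Prop :=
  ∃ (R' Q V : Type u) (_ : CommRing R') (_ : CommRing Q) (_ : CommRing V)
    (_ : IsLocalRing R') (_ : IsLocalRing Q) (_ : IsLocalRing V)
    (_ : IsNoetherianRing R') (_ : IsNoetherianRing Q) (_ : IsNoetherianRing V)
    (_ : Algebra R R') (_ : Algebra R V) (_ : Algebra Q R') (_ : Algebra V R')
    (_ : IsScalarTower R V R')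
    (N : Type u) (_ : AddCommGroup N) (_ : Module R' N) (_ : Module Q N) (_ : Module R N)
    (_ : IsScalarTower Q R' N) (_ : IsScalarTower R R' N) (j : M →ₗ[R] N),
    IsLocalHom (algebraMap R R') ∧ Module.Flat R R' ∧
    Function.Surjective (algebraMap Q R') ∧
    GeneratedByRegularSequence Q (RingHom.ker (algebraMap Q R')) ∧
    WR R V ∧ Function.Surjective (algebraMap V R') ∧
    GeneratedByRegularSequence V (RingHom.ker (algebraMap V R')) ∧
    IsBaseChange R' j ∧ FlatDimFinite Q N

end BC

section StepJ
open RingTheory.Sequence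

lemma smulComm_alg (A B C : Type u) [CommRing A] [CommRing B] [CommRing C] [Algebra A C]
    [Algebra B C] : SMulCommClass A B C :=
  ⟨fun a b x => by simp only [Algebra.smul_def]; ring⟩

lemma bc_transfer {A B A1 B1 Q M N : Type u} [CommRing A] [CommRing B] [CommRing A1] [CommRing B1]
    [CommRing Q]
    [Algebra A A1] [Algebra A B] [Algebra A B1] [Algebra A1 B1] [Algebra B B1]
    [IsScalarTower A A1 B1] [IsScalarTower A B B1] [AddCommGroup M] [AddCommGroup N]
    [Algebra Q B] [Algebra Q B1] [IsScalarTower Q B B1]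
    [Module A M] [Module A1 M] [IsScalarTower A A1 M]
    [Module A N] [Module B N] [IsScalarTower A B N] [Module Q N] [IsScalarTower Q B N]
    [SMulCommClass A1 Q B1]
    (hp : Algebra.IsPushout A B A1 B1)
    (j : M →ₗ[A] N) (hj : IsBaseChange B j) (h : FlatDimFinite Q N) :
    FlatDimFinite Q (B1 ⊗[A1] M) := by
  have := smulComm_alg A1 B B1
  have := smulComm_alg A1 A B1
  have h1 : IsBaseChange B1 (TensorProduct.mk A1 B1 M 1) := TensorProduct.isBaseChange A1 M B1
  have h2 := (bc_pushout hp _).1 h1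
  have e : N ≃ₗ[B] B1 ⊗[A1] M := hj.equiv.symm ≪≫ₗ h2.equiv
  obtain ⟨n, hn⟩ := h
  exact ⟨n, hn.of_equiv (e.restrictScalars Q)⟩

lemma grs_map_flat {A B : Type u} [CommRing A] [CommRing B] [IsLocalRing B] [Algebra A B]
    [Module.Flat A B] {rs : List A} (h : IsWeaklyRegular A rs)
    (hm : (Ideal.ofList rs).map (algebraMap A B) ≤ maximalIdeal B) :
    IsWeaklyRegular B (rs.map (algebraMap A B)) ∧
    GeneratedByRegularSequence B ((Ideal.ofList rs).map (algebraMap A B)) := by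
  have h1 : IsWeaklyRegular B (rs.map (algebraMap A B)) := h.of_flat
  refine ⟨h1, grs_iff.2 ⟨fun h => ?_, _, h1, (Ideal.map_ofList _ _).symm⟩⟩
  rw [h, top_le_iff] at hm
  exact (Ideal.IsPrime.ne_top inferInstance) hm

lemma exists_alg_of_surj {A S B : Type u} [CommRing A] [CommRing S] [CommRing B] [Algebra A S]
    [Algebra A B] (hs : Function.Surjective (algebraMap A S))
    (hk : RingHom.ker (algebraMap A S) ≤ RingHom.ker (algebraMap A B)) :
    ∃ _ : Algebra S B, IsScalarTower A S B := by
  let f : S →+* B := (algebraMap A S).liftOfSurjective hs ⟨algebraMap A B, hk⟩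
  let _ := f.toAlgebra
  exact ⟨f.toAlgebra, IsScalarTower.of_algebraMap_eq fun x =>
    ((algebraMap A S).liftOfRightInverse_comp_apply _ _ ⟨algebraMap A B, hk⟩ x).symm⟩

lemma tower_of_surj {A S B C : Type u} [CommRing A] [CommRing S] [CommRing B] [CommRing C]
    [Algebra A S] [Algebra A B] [Algebra A C] [Algebra S B] [Algebra S C] [Algebra B C]
    [IsScalarTower A S B] [IsScalarTower A S C] [IsScalarTower A B C]
    (hs : Function.Surjective (algebraMap A S)) : IsScalarTower S B C := by
  refine IsScalarTower.of_algebraMap_eq fun x => ?_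
  obtain ⟨a, rfl⟩ := hs x
  rw [← IsScalarTower.algebraMap_apply A S C, ← IsScalarTower.algebraMap_apply A S B,
    ← IsScalarTower.algebraMap_apply A B C]

theorem stepJ {P S M : Type u} [CommRing P] [CommRing S] [IsLocalRing P] [IsLocalRing S]
    [Algebra P S] [AddCommGroup M] [Module P M] [Module S M] [IsScalarTower P S M]
    (hs : Function.Surjective (algebraMap P S))
    (hg : GeneratedByRegularSequence P (RingHom.ker (algebraMap P S)))
    (h : HF P M) : HF S M := by
  obtain ⟨P', Q, V, _, _, _, _, _, _, _, _, _, _, _, _, _, _, N, _, _, _, _, _, _, j,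
    hloc, hfl, hQs, hQg, hWR, hVs, hVg, hbc, hfd⟩ := h
  obtain ⟨-, rs, hrs, hrJ⟩ := grs_iff.1 hg
  have hJm : RingHom.ker (algebraMap P S) ≤ maximalIdeal P :=
    le_maximalIdeal (RingHom.ker_ne_top _)
  have hlocV := hWR.1
  have hflV := hWR.2.1
  set J := RingHom.ker (algebraMap P S) with hJ
  have hJP : J.map (algebraMap P P') ≤ maximalIdeal P' :=
    (Ideal.map_mono hJm).trans map_maximalIdeal_le
  have hJV : J.map (algebraMap P V) ≤ maximalIdeal V :=
    (Ideal.map_mono hJm).trans map_maximalIdeal_le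
  have hP'g := grs_map_flat hrs (B := P') (by rw [hrJ]; exact hJP)
  have hVrs := grs_map_flat hrs (B := V) (by rw [hrJ]; exact hJV)
  rw [hrJ] at hP'g hVrs
  let S' := P' ⧸ J.map (algebraMap P P')
  let V1 := V ⧸ J.map (algebraMap P V)
  have : IsLocalRing S' := isLocalRing_quot hJP
  have : IsLocalRing V1 := isLocalRing_quot hJV
  have hSS' : Function.Surjective (algebraMap P' S') := Ideal.Quotient.mk_surjective
  have hVV1 : Function.Surjective (algebraMap V V1) := Ideal.Quotient.mk_surjective
  have hkS : RingHom.ker (algebraMap P' S') = J.map (algebraMap P P') := Ideal.mk_ker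
  have hkV : RingHom.ker (algebraMap V V1) = J.map (algebraMap P V) := Ideal.mk_ker
  have : IsScalarTower P P' S' := IsScalarTower.of_algebraMap_eq fun _ => rfl
  have : IsScalarTower Q P' S' := IsScalarTower.of_algebraMap_eq fun _ => rfl
  have : IsScalarTower V P' S' := IsScalarTower.of_algebraMap_eq fun _ => rfl
  have : IsScalarTower P V V1 := IsScalarTower.of_algebraMap_eq fun _ => rfl
  have hPV : algebraMap P P' = (algebraMap V P').comp (algebraMap P V) :=
    IsScalarTower.algebraMap_eq P V P'
  have hJVP : (J.map (algebraMap P V)).map (algebraMap V P') = J.map (algebraMap P P') := by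
    rw [Ideal.map_map, hPV]
  obtain ⟨_, _⟩ := exists_alg_of_surj (B := S') hs (by
    rw [IsScalarTower.algebraMap_eq P P' S', ← RingHom.comap_ker, hkS]
    exact Ideal.le_comap_map)
  obtain ⟨_, _⟩ := exists_alg_of_surj (B := V1) hs (by
    rw [IsScalarTower.algebraMap_eq P V V1, ← RingHom.comap_ker, hkV]
    exact Ideal.le_comap_map)
  obtain ⟨_, _⟩ := exists_alg_of_surj (S := V1) (B := S') hVV1 (by
    rw [hkV, IsScalarTower.algebraMap_eq V P' S', ← RingHom.comap_ker, hkS,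
      ← Ideal.map_le_iff_le_comap, hJVP])
  have : IsScalarTower P V S' := IsScalarTower.of_algebraMap_eq fun x => by
    rw [IsScalarTower.algebraMap_apply P P' S', IsScalarTower.algebraMap_apply P V P',
      ← IsScalarTower.algebraMap_apply V P' S']
  have : IsScalarTower P V1 S' := IsScalarTower.of_algebraMap_eq fun x => by
    rw [IsScalarTower.algebraMap_apply P V V1, ← IsScalarTower.algebraMap_apply V V1 S',
      ← IsScalarTower.algebraMap_apply P V S']
  have : IsScalarTower S V1 S' := tower_of_surj hs
  have hQS : algebraMap Q S' = (algebraMap P' S').comp (algebraMap Q P') :=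
    IsScalarTower.algebraMap_eq Q P' S'
  have hVS : algebraMap V S' = (algebraMap P' S').comp (algebraMap V P') :=
    IsScalarTower.algebraMap_eq V P' S'
  have hVS1 : algebraMap V S' = (algebraMap V1 S').comp (algebraMap V V1) :=
    IsScalarTower.algebraMap_eq V V1 S'
  have := smulComm_alg S Q S'
  have := smulComm_alg S S' S'
  have hpo : Algebra.IsPushout P S P' S' := pushout_surj hs hSS' hkS
  refine ⟨S', Q, V1, inferInstance, inferInstance, inferInstance, inferInstance, inferInstance,
    inferInstance, inferInstance, inferInstance, inferInstance, inferInstance, inferInstance,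
    inferInstance, inferInstance, inferInstance, S' ⊗[S] M, inferInstance, inferInstance,
    inferInstance, inferInstance, inferInstance, inferInstance, TensorProduct.mk S S' M 1,
    ?_, ?_, ?_, ?_, ?_, ?_, ?_, TensorProduct.isBaseChange S M S',
    bc_transfer (B := P') hpo.symm j hbc hfd⟩
  · refine ((IsLocalRing.local_hom_TFAE (algebraMap S S')).out 0 2).2 ?_
    rw [← map_maximalIdeal_of_surj _ hs, ← map_maximalIdeal_of_surj _ hSS', Ideal.map_map,
      ← IsScalarTower.algebraMap_eq, IsScalarTower.algebraMap_eq P P' S', ← Ideal.map_map]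
    exact Ideal.map_mono map_maximalIdeal_le
  · exact flat_surj hs hSS' hkS
  · rw [hQS]; exact hSS'.comp hQs
  · rw [hQS, ← RingHom.comap_ker, hkS]
    exact grs_comap _ hQs hQg _ hP'g.2
  · exact WR.quot hs hVV1 hkV hWR
  · have : Function.Surjective (algebraMap V S') := by rw [hVS]; exact hSS'.comp hVs
    rw [hVS1] at this
    exact Function.Surjective.of_comp this
  · obtain ⟨-, ys, hys, hyk⟩ := grs_iff.1 hVg
    have h1 : IsWeaklyRegular V (ys ++ rs.map (algebraMap P V)) := by
      rw [wreg_append_iff (algebraMap V P') hVs hyk]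
      refine ⟨hys, ?_⟩
      rw [List.map_map, ← RingHom.coe_comp, ← hPV]
      exact hP'g.1
    have hrV : Ideal.ofList (rs.map (algebraMap P V)) = J.map (algebraMap P V) := by
      rw [← Ideal.map_ofList, hrJ]
    have h2 := wreg_perm h1 List.perm_append_comm (by
      rw [Ideal.ofList_append, hyk, hrV]
      exact sup_le (le_maximalIdeal (RingHom.ker_ne_top _)) hJV)
    rw [wreg_append_iff (algebraMap V V1) hVV1 (by rw [hrV, hkV])] at h2
    refine grs_iff.2 ⟨RingHom.ker_ne_top _, _, h2.2, ?_⟩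
    rw [← Ideal.map_ofList, hyk]
    apply Ideal.comap_injective_of_surjective _ hVV1
    rw [Ideal.comap_map_of_surjective' _ hVV1, RingHom.comap_ker, ← hVS1, hVS,
      ← RingHom.comap_ker, hkS, hkV, ← hJVP, Ideal.comap_map_of_surjective' _ hVs, sup_comm]

end StepJ

section A0
open RingTheory.Sequence

lemma wreg_descend {A B : Type u} [CommRing A] [CommRing B] [Algebra A B]
    [Module.FaithfullyFlat A B] {rs : List A} (h : IsWeaklyRegular B (rs.map (algebraMap A B))) :
    IsWeaklyRegular A rs := by
  refine ⟨fun i hi => ?_⟩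
  have h1 := h.regular_mod_prev i (by simpa using hi)
  rw [isSMulRegular_quotient_iff_mem_of_smul_mem] at h1 ⊢
  intro a ha
  simp only [smul_eq_mul, Ideal.mul_top, List.getElem_map] at h1 ha ⊢
  rw [← List.map_take, ← Ideal.map_ofList] at h1
  rw [← Ideal.comap_map_eq_self_of_faithfullyFlat (B := B) (Ideal.ofList (rs.take i))]
  refine h1 _ ?_
  rw [← map_mul]
  exact Ideal.mem_map_of_mem _ ha

lemma ker_eq_map {R S P : Type u} [CommRing R] [CommRing S] [CommRing P] [IsLocalRing R]
    [IsLocalRing S] [IsLocalRing P] [IsNoetherianRing S] [IsNoetherianRing P]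
    [Algebra R S] [Algebra R P] (hs : Function.Surjective (algebraMap R S))
    (hm : (maximalIdeal R).map (algebraMap R P) = maximalIdeal P)
    (g : P →+* Cp S) (hg : Function.Surjective g)
    (hc : ∀ x, g (algebraMap R P x) = algebraMap S (Cp S) (algebraMap R S x)) :
    RingHom.ker g = (RingHom.ker (algebraMap R S)).map (algebraMap R P) := by
  have hloc : IsLocalHom g := .of_surjective g hg
  have hmS := map_maximalIdeal_of_surj _ hs
  have hres : ∀ t : P, ∃ r : R, t - algebraMap R P r ∈ maximalIdeal P := by
    intro t
    obtain ⟨s, h⟩ := Cp.residue 1 (g t)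
    obtain ⟨r, rfl⟩ := hs s
    refine ⟨r, ?_⟩
    rw [← hc, ← map_sub, pow_one] at h
    have h4 : (maximalIdeal (Cp S)).comap g = maximalIdeal P :=
      ((IsLocalRing.local_hom_TFAE g).out 0 4).1 hloc
    rw [← h4]
    exact h
  have hgr : ∀ n, ∀ y ∈ maximalIdeal P ^ n, ∃ r ∈ maximalIdeal R ^ n,
      y - algebraMap R P r ∈ maximalIdeal P ^ (n + 1) := by
    intro n y hy
    rw [← hm, ← Ideal.map_pow, Ideal.map] at hy
    induction hy using Submodule.span_induction with
    | mem x hx =>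
      obtain ⟨a, ha, rfl⟩ := hx
      exact ⟨a, ha, by simp⟩
    | zero => exact ⟨0, zero_mem _, by simp⟩
    | add x y _ _ hx hy =>
      obtain ⟨a, ha, ha'⟩ := hx
      obtain ⟨b, hb, hb'⟩ := hy
      refine ⟨a + b, add_mem ha hb, ?_⟩
      have := add_mem ha' hb'
      rw [map_add]
      convert this using 1
      ring
    | smul p y hy' hy =>
      obtain ⟨a, ha, ha'⟩ := hy
      obtain ⟨b, hb⟩ := hres p
      have hy2 : y ∈ maximalIdeal P ^ n := by
        rw [← hm, ← Ideal.map_pow]; exact hy'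
      refine ⟨b * a, Ideal.mul_mem_left _ _ ha, ?_⟩
      have e : p • y - algebraMap R P (b * a) =
          (y * (p - algebraMap R P b)) + algebraMap R P b * (y - algebraMap R P a) := by
        rw [map_mul, smul_eq_mul]; ring
      rw [e]
      exact add_mem (by rw [pow_succ]; exact Ideal.mul_mem_mul hy2 hb) (Ideal.mul_mem_left _ _ ha')
  have happ : ∀ n, ∀ t : P, ∃ r : R, t - algebraMap R P r ∈ maximalIdeal P ^ n := by
    intro n
    induction n with
    | zero => intro t; exact ⟨0, by simp⟩
    | succ n ih =>
      intro t
      obtain ⟨r, hr⟩ := ih t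
      obtain ⟨r', -, hr'⟩ := hgr n _ hr
      refine ⟨r + r', ?_⟩
      convert hr' using 1
      rw [map_add]; ring
  have hE : ∀ n, (maximalIdeal P ^ n).map g = maximalIdeal (Cp S) ^ n := fun n => by
    rw [Ideal.map_pow, map_maximalIdeal_of_surj _ hg]
  apply le_antisymm
  · intro x hx
    rw [RingHom.mem_ker] at hx
    set I := (RingHom.ker (algebraMap R S)).map (algebraMap R P)
    rw [← Ideal.Quotient.eq_zero_iff_mem]
    refine IsHausdorff.haus (I := maximalIdeal P) inferInstance _ fun n => ?_
    obtain ⟨r, hr⟩ := happ n x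
    have h1 : algebraMap S (Cp S) (algebraMap R S r) ∈ maximalIdeal (Cp S) ^ n := by
      have := Ideal.mem_map_of_mem g hr
      rw [hE, map_sub, hx, zero_sub, neg_mem_iff, hc] at this
      exact this
    rw [AdicCompletion.maximalIdeal_eq_map, mem_pow_completion, AdicCompletion.algebraMap_apply,
      AdicCompletion.evalₐ_of] at h1
    rw [Ideal.Quotient.eq_zero_iff_mem] at h1
    replace h1 : algebraMap R S r ∈ maximalIdeal S ^ n := h1
    rw [← hmS, ← Ideal.map_pow] at h1
    replace h1 := Ideal.mem_comap.2 h1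
    rw [Ideal.comap_map_of_surjective' _ hs] at h1
    obtain ⟨a, ha, b, hb, rfl⟩ := Submodule.mem_sup.1 h1
    rw [SModEq.zero]
    have e : (Ideal.Quotient.mk I x) = Ideal.Quotient.mk I
        ((x - algebraMap R P (a + b)) + algebraMap R P a) := by
      rw [← sub_eq_zero, ← map_sub, Ideal.Quotient.eq_zero_iff_mem]
      have : x - (x - algebraMap R P (a + b) + algebraMap R P a) = algebraMap R P b := by
        rw [map_add]; ring
      rw [this]
      exact Ideal.mem_map_of_mem _ hb
    rw [e, ← mul_one (_ + _), map_mul]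
    refine Submodule.smul_mem_smul (n := (1 : P ⧸ I)) (add_mem hr ?_) Submodule.mem_top
    rw [← hm, ← Ideal.map_pow]
    exact Ideal.mem_map_of_mem _ ha
  · rw [Ideal.map_le_iff_le_comap]
    intro a ha
    rw [Ideal.mem_comap, RingHom.mem_ker, hc, RingHom.mem_ker.1 ha, map_zero]

theorem lemmaA0 {R S T : Type u} [CommRing R] [CommRing S] [CommRing T] [IsLocalRing R]
    [IsLocalRing S] [IsLocalRing T] [IsNoetherianRing R] [IsNoetherianRing S] [IsNoetherianRing T]
    [Algebra R S] [Algebra R T] (hs : Function.Surjective (algebraMap R S))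
    (hT : WR R T) (g : T →+* Cp S) (hg : Function.Surjective g)
    (hK : GeneratedByRegularSequence T (RingHom.ker g))
    (hc : ∀ x, g (algebraMap R T x) = algebraMap S (Cp S) (algebraMap R S x)) :
    GeneratedByRegularSequence R (RingHom.ker (algebraMap R S)) := by
  obtain ⟨hl, hf, rs, hrs, hrm⟩ := hT
  have hmT : (maximalIdeal R).map (algebraMap R T) ≤ maximalIdeal T := map_maximalIdeal_le
  set K := RingHom.ker g with hKd
  have hKm : K ≤ maximalIdeal T := le_maximalIdeal (RingHom.ker_ne_top _)
  set mT := (maximalIdeal R).map (algebraMap R T) with hmTd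
  have hgm : mT.map g = maximalIdeal (Cp S) := by
    have e : g.comp (algebraMap R T) = (algebraMap S (Cp S)).comp (algebraMap R S) :=
      RingHom.ext hc
    rw [hmTd, Ideal.map_map, AdicCompletion.maximalIdeal_eq_map, e, ← Ideal.map_map,
      map_maximalIdeal_of_surj _ hs]
  have hsup : maximalIdeal T ≤ mT ⊔ K := by
    rw [← Ideal.comap_map_of_surjective' _ hg, hgm, ← Ideal.map_le_iff_le_comap,
      map_maximalIdeal_of_surj _ hg]
  -- lift
  have hlf : IsLocalRing (T ⧸ mT) := isLocalRing_quot hmT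
  obtain ⟨ws, hw1, hw2⟩ := list_lift (Ideal.Quotient.mk mT) (K : Set T)
    (rs.map (Ideal.Quotient.mk mT)) (by
      intro w hw
      obtain ⟨r, hr, rfl⟩ := List.mem_map.1 hw
      have : r ∈ maximalIdeal T := mem_of_ofList_le (le_sup_right.trans_eq hrm) r hr
      obtain ⟨a, ha, b, hb, rfl⟩ := Submodule.mem_sup.1 (hsup this)
      refine ⟨b, hb, ?_⟩
      rw [map_add, Ideal.Quotient.eq_zero_iff_mem.2 ha, zero_add])
  have hwr : IsWeaklyRegular (T ⧸ mT) ws := by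
    rw [← wreg_mk, hw1, wreg_mk]; exact hrs
  have hwm : mT ⊔ Ideal.ofList ws = maximalIdeal T := by
    rw [sup_ofList_iff hmT, hw1, ← sup_ofList_iff hmT]; exact hrm
  have hwK : Ideal.ofList ws ≤ K := ofList_le hw2
  obtain ⟨hwT, hwf⟩ := fib_list ws (hwK.trans hKm) hwr
  obtain ⟨-, ys, hys, hyK⟩ := grs_iff.1 hK
  obtain ⟨Z, hZ1, hZ2⟩ := wreg_extend hKm ws [] ys hys hyK hw2 (by
    rintro l₁ v l₂ rfl hv
    have h1 := wreg_mk.2 hwr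
    rw [List.map_append, List.map_cons] at h1
    have hmm : Ideal.ofList ((l₁ ++ v :: l₂).map (Ideal.Quotient.mk mT)) =
        maximalIdeal (T ⧸ mT) := by
      rw [maximalIdeal_quot, ← sup_ofList_iff hmT]; exact hwm
    rw [List.map_append, List.map_cons] at hmm
    refine wreg_indep h1 hmm le_rfl ?_
    have := Ideal.mem_map_of_mem (Ideal.Quotient.mk mT) hv
    rw [List.nil_append, Ideal.map_sup, Ideal.map_mul, Ideal.map_ofList, ← maximalIdeal_quot] at this
    have hle : K.map (Ideal.Quotient.mk mT) ≤ maximalIdeal (T ⧸ mT) := by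
      rw [maximalIdeal_quot]
      exact Ideal.map_mono hKm
    exact sup_le_sup le_rfl (Ideal.mul_mono le_rfl hle) this)
  rw [List.nil_append] at hZ1 hZ2
  -- the quotient
  let P := T ⧸ Ideal.ofList ws
  have : IsLocalRing P := isLocalRing_quot (hwK.trans hKm)
  have : IsScalarTower R T P := IsScalarTower.of_algebraMap_eq fun _ => rfl
  let g' : P →+* Cp S := Ideal.Quotient.lift _ g (fun a ha => hwK ha)
  have hg' : Function.Surjective g' := Ideal.Quotient.lift_surjective_of_surjective _ _ hg
  have hPm : (maximalIdeal R).map (algebraMap R P) = maximalIdeal P := by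
    rw [IsScalarTower.algebraMap_eq R T P, ← Ideal.map_map, maximalIdeal_quot, ← hwm,
      Ideal.map_sup]
    symm
    refine sup_eq_left.2 ?_
    rw [Ideal.map_quotient_self]
    exact bot_le
  have hPk := ker_eq_map hs hPm g' hg' hc
  rw [wreg_append_iff (Ideal.Quotient.mk (Ideal.ofList ws)) Ideal.Quotient.mk_surjective
    Ideal.mk_ker.symm] at hZ1
  have hkP : Ideal.ofList (Z.map (Ideal.Quotient.mk (Ideal.ofList ws))) = RingHom.ker g' := by
    rw [← Ideal.map_ofList]
    apply Ideal.comap_injective_of_surjective _ Ideal.Quotient.mk_surjective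
    rw [Ideal.comap_map_of_surjective' _ Ideal.Quotient.mk_surjective, Ideal.mk_ker,
      sup_comm, ← Ideal.ofList_append, hZ2, RingHom.comap_ker]
    rfl
  set J := RingHom.ker (algebraMap R S)
  obtain ⟨X, hX1, hX2, hX3⟩ := wreg_choose (le_maximalIdeal (RingHom.ker_ne_top g'))
    (algebraMap R P '' J) hPk.symm _ []
    _ rfl hZ1.2 hkP (by simp)
  obtain ⟨xs, rfl, hxJ⟩ := list_lift (algebraMap R P) (J : Set R) X (fun w hw => by
    obtain ⟨a, ha, e⟩ := hX3 w hw
    exact ⟨a, ha, e⟩)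
  have : IsLocalHom (algebraMap R P) :=
    ((IsLocalRing.local_hom_TFAE (algebraMap R P)).out 0 2).2 hPm.le
  have : Module.FaithfullyFlat R P := Module.FaithfullyFlat.of_flat_of_isLocalHom
  refine grs_iff.2 ⟨RingHom.ker_ne_top _, xs, wreg_descend hX1, ?_⟩
  rw [← Ideal.comap_map_eq_self_of_faithfullyFlat (B := P) (Ideal.ofList xs), Ideal.map_ofList,
    hX2, hPk, Ideal.comap_map_eq_self_of_faithfullyFlat]

end A0

section StepX
open RingTheory.Sequence Polynomial
attribute [local instance] Polynomial.algebra

set_option maxHeartbeats 1000000 in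
theorem stepX_mod {R R' Q E G P1 M N : Type u} [CommRing R] [CommRing R'] [CommRing Q] [CommRing E]
    [CommRing G] [CommRing P1] [Algebra R R'] [Algebra Q R'] [Algebra Q[X] G] [Algebra R'[X] E]
    [Algebra G E] [Algebra Q[X] E] [Algebra R[X] E] [Algebra P1 E] [Algebra R[X] P1]
    [IsScalarTower Q[X] G E] [IsScalarTower Q[X] R'[X] E] [IsScalarTower R[X] R'[X] E]
    [IsScalarTower R[X] P1 E] (s : Submonoid R[X]) [IsLocalization s P1]
    (hp : Algebra.IsPushout Q[X] G R'[X] E) [Module.Flat Q[X] G]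
    [AddCommGroup M] [AddCommGroup N] [Module R M] [Module R[X] M] [Module P1 M]
    [IsScalarTower R R[X] M] [IsScalarTower R[X] P1 M]
    [Module R N] [Module R' N] [IsScalarTower R R' N] [Module Q N] [IsScalarTower Q R' N]
    (j : M →ₗ[R] N) (hj : IsBaseChange R' j) (h : FlatDimFinite Q N) :
    ∃ (N1 : Type u) (_ : AddCommGroup N1) (_ : Module E N1) (_ : Module G N1) (_ : Module P1 N1)
      (_ : IsScalarTower G E N1) (_ : IsScalarTower P1 E N1) (j1 : M →ₗ[P1] N1),
      IsBaseChange E j1 ∧ FlatDimFinite G N1 := by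
  have := smulComm_alg R[X] Q R'[X]
  have := smulComm_alg R[X] Q[X] R'[X]
  have := smulComm_alg R[X] R'[X] R'[X]
  have := smulComm_alg R'[X] R[X] E
  have := smulComm_alg R'[X] Q[X] E
  have := smulComm_alg R'[X] G E
  have := smulComm_alg R'[X] P1 E
  have hN' : FlatDimFinite Q (R'[X] ⊗[R[X]] M) :=
    bc_transfer (B := R') (inferInstanceAs (Algebra.IsPushout R R' R[X] R'[X])) j hj h
  obtain ⟨n, hn⟩ := hN'
  have : IsScalarTower Q Q[X] R'[X] := IsScalarTower.of_algebraMap_eq fun x => by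
    rw [Polynomial.algebraMap_apply, Polynomial.algebraMap_eq]
    simp [Polynomial.algebraMap_def]
  have hn2 := hn.poly
  have b1 : IsBaseChange E (TensorProduct.mk R'[X] E (R'[X] ⊗[R[X]] M) 1) :=
    TensorProduct.isBaseChange _ _ _
  have b2 := (bc_pushout hp _).1 b1
  have hn3 := hn2.isBaseChange b2
  have b0 : IsBaseChange R'[X] (TensorProduct.mk R[X] R'[X] M 1) :=
    TensorProduct.isBaseChange _ _ _
  have b3 := b0.comp b1
  have := isLocalizedModule_id s M P1
  have b4 := IsLocalizedModule.isBaseChange s P1 (LinearMap.id : M →ₗ[R[X]] M)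
  have : IsScalarTower R[X] P1 (E ⊗[R'[X]] (R'[X] ⊗[R[X]] M)) := inferInstance
  refine ⟨E ⊗[R'[X]] (R'[X] ⊗[R[X]] M), inferInstance, inferInstance, inferInstance, inferInstance,
    inferInstance, inferInstance, LinearMap.extendScalarsOfIsLocalization s P1 (((TensorProduct.mk
      R'[X] E (R'[X] ⊗[R[X]] M) 1).restrictScalars R[X]) ∘ₗ (TensorProduct.mk R[X] R'[X] M 1)),
      ?_, _, hn3⟩
  exact IsBaseChange.of_comp b4 b3

end StepX

section StepX2
open RingTheory.Sequence Polynomial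

lemma exists_q' {R R' : Type u} [CommRing R] [CommRing R'] [IsLocalRing R] [IsLocalRing R']
    [IsNoetherianRing R] [Algebra R R'] [IsLocalHom (algebraMap R R')] (q : Ideal R[X]) [q.IsPrime]
    (hq : q.comap C = maximalIdeal R) :
    ∃ q' : Ideal R'[X], q'.IsPrime ∧ q'.comap C = maximalIdeal R' ∧
      q'.comap (mapRingHom (algebraMap R R')) = q := by
  have hloc := (wr_poly q hq).1
  let P1 := Localization.AtPrime q
  let κ := ResidueField P1
  let k := ResidueField R
  let k' := ResidueField R'
  let E := κ ⊗[k] k'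
  obtain ⟨n, hn⟩ := Ideal.exists_maximal E
  let L := E ⧸ n
  let : Field L := Ideal.Quotient.field n
  let a : κ →+* L := (Ideal.Quotient.mk n).comp Algebra.TensorProduct.includeLeftRingHom
  let b : k' →+* L := (Ideal.Quotient.mk n).comp
    (Algebra.TensorProduct.includeRight : k' →ₐ[k] E).toRingHom
  have hab : ∀ x : k, a (algebraMap k κ x) = b (algebraMap k k' x) := fun x => by
    refine congrArg (Ideal.Quotient.mk n) ?_
    exact ((Algebra.TensorProduct.includeLeft : κ →ₐ[k] E).commutes x).trans
      ((Algebra.TensorProduct.includeRight : k' →ₐ[k] E).commutes x).symm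
  let ρ : R[X] →+* κ := (residue P1).comp (algebraMap R[X] P1)
  let φ : R'[X] →+* L := eval₂RingHom (b.comp (residue R')) (a (ρ X))
  have hφ : φ.comp (mapRingHom (algebraMap R R')) = a.comp ρ := by
    apply Polynomial.ringHom_ext
    · intro r
      simp only [RingHom.comp_apply, φ, coe_mapRingHom, map_C, coe_eval₂RingHom, eval₂_C]
      exact (hab (residue R r)).symm
    · simp [φ]
  refine ⟨RingHom.ker φ, RingHom.ker_isPrime φ, ?_, ?_⟩
  · rw [RingHom.comap_ker]
    have : φ.comp C = b.comp (residue R') := by ext x; simp [φ]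
    rw [this, RingHom.ker_comp_of_injective _ b.injective, IsLocalRing.ker_residue]
  · rw [RingHom.comap_ker, hφ, RingHom.ker_comp_of_injective _ a.injective, ← RingHom.comap_ker,
      IsLocalRing.ker_residue]
    exact Localization.AtPrime.under_maximalIdeal
  
lemma loc_surj {D D' : Type u} [CommRing D] [CommRing D'] (f : D →+* D')
    (hs : Function.Surjective f) (q' : Ideal D') [q'.IsPrime] (q : Ideal D) [q.IsPrime]
    (hq : q = q'.comap f) : Function.Surjective (Localization.localRingHom q q' f hq) ∧
    RingHom.ker (Localization.localRingHom q q' f hq) = (RingHom.ker f).map (algebraMap D _) := by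
  have hm : q.primeCompl.map f = q'.primeCompl := by
    ext x
    constructor
    · rintro ⟨y, hy, rfl⟩
      intro hx
      exact hy (hq ▸ hx)
    · intro hx
      obtain ⟨y, rfl⟩ := hs x
      exact ⟨y, fun hy => hx (by rw [hq] at hy; exact hy), rfl⟩
  constructor
  · have : IsLocalization (q.primeCompl.map f) (Localization.AtPrime q') := by
      rw [hm]; infer_instance
    exact IsLocalization.map_surjective_of_surjective (M := q.primeCompl)
      (S := Localization.AtPrime q) (g := f) (Q := Localization.AtPrime q') hs
  · exact IsLocalization.ker_map (S := Localization.AtPrime q) (Localization.AtPrime q') f hm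

lemma Cp.map_ker {A B : Type u} [CommRing A] [IsLocalRing A] [IsNoetherianRing A]
    [CommRing B] [IsLocalRing B] [IsNoetherianRing B] (f : A →+* B) (hf : Function.Surjective f)
    (hg : GeneratedByRegularSequence A (RingHom.ker f)) :
    ∃ F : Cp A →+* Cp B, (∀ a, F (algebraMap A _ a) = algebraMap B _ (f a)) ∧
      Function.Surjective F ∧ GeneratedByRegularSequence (Cp A) (RingHom.ker F) ∧
      RingHom.ker F = (RingHom.ker f).map (algebraMap A (Cp A)) := by
  obtain ⟨F, h1, h2, h3⟩ := Cp.map f hf hg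
  let _ := f.toAlgebra
  exact ⟨F, h1, h2, h3, ker_eq_map (R := A) (S := B) hf AdicCompletion.maximalIdeal_eq_map.symm F h2
    h1⟩

lemma lemC {D D' : Type u} [CommRing D] [CommRing D'] [IsLocalRing D] [IsLocalRing D']
    [IsNoetherianRing D] [IsNoetherianRing D'] (f : D →+* D') (hs : Function.Surjective f)
    (hg : GeneratedByRegularSequence D (RingHom.ker f)) (q' : Ideal D'[X]) [q'.IsPrime]
    (q : Ideal D[X]) [q.IsPrime]
    (hq' : q'.comap C = maximalIdeal D') (hq : q = q'.comap (mapRingHom f)) :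
    q.comap C = maximalIdeal D ∧
    ∃ F : Cp (Localization.AtPrime q) →+* Cp (Localization.AtPrime q'),
      (∀ p : D[X], F (algebraMap D[X] _ p) = algebraMap D'[X] _ (mapRingHom f p)) ∧
      Function.Surjective F ∧
      GeneratedByRegularSequence (Cp (Localization.AtPrime q)) (RingHom.ker F) ∧
      RingHom.ker F = (RingHom.ker (mapRingHom f)).map (algebraMap D[X] _) := by
  have hqD : q.comap C = maximalIdeal D := by
    have hl : IsLocalHom f := .of_surjective f hs
    have h4 : (maximalIdeal D').comap f = maximalIdeal D :=
      ((IsLocalRing.local_hom_TFAE f).out 0 4).1 hl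
    rw [hq, Ideal.comap_comap, mapRingHom_comp_C, ← Ideal.comap_comap, hq', h4]
  refine ⟨hqD, ?_⟩
  have hwr := wr_poly q hqD
  have hl := hwr.1
  have hfl := hwr.2.1
  have hs2 : Function.Surjective (mapRingHom f) := map_surjective f hs
  obtain ⟨h1, h2⟩ := loc_surj (mapRingHom f) hs2 q' q hq
  have hk : RingHom.ker (Localization.localRingHom q q' (mapRingHom f) hq) =
      (RingHom.ker f).map (algebraMap D (Localization.AtPrime q)) := by
    rw [h2, ker_mapRingHom, Ideal.map_map]
    rfl
  obtain ⟨-, rs, hrs, hr⟩ := grs_iff.1 hg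
  have hgl : GeneratedByRegularSequence _
      (RingHom.ker (Localization.localRingHom q q' (mapRingHom f) hq)) := by
    rw [hk, ← hr]
    refine (grs_map_flat hrs ?_).2
    rw [hr, ← hk]
    exact le_maximalIdeal (RingHom.ker_ne_top _)
  obtain ⟨F, hF1, hF2, hF3, hF4⟩ := Cp.map_ker _ h1 hgl
  refine ⟨F, fun p => ?_, hF2, hF3, ?_⟩
  · refine (hF1 (algebraMap D[X] _ p)).trans ?_
    rw [Localization.localRingHom_to_map]
    rfl
  · rw [hF4, h2, Ideal.map_map]
    rfl

end StepX2

section StepX3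
open RingTheory.Sequence Polynomial
attribute [local instance] Polynomial.algebra

lemma locHom_WR {D : Type u} [CommRing D] [IsLocalRing D] [IsNoetherianRing D] :
    IsLocalHom (algebraMap D (Cp D)) := Cp.wr.1

set_option maxHeartbeats 2000000 in
theorem stepX {R M : Type u} [CommRing R] [IsLocalRing R] [IsNoetherianRing R] (q : Ideal R[X])
    [q.IsPrime] (hq : q.comap C = maximalIdeal R) [AddCommGroup M] [Module R M]
    [Module (Localization.AtPrime q) M] [IsScalarTower R (Localization.AtPrime q) M]
    (h : HF R M) : HF (Localization.AtPrime q) M := by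
  obtain ⟨R', Q, V, _, _, _, _, _, _, _, _, _, _, _, _, _, _, N, _, _, _, _, _, _, j, hloc, hfl,
    hQs, hQg, hWR, hVs, hVg, hbc, hfd⟩ := h
  obtain ⟨q', hq'p, hq', hqq'⟩ := exists_q' (R' := R') q hq
  let qQ := q'.comap (mapRingHom (algebraMap Q R'))
  let qV := q'.comap (mapRingHom (algebraMap V R'))
  obtain ⟨hQ1, FQ, hFQ1, hFQ2, hFQ3, hFQ4⟩ := lemC (algebraMap Q R') hQs hQg q' qQ hq' rfl
  obtain ⟨hV1, FV, hFV1, hFV2, hFV3, -⟩ := lemC (algebraMap V R') hVs hVg q' qV hq' rfl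
  have hqV : q = qV.comap (mapRingHom (algebraMap R V)) := by
    rw [Ideal.comap_comap, mapRingHom_comp, ← IsScalarTower.algebraMap_eq, hqq']
  let P1 := Localization.AtPrime q
  let E := Cp (Localization.AtPrime q')
  let G := Cp (Localization.AtPrime qQ)
  let W := Cp (Localization.AtPrime qV)
  let a : P1 →+* E := (algebraMap (Localization.AtPrime q') E).comp
    (Localization.localRingHom q q' (mapRingHom (algebraMap R R')) hqq'.symm)
  let b : P1 →+* W := (algebraMap (Localization.AtPrime qV) W).comp
    (Localization.localRingHom q qV (mapRingHom (algebraMap R V)) hqV)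
  have ha : ∀ x : R[X], a (algebraMap R[X] P1 x) = algebraMap R'[X] E (mapRingHom (algebraMap R R') x) := by
    exact fun x => congrArg (algebraMap (Localization.AtPrime q') E)
      (Localization.localRingHom_to_map q q' (mapRingHom (algebraMap R R')) hqq'.symm x)
  have hb : ∀ x : R[X], b (algebraMap R[X] P1 x) = algebraMap V[X] W (mapRingHom (algebraMap R V) x) := by
    exact fun x => congrArg (algebraMap (Localization.AtPrime qV) W)
      (Localization.localRingHom_to_map q qV (mapRingHom (algebraMap R V)) hqV x)
  have la : IsLocalHom a := by
    have := locHom_WR (D := Localization.AtPrime q')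
    have := Localization.isLocalHom_localRingHom q q' (mapRingHom (algebraMap R R')) hqq'.symm
    exact RingHom.isLocalHom_comp _ _
  have lb : IsLocalHom b := by
    have := locHom_WR (D := Localization.AtPrime qV)
    have := Localization.isLocalHom_localRingHom q qV (mapRingHom (algebraMap R V)) hqV
    exact RingHom.isLocalHom_comp _ _
  have hab : ∀ x, FV (b x) = a x := by
    intro x
    have : FV.comp b = a := by
      apply IsLocalization.ringHom_ext q.primeCompl
      refine RingHom.ext fun y => ?_
      simp only [RingHom.comp_apply]
      rw [hb, ha, hFV1]
      simp only [← RingHom.comp_apply, mapRingHom_comp, ← IsScalarTower.algebraMap_eq]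
      rfl
    rw [← this]; rfl
  obtain ⟨V', _, _, _, _, g, hV'1, hV'2, hg1, hg2⟩ := cohen_fact' (fun k _ p _ => cohen_exists k p) b
  let _ : Algebra P1 E := a.toAlgebra
  let _ : Algebra V' E := (FV.comp g).toAlgebra
  let _ : Algebra G E := FQ.toAlgebra
  have t1 : IsScalarTower P1 V' E := IsScalarTower.of_algebraMap_eq fun x => by
    change a x = FV (g (algebraMap P1 V' x))
    rw [hg2, hab]
  have t2 : IsScalarTower R[X] P1 E := IsScalarTower.of_algebraMap_eq fun x => (ha x).symm
  have t3 : IsScalarTower Q[X] G E := IsScalarTower.of_algebraMap_eq fun x => (hFQ1 x).symm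
  have t4 : IsScalarTower Q[X] R'[X] E := IsScalarTower.of_algebraMap_eq fun _ => rfl
  have t5 : IsScalarTower R[X] R'[X] E := IsScalarTower.of_algebraMap_eq fun _ => rfl
  have hp : Algebra.IsPushout Q[X] G R'[X] E :=
    (pushout_surj (A := Q[X]) (A1 := R'[X]) (B := G) (B1 := E) (map_surjective _ hQs) hFQ2 hFQ4).symm
  have fG : Module.Flat Q[X] G := by
    have : Module.Flat (Localization.AtPrime qQ) G := Cp.wr.2.1
    have : Module.Flat Q[X] (Localization.AtPrime qQ) := IsLocalization.flat _ qQ.primeCompl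
    have : IsScalarTower Q[X] (Localization.AtPrime qQ) G := inferInstance
    exact Module.Flat.trans Q[X] (Localization.AtPrime qQ) G
  have fE : Module.Flat P1 E := by
    have : Module.Flat (Localization.AtPrime q') E := Cp.wr.2.1
    have : Module.Flat R'[X] (Localization.AtPrime q') := IsLocalization.flat _ q'.primeCompl
    have : IsScalarTower R'[X] (Localization.AtPrime q') E := inferInstance
    have : Module.Flat R'[X] E := Module.Flat.trans R'[X] (Localization.AtPrime q') E
    have hpo : IsBaseChange R[X] (IsScalarTower.toAlgHom R R' R'[X]).toLinearMap :=
      (inferInstance : Algebra.IsPushout R R[X] R' R'[X]).out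
    have : Module.Flat R[X] R'[X] := Module.Flat.isBaseChange R R[X] R' R'[X] hpo
    have : Module.Flat R[X] E := Module.Flat.trans R[X] R'[X] E
    exact (Module.flat_iff_of_isLocalization P1 q.primeCompl E).2 this
  let _ : Module R[X] M := Module.compHom M (algebraMap R[X] P1)
  have t6 : IsScalarTower R[X] P1 M := IsScalarTower.of_algebraMap_smul fun _ _ => rfl
  have t7 : IsScalarTower R R[X] M := IsScalarTower.of_algebraMap_smul fun r x => by
    change (algebraMap R[X] P1 (algebraMap R R[X] r)) • x = r • x
    rw [← IsScalarTower.algebraMap_apply R R[X] P1, algebraMap_smul]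
  obtain ⟨N1, _, _, _, _, _, _, j1, hj1, hf1⟩ := stepX_mod (E := E) (P1 := P1) q.primeCompl hp j hbc hfd
  refine ⟨E, G, V', inferInstance, inferInstance, inferInstance, inferInstance, inferInstance,
    inferInstance, inferInstance, inferInstance, inferInstance, inferInstance, inferInstance,
    inferInstance, inferInstance, inferInstance, N1, inferInstance, inferInstance,
    inferInstance, inferInstance, inferInstance, inferInstance, j1, la, fE, hFQ2, hFQ3, hV'1,
    hFV2.comp hg1, ?_, hj1, hf1⟩
  have hRP1 : WR R P1 := wr_poly q hq
  let _ : Algebra R V' := ((algebraMap P1 V').comp (algebraMap R P1)).toAlgebra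
  have : IsScalarTower R P1 V' := IsScalarTower.of_algebraMap_eq fun _ => rfl
  have hRV' : WR R V' := hRP1.comp hV'1
  have : IsScalarTower R V (Localization.AtPrime qV) := inferInstance
  have hRVq : WR R (Localization.AtPrime qV) := hWR.comp (wr_poly qV hV1)
  have : IsScalarTower R (Localization.AtPrime qV) W := inferInstance
  have hRW : WR R W := hRVq.comp Cp.wr
  let g' : V' →ₐ[R] W := { g with
    commutes' := fun r => by
      change g (algebraMap P1 V' (algebraMap R P1 r)) = _
      rw [hg2, IsScalarTower.algebraMap_apply R R[X] P1, hb]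
      simp only [algebraMap_eq, coe_mapRingHom, map_C]
      rfl }
  have hk : GeneratedByRegularSequence V' (RingHom.ker g) := grs_ker_of_WR hRV' hRW g' hg1
  change GeneratedByRegularSequence V' (RingHom.ker (FV.comp g))
  rw [← RingHom.comap_ker]
  exact grs_comap g hg1 hk _ hFV3

end StepX3

section Norm
open RingTheory.Sequence

def CIw (R S : Type u) [CommRing R] [CommRing S] [IsLocalRing R] [IsLocalRing S] [Algebra R S] :
    Prop :=
  ∃ (T : Type u) (_ : CommRing T) (_ : IsLocalRing T) (_ : IsNoetherianRing T) (_ : Algebra R T)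
    (g : T →+* Cp S), WR R T ∧ IsAdicComplete (maximalIdeal T) T ∧ Function.Surjective g ∧
    GeneratedByRegularSequence T (RingHom.ker g) ∧
    ∀ x, g (algebraMap R T x) = algebraMap S (Cp S) (algebraMap R S x)

lemma ciw_iff {R S : Type u} [CommRing R] [CommRing S] [IsLocalRing R] [IsLocalRing S]
    [IsNoetherianRing S] [Algebra R S] :
    CIw R S ↔ IsCIAt R S (algebraMap R S) (maximalIdeal S) := by
  constructor
  · rintro ⟨T, _, _, _, _, g, h1, h2, h3, h4, h5⟩
    exact ⟨T, inferInstance, algebraMap R T, g, ⟨RingHom.ext h5, inferInstance,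
      ⟨inferInstance, h2⟩, wr_iff.1 h1, h3, .of_surjective g h3⟩, h4⟩
  · rintro ⟨T, _, f, g, ⟨h5, _, ⟨_, h2⟩, h1, h3, -⟩, h4⟩
    let _ := f.toAlgebra
    exact ⟨T, inferInstance, inferInstance, inferInstance, inferInstance, g, wr_iff.2 h1, h2, h3,
      h4, fun x => RingHom.congr_fun h5 x⟩

set_option maxHeartbeats 1000000 in
theorem hf_of_ciqd {R M : Type u} [CommRing R] [IsLocalRing R] [IsNoetherianRing R]
    [AddCommGroup M] [Module R M] (h : HasFiniteCIQDDim R M) : HF R M := by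
  obtain ⟨R', Q, _, _, hR', f, g, ⟨_, _, _, _, hf, hg, hfl, hgs, hgg⟩, hci, hfd, -⟩ := h
  let _ := f.toAlgebra
  let _ := g.toAlgebra
  obtain ⟨N0, _, _, _, _, _, _, j0, b0, hfd⟩ : ∃ (N0 : Type u) (_ : AddCommGroup N0)
      (_ : Module R' N0) (_ : Module Q N0) (_ : Module R N0) (_ : IsScalarTower Q R' N0)
      (_ : IsScalarTower R R' N0) (j0 : M →ₗ[R] N0), IsBaseChange R' j0 ∧ FlatDimFinite Q N0 :=
    ⟨R' ⊗[R] M, inferInstance, inferInstance, Module.compHom _ g, inferInstance,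
      ⟨fun a b c => mul_smul (g a) b c⟩, inferInstance, TensorProduct.mk R R' M 1,
      TensorProduct.isBaseChange _ _ _, hfd⟩
  obtain ⟨V, _, _, _, _, gV, hV1, hV2, hV3, hV4, hV5⟩ := ciw_iff.2 hci
  obtain ⟨F, hF1, hF2, hF3, hF4⟩ := Cp.map_ker g hgs hgg
  let _ : Algebra V (Cp R') := gV.toAlgebra
  let _ : Algebra (Cp Q) (Cp R') := F.toAlgebra
  have : IsScalarTower R V (Cp R') := IsScalarTower.of_algebraMap_eq fun x => (hV5 x).symm
  have : IsScalarTower Q (Cp Q) (Cp R') := IsScalarTower.of_algebraMap_eq fun x => (hF1 x).symm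
  have : IsScalarTower Q R' (Cp R') := inferInstance
  have : IsScalarTower R R' (Cp R') := inferInstance
  have hp : Algebra.IsPushout Q (Cp Q) R' (Cp R') :=
    (pushout_surj (A := Q) (A1 := R') (B := Cp Q) (B1 := Cp R') hgs hF2 hF4).symm
  have := smulComm_alg R' R (Cp R')
  have := smulComm_alg R' Q (Cp R')
  have := smulComm_alg R' (Cp Q) (Cp R')
  have := smulComm_alg R' V (Cp R')
  have fQ : Module.Flat Q (Cp Q) := Cp.wr.2.1
  have fR : Module.Flat R' (Cp R') := Cp.wr.2.1
  have fRR : Module.Flat R R' := hfl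
  have b1 : IsBaseChange (Cp R') (TensorProduct.mk R' (Cp R') N0 1) :=
    TensorProduct.isBaseChange _ _ _
  have b2 := (bc_pushout hp _).1 b1
  obtain ⟨n, hn⟩ := hfd
  have hn3 := FlatDimLE.isBaseChange b2 hn
  have b3 := b0.comp b1
  have l1 : IsLocalHom (algebraMap R R') := hf
  have l2 : IsLocalHom (algebraMap R' (Cp R')) := locHom_WR
  refine ⟨Cp R', Cp Q, V, inferInstance, inferInstance, inferInstance, inferInstance, inferInstance,
    inferInstance, inferInstance, inferInstance, inferInstance, inferInstance, inferInstance,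
    inferInstance, inferInstance, inferInstance, Cp R' ⊗[R'] N0, inferInstance,
    inferInstance, inferInstance, inferInstance, inferInstance, inferInstance, _, ?_, ?_, hF2, hF3,
    hV1, hV3, hV4, b3, n, hn3⟩
  · rw [IsScalarTower.algebraMap_eq R R' (Cp R')]
    exact RingHom.isLocalHom_comp _ _
  · exact Module.Flat.trans R R' (Cp R')

lemma fd_congr {Q S' N N' : Type u} [CommRing Q] [CommRing S'] [Algebra Q S'] [AddCommGroup N]
    [AddCommGroup N'] [Module Q N] [Module S' N] [Module Q N'] [Module S' N'] [IsScalarTower Q S' N']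
    [IsScalarTower Q S' N] (e : N ≃ₗ[S'] N') (h : FlatDimFinite Q N) : FlatDimFinite Q N' := by
  obtain ⟨n, hn⟩ := h
  exact ⟨n, hn.of_equiv (e.restrictScalars Q)⟩

theorem ciqd_of_hf {S M : Type u} [CommRing S] [IsLocalRing S] [IsNoetherianRing S]
    [AddCommGroup M] [Module S M] (h : HF S M) : HasFiniteCIQDDim S M := by
  obtain ⟨S', Q, V, _, _, _, _, _, _, _, _, _, i1, _, i2, _, _, N, _, _, _, _, _, _, j, hloc, hfl,
    hQs, hQg, hWR, hVs, hVg, hbc, hfd⟩ := h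
  have hci : IsCIAt S S' (algebraMap S S') (maximalIdeal S') := by
    obtain ⟨F, hF1, hF2, hF3⟩ := Cp.map (algebraMap V S') hVs hVg
    refine ciw_iff.1 ⟨Cp V, inferInstance, inferInstance, inferInstance, inferInstance, F,
      hWR.comp Cp.wr, inferInstance, hF2, hF3, fun x => ?_⟩
    rw [IsScalarTower.algebraMap_apply S V (Cp V), hF1, IsScalarTower.algebraMap_apply S V S']
  have hpd : ProjDimFinite Q S' := projDimFinite_of_grs hQs hQg
  clear hVs hVg 
  obtain ⟨g, rfl⟩ : ∃ g : Q →+* S', i2 = g.toAlgebra :=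
    ⟨algebraMap Q S', (Algebra.algebra_ext _ _ fun _ => rfl)⟩
  have : ∃ f : S →+* S', i1 = f.toAlgebra :=
    ⟨algebraMap S S', (Algebra.algebra_ext _ _ fun _ => rfl)⟩
  obtain ⟨f, rfl⟩ := this
  refine ⟨S', Q, inferInstance, inferInstance, inferInstance, f, g, ⟨inferInstance, inferInstance,
    inferInstance, inferInstance, hloc, .of_surjective g hQs, hfl, hQs, hQg⟩, hci, ?_⟩
  let _ := f.toAlgebra
  let _ := g.toAlgebra
  refine ⟨?_, hpd⟩
  refine @fd_congr Q S' N (S' ⊗[S] M) _ _ _ _ _ _ _ (Module.compHom _ g) _ ?_ _ hbc.equiv.symm hfd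
  exact ⟨fun a b c => mul_smul (g a) b c⟩

end Norm

section MainInd
open RingTheory.Sequence Polynomial

lemma ciw_poly {R S : Type u} [CommRing R] [CommRing S] [IsLocalRing R] [IsLocalRing S]
    [IsNoetherianRing R] [IsNoetherianRing S] [Algebra R S] (s : S) (q : Ideal R[X]) [q.IsPrime]
    (hq : q.comap C = maximalIdeal R) (hqs : ∀ p, p ∉ q → IsUnit (aeval s p))
    [Algebra (Localization.AtPrime q) S] [IsLocalHom (algebraMap (Localization.AtPrime q) S)]
    (hX : ∀ p : R[X], algebraMap (Localization.AtPrime q) S (algebraMap R[X] _ p) = aeval s p)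
    (h : CIw R S) : CIw (Localization.AtPrime q) S := by
  obtain ⟨T, _, _, _, _, g, h1, h2, h3, h4, h5⟩ := h
  obtain ⟨t, ht⟩ := h3 (algebraMap S (Cp S) s)
  have hgl : IsLocalHom g := .of_surjective g h3
  let φ : R[X] →+* T := (aeval t : R[X] →ₐ[R] T).toRingHom
  have hφ : ∀ p, g (φ p) = algebraMap S (Cp S) (aeval s p) := by
    have : g.comp φ = (algebraMap S (Cp S)).comp (aeval s : R[X] →ₐ[R] S).toRingHom := by
      apply Polynomial.ringHom_ext
      · intro r; simpa [φ] using h5 r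
      · simpa [φ] using ht
    exact fun p => RingHom.congr_fun this p
  have hu : ∀ y : q.primeCompl, IsUnit (φ y) := fun y => by
    refine hgl.map_nonunit _ ?_
    rw [hφ]
    exact (hqs y y.2).map _
  let ψ : Localization.AtPrime q →+* T := IsLocalization.lift hu
  have hψ : ∀ p, ψ (algebraMap R[X] _ p) = φ p := fun p => IsLocalization.lift_eq hu p
  have hgψ : g.comp ψ = (algebraMap S (Cp S)).comp (algebraMap (Localization.AtPrime q) S) := by
    apply IsLocalization.ringHom_ext q.primeCompl
    refine RingHom.ext fun p => ?_
    simp only [RingHom.comp_apply]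
    rw [hψ, hφ, hX]
  have hlψ : IsLocalHom ψ := by
    have l2 : IsLocalHom (algebraMap S (Cp S)) := locHom_WR
    have : IsLocalHom (g.comp ψ) := by rw [hgψ]; exact RingHom.isLocalHom_comp _ _
    exact isLocalHom_of_comp ψ g
  obtain ⟨V, _, _, _, _, k, hV1, hV2, hk1, hk2⟩ := cohen_fact' (fun k _ p _ => cohen_exists k p) ψ
  let _ : Algebra R V := ((algebraMap (Localization.AtPrime q) V).comp
    (algebraMap R (Localization.AtPrime q))).toAlgebra
  have : IsScalarTower R (Localization.AtPrime q) V := IsScalarTower.of_algebraMap_eq fun _ => rfl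
  have hRV : WR R V := (wr_poly q hq).comp hV1
  let k' : V →ₐ[R] T := { k with
    commutes' := fun r => by
      change k (algebraMap (Localization.AtPrime q) V (algebraMap R (Localization.AtPrime q) r)) = _
      rw [hk2, IsScalarTower.algebraMap_apply R R[X] (Localization.AtPrime q), hψ]
      exact (aeval t : R[X] →ₐ[R] T).commutes r }
  have hkk : GeneratedByRegularSequence V (RingHom.ker k) := grs_ker_of_WR hRV h1 k' hk1
  refine ⟨V, inferInstance, inferInstance, inferInstance, inferInstance, g.comp k, hV1, hV2,
    h3.comp hk1, ?_, fun x => ?_⟩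
  · rw [← RingHom.comap_ker]
    exact grs_comap k hk1 hkk _ h4
  · rw [RingHom.comp_apply, hk2]
    exact RingHom.congr_fun hgψ x

theorem main_ind {S M : Type u} [CommRing S] [IsLocalRing S] [IsNoetherianRing S] [AddCommGroup M]
    [Module S M] (l : List S) : ∀ (R : Type u) [CommRing R] [IsLocalRing R] [IsNoetherianRing R]
    [Algebra R S] [IsLocalHom (algebraMap R S)] [Module R M] [IsScalarTower R S M]
    (_ : ∀ x : S, ∃ t ∈ Algebra.adjoin R {y | y ∈ l}, IsUnit t ∧ x * t ∈ Algebra.adjoin R {y | y ∈ l})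
    (_ : CIw R S) (_ : HF R M), HF S M := by
  induction l with
  | nil =>
    intro R _ _ _ _ hl _ _ hgen hci hf
    have hs : Function.Surjective (algebraMap R S) := by
      intro x
      obtain ⟨t, ht, htu, hx⟩ := hgen x
      have h0 : {y : S | y ∈ ([] : List S)} = ∅ := by ext; simp
      rw [h0, Algebra.adjoin_empty, Algebra.mem_bot] at ht hx
      obtain ⟨r, rfl⟩ := ht
      obtain ⟨a, ha⟩ := hx
      obtain ⟨u, rfl⟩ := hl.map_nonunit r htu
      refine ⟨a * ↑u⁻¹, ?_⟩
      rw [map_mul, ha, mul_assoc, ← map_mul, Units.mul_inv, map_one, mul_one]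
    obtain ⟨T, _, _, _, _, g, h1, h2, h3, h4, h5⟩ := hci
    exact stepJ hs (lemmaA0 hs h1 g h3 h4 h5) hf
  | cons s l ih =>
    intro R _ _ _ _ hl _ _ hgen hci hf
    let φ : R[X] →+* S := (aeval s : R[X] →ₐ[R] S).toRingHom
    let q : Ideal R[X] := (maximalIdeal S).comap φ
    have hqp : q.IsPrime := inferInstance
    have hq : q.comap C = maximalIdeal R := by
      have h4 : (maximalIdeal S).comap (algebraMap R S) = maximalIdeal R :=
        ((IsLocalRing.local_hom_TFAE (algebraMap R S)).out 0 4).1 hl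
      rw [← h4, Ideal.comap_comap]
      congr 1
      ext r; simp [φ]
    have hqs : ∀ p, p ∉ q → IsUnit (aeval s p) := fun p hp => by
      by_contra h
      exact hp h
    let P1 := Localization.AtPrime q
    let ψ : P1 →+* S := IsLocalization.lift (M := q.primeCompl) (g := φ) fun y => hqs y y.2
    have hψ : ∀ p, ψ (algebraMap R[X] P1 p) = φ p := fun p => IsLocalization.lift_eq _ p
    let _ : Algebra P1 S := ψ.toAlgebra
    have hlψ : IsLocalHom (algebraMap P1 S) := by
      refine ⟨fun x hx => ?_⟩
      obtain ⟨a, b, rfl⟩ := IsLocalization.exists_mk'_eq q.primeCompl x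
      have h1 : IsUnit (φ a) := by
        have : ψ (IsLocalization.mk' P1 a b) * φ b = φ a := by
          rw [← hψ, ← hψ, ← map_mul, IsLocalization.mk'_spec]
        rw [← this]
        exact hx.mul (hqs b b.2)
      rw [IsLocalization.AtPrime.isUnit_mk'_iff P1 q]
      exact fun h => h h1
    let _ : Module P1 M := Module.compHom M ψ
    have t1 : IsScalarTower P1 S M := IsScalarTower.of_algebraMap_smul fun _ _ => rfl
    have t2 : IsScalarTower R P1 S := IsScalarTower.of_algebraMap_eq fun r => by
      rw [IsScalarTower.algebraMap_apply R R[X] P1]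
      change _ = ψ _
      rw [hψ]
      exact ((aeval s : R[X] →ₐ[R] S).commutes r).symm
    have t3 : IsScalarTower R P1 M := IsScalarTower.of_algebraMap_smul fun r x => by
      rw [← algebraMap_smul S (algebraMap R P1 r) x, ← IsScalarTower.algebraMap_apply R P1 S,
        algebraMap_smul]
    have hle : Algebra.adjoin R {y | y ∈ s :: l} ≤
        (Algebra.adjoin P1 {y | y ∈ l}).restrictScalars R := by
      refine Algebra.adjoin_le fun y hy => ?_
      rcases List.mem_cons.1 hy with rfl | hy
      · have : algebraMap P1 S (algebraMap R[X] P1 X) = y := by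
          refine (hψ X).trans ?_
          simp [φ]
        have h2 := (Algebra.adjoin P1 {y | y ∈ l}).algebraMap_mem (algebraMap R[X] P1 X)
        rw [this] at h2
        exact h2
      · exact Algebra.subset_adjoin (R := P1) (s := {y | y ∈ l}) hy
    refine ih P1 (fun x => ?_) (ciw_poly s q hq hqs hψ hci) (stepX q hq hf)
    obtain ⟨t, ht, htu, hx⟩ := hgen x
    exact ⟨t, hle ht, htu, hle hx⟩

theorem ascent_aux {R S M : Type u} [CommRing R] [CommRing S] [IsLocalRing R] [IsLocalRing S]
    [IsNoetherianRing R] [IsNoetherianRing S] [Algebra R S] [IsLocalHom (algebraMap R S)]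
    [AddCommGroup M] [Module R M] [Module S M] [IsScalarTower R S M]
    [Algebra.EssFiniteType R S]
    (hci : IsCIAt R S (algebraMap R S) (maximalIdeal S)) (hfd : HasFiniteCIQDDim R M) :
    HasFiniteCIQDDim S M := by
  obtain ⟨σ, hσ⟩ := (Algebra.essFiniteType_iff R S).1 inferInstance
  refine ciqd_of_hf (main_ind σ.toList R (fun x => ?_) (ciw_iff.2 hci) (hf_of_ciqd hfd))
  have : {y | y ∈ σ.toList} = (σ : Set S) := by ext; simp
  rw [this]
  exact hσ x

end MainInd

variable (R S M : Type u) [CommRing R] [CommRing S]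
  [IsLocalRing R] [IsLocalRing S] [IsNoetherianRing R] [IsNoetherianRing S]
  [Algebra R S] [IsLocalHom (algebraMap R S)]
  [AddCommGroup M] [Module R M] [Module S M] [IsScalarTower R S M] [Module.Finite S M]

/-- Ascent of complete intersection flat dimension. -/
theorem ascent_cidimfd_of_eft_ci [Algebra.EssFiniteType R S]
    (hci : IsCIAt R S (algebraMap R S) (maximalIdeal S))
    
    (hfd : HasFiniteCIQDDim R M) :
    HasFiniteCIQDDim S M :=
  ascent_aux hci hfd
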